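/- Regularity of quotients of solutions of the conformal Laplace equation (Theorem 2.2, part (2), coordinate version): Let n ≥ 3 and let g be a metric on an open set U ⊆ ℝⁿ. Let u, f ∈ C²(U) satisfy L_g u = L_g f = 0 on U with f > 0 on U. If g is of class C^{k+α} on U for some k ∈ ℕ with k ≥ 2 and α ∈ (0,1), then the quotient u/f is of class C^{k+1+α} on U. If g is C^∞ on U, then u/f is C^∞ on U. If every entry of g is real-analytic on U, then u/f is real-analytic on U. -/

import Mathlib

noncomputable section

open Set Matrix Matrix

/-- Points of `ℝⁿ`. -/
abbrev Pt (n : ℕ) := Fin n → ℝ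

/-- A metric in coordinates: a matrix-valued map. -/
abbrev Met (n : ℕ) := Pt n → Matrix (Fin n) (Fin n) ℝ

/-- Partial derivative of `f` in the `a`-th coordinate direction. -/
def pd {n : ℕ} (a : Fin n) (f : Pt n → ℝ) (x : Pt n) : ℝ :=
  fderiv ℝ f x (Pi.single a 1)

/-- `g` is a metric (pointwise symmetric positive definite) on `U`. -/
def IsMetricOn {n : ℕ} (g : Met n) (U : Set (Pt n)) : Prop :=
  ∀ x ∈ U, (g x).IsSymm ∧ (g x).PosDef

/-- Christoffel symbols `Γ^c_{ab}` of `g`. -/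
def christoffel {n : ℕ} (g : Met n) (c a b : Fin n) (x : Pt n) : ℝ :=
  (1 / 2) * ∑ d, (g x)⁻¹ c d *
    (pd a (fun y => g y b d) x + pd b (fun y => g y a d) x - pd d (fun y => g y a b) x)

/-- Ricci tensor `R_{ab}` of `g`. -/
def ricci {n : ℕ} (g : Met n) (a b : Fin n) (x : Pt n) : ℝ :=
  (∑ c, pd c (christoffel g c a b) x) - (∑ c, pd a (christoffel g c c b) x)
    + (∑ c, ∑ d, christoffel g c a b x * christoffel g d d c x)
    - (∑ c, ∑ d, christoffel g d c b x * christoffel g c a d x)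

/-- Scalar curvature `R(g)`. -/
def scalarCurv {n : ℕ} (g : Met n) (x : Pt n) : ℝ :=
  ∑ a, ∑ b, (g x)⁻¹ a b * ricci g a b x

/-- Laplace–Beltrami operator `Δ_g`. -/
def laplaceBeltrami {n : ℕ} (g : Met n) (u : Pt n → ℝ) (x : Pt n) : ℝ :=
  -(Real.sqrt (g x).det)⁻¹ *
    ∑ a, pd a (fun y => Real.sqrt (g y).det * ∑ b, (g y)⁻¹ a b * pd b u y) x

/-- Conformal Laplacian `L_g`. -/
def confLap {n : ℕ} (g : Met n) (u : Pt n → ℝ) (x : Pt n) : ℝ :=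
  laplaceBeltrami g u x + (((n : ℝ) - 2) / (4 * ((n : ℝ) - 1))) * scalarCurv g x * u x

/-- `f` is of class `C^{k+α}` on `s`: it is `C^k` there and its `k`-th order derivatives are
locally `α`-Hölder continuous. -/
def CHolderOn {n : ℕ} (k : ℕ) (α : ℝ) (s : Set (Pt n)) (f : Pt n → ℝ) : Prop :=
  ContDiffOn ℝ k f s ∧
    ∀ x ∈ s, ∃ C : NNReal, ∃ t ∈ nhdsWithin x s,
      HolderOnWith C (Real.toNNReal α) (iteratedFDerivWithin ℝ k f s) t

/-- All entries of `g` are of class `C^{k+α}` on `s`. -/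
def MetCHolderOn {n : ℕ} (k : ℕ) (α : ℝ) (s : Set (Pt n)) (g : Met n) : Prop :=
  ∀ a b, CHolderOn k α s fun x => g x a b

/-- Contracted Christoffel symbol `Γ^a = g^{bc} Γ^a_{bc}`. -/
def gammaUp {n : ℕ} (g : Met n) (a : Fin n) (x : Pt n) : ℝ :=
  ∑ b, ∑ c, (g x)⁻¹ b c * christoffel g a b c x

/-- Contracted Christoffel symbol `Γ_a = g_{ab} Γ^b`. -/
def gammaLow {n : ℕ} (g : Met n) (a : Fin n) (x : Pt n) : ℝ :=
  ∑ b, g x a b * gammaUp g b x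

/-- `g` satisfies the conformal harmonic gauge on `U`. -/
def ConfHarmonicGauge {n : ℕ} (g : Met n) (U : Set (Pt n)) : Prop :=
  ∃ f : Pt n → ℝ, ContDiffOn ℝ 2 f U ∧ (∀ x ∈ U, 0 < f x) ∧
    (∀ x ∈ U, confLap g f x = 0) ∧
    ∀ a : Fin n, ∀ x ∈ U, gammaLow g a x = 2 * pd a (fun y => Real.log (f y)) x

/-- Determinant-normalized metric `ĝ = (det g)^{-1/n} g`. -/
def dnorm {n : ℕ} (g : Met n) : Met n :=
  fun x => ((g x).det ^ (-(1 : ℝ) / (n : ℝ))) • g x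

/-- Jacobian matrix of a map `Z : ℝⁿ → ℝⁿ`. -/
def jac {n : ℕ} (Z : Pt n → Pt n) (x : Pt n) : Matrix (Fin n) (Fin n) ℝ :=
  Matrix.of fun i j => pd j (fun y => Z y i) x

/-- Riemann curvature tensor `R_{abc}{}^{d}`. -/
def riemannUp {n : ℕ} (g : Met n) (a b c d : Fin n) (x : Pt n) : ℝ :=
  pd a (christoffel g d b c) x - pd b (christoffel g d a c) x
    + (∑ e, christoffel g e b c x * christoffel g d a e x)
    - (∑ e, christoffel g e a c x * christoffel g d b e x)

/-- Riemann curvature tensor `R_{abcd} = R_{abc}{}^{e} g_{ed}`. -/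
def riemannLow {n : ℕ} (g : Met n) (a b c d : Fin n) (x : Pt n) : ℝ :=
  ∑ e, riemannUp g a b c e x * g x e d

/-- Schouten tensor `P_{ab}`. -/
def schouten {n : ℕ} (g : Met n) (a b : Fin n) (x : Pt n) : ℝ :=
  (1 / ((n : ℝ) - 2)) * (ricci g a b x - (scalarCurv g x / (2 * ((n : ℝ) - 1))) * g x a b)

/-- Weyl tensor `W_{abcd}`. -/
def weyl {n : ℕ} (g : Met n) (a b c d : Fin n) (x : Pt n) : ℝ :=
  riemannLow g a b c d x + schouten g a c x * g x b d - schouten g b c x * g x a d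
    + schouten g b d x * g x a c - schouten g a d x * g x b c

/-- Weyl tensor with raised last index, `W_{abc}{}^{d} = g^{de} W_{abce}`. -/
def weylUp {n : ℕ} (g : Met n) (a b c d : Fin n) (x : Pt n) : ℝ :=
  ∑ e, (g x)⁻¹ d e * weyl g a b c e x

/-- Covariant derivative of a 2-tensor: `(∇T)_{cab} = ∇_c T_{ab}`. -/
def cov2 {n : ℕ} (g : Met n) (T : Fin n → Fin n → Pt n → ℝ) (c a b : Fin n) (x : Pt n) : ℝ :=
  pd c (T a b) x - (∑ d, christoffel g d c a x * T d b x)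
    - ∑ d, christoffel g d c b x * T a d x

/-- Covariant derivative of a 3-tensor: `(∇T)_{dabc} = ∇_d T_{abc}`. -/
def cov3 {n : ℕ} (g : Met n) (T : Fin n → Fin n → Fin n → Pt n → ℝ) (d a b c : Fin n)
    (x : Pt n) : ℝ :=
  pd d (T a b c) x - (∑ e, christoffel g e d a x * T e b c x)
    - (∑ e, christoffel g e d b x * T a e c x)
    - ∑ e, christoffel g e d c x * T a b e x

/-- Cotton tensor `C_{abc} = ∇_a P_{bc} - ∇_b P_{ac}`. -/
def cotton {n : ℕ} (g : Met n) (a b c : Fin n) (x : Pt n) : ℝ :=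
  cov2 g (schouten g) a b c x - cov2 g (schouten g) b a c x

/-- Bach tensor `B_{ab}`. -/
def bach {n : ℕ} (g : Met n) (a b : Fin n) (x : Pt n) : ℝ :=
  (∑ c, ∑ d, (g x)⁻¹ c d *
      (cov3 g (cov2 g (schouten g)) d a b c x - cov3 g (cov2 g (schouten g)) d c a b x))
    + ∑ c, ∑ d, ∑ e, ∑ f, (g x)⁻¹ c e * (g x)⁻¹ d f * schouten g e f x * weyl g a c d b x

namespace EllipticReg

open MeasureTheory Filter Topology
open scoped ContDiff

section PartialDerivatives

variable {n : ℕ}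

theorem _root_.HasFDerivAt.pd_eq {f : Pt n → ℝ} {L : Pt n →L[ℝ] ℝ} {x : Pt n}
    (h : HasFDerivAt f L x) (i : Fin n) : pd i f x = L (Pi.single i 1) := by
  rw [pd, h.fderiv]

theorem clm_apply_eq_sum (L : Pt n →L[ℝ] ℝ) (v : Pt n) :
    L v = ∑ i, v i * L (Pi.single i 1) := by
  conv_lhs => rw [← Finset.univ_sum_single v]
  rw [map_sum]
  refine Finset.sum_congr rfl fun i _ => ?_
  rw [← mul_one (v i), ← smul_eq_mul, Pi.single_smul, map_smul]
  simp

theorem fderiv_apply_eq_sum (f : Pt n → ℝ) (x v : Pt n) :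
    fderiv ℝ f x v = ∑ i, v i * pd i f x := clm_apply_eq_sum _ v

theorem pd_add {f h : Pt n → ℝ} {x : Pt n} (hf : DifferentiableAt ℝ f x)
    (hh : DifferentiableAt ℝ h x) (i : Fin n) :
    pd i (fun y => f y + h y) x = pd i f x + pd i h x := by
  have h := hf.hasFDerivAt.fun_add hh.hasFDerivAt
  rw [h.pd_eq]; rfl

theorem pd_mul {f h : Pt n → ℝ} {x : Pt n} (hf : DifferentiableAt ℝ f x)
    (hh : DifferentiableAt ℝ h x) (i : Fin n) :
    pd i (fun y => f y * h y) x = pd i f x * h x + f x * pd i h x := by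
  have h := hf.hasFDerivAt.fun_mul hh.hasFDerivAt
  rw [h.pd_eq]
  simp [pd]; ring

theorem pd_const_mul {f : Pt n → ℝ} {x : Pt n} (c : ℝ) (hf : DifferentiableAt ℝ f x)
    (i : Fin n) : pd i (fun y => c * f y) x = c * pd i f x := by
  rw [(hf.hasFDerivAt.const_mul c).pd_eq]; rfl

theorem pd_sum {ι : Type*} (s : Finset ι) {f : ι → Pt n → ℝ} {x : Pt n}
    (hf : ∀ a ∈ s, DifferentiableAt ℝ (f a) x) (i : Fin n) :
    pd i (fun y => ∑ a ∈ s, f a y) x = ∑ a ∈ s, pd i (f a) x := by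
  rw [(HasFDerivAt.fun_sum fun a ha => (hf a ha).hasFDerivAt).pd_eq]
  simp [pd]

theorem _root_.Filter.EventuallyEq.pd_eq {f h : Pt n → ℝ} {x : Pt n} (hfh : f =ᶠ[𝓝 x] h)
    (i : Fin n) : pd i f x = pd i h x := by
  rw [pd, pd, hfh.fderiv_eq]

theorem _root_.Filter.EventuallyEq.pd {f h : Pt n → ℝ} {x : Pt n} (hfh : f =ᶠ[𝓝 x] h)
    (i : Fin n) : pd i f =ᶠ[𝓝 x] pd i h :=
  hfh.eventuallyEq_nhds.mono fun _ hy => hy.pd_eq i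

theorem contDiff_pd {m k : WithTop ℕ∞} {f : Pt n → ℝ} (hf : ContDiff ℝ k f) (hm : m + 1 ≤ k)
    (i : Fin n) : ContDiff ℝ m (pd i f) :=
  (hf.fderiv_right hm).clm_apply contDiff_const

theorem contDiffAt_pd {m k : WithTop ℕ∞} {f : Pt n → ℝ} {x : Pt n} (hf : ContDiffAt ℝ k f x)
    (hm : m + 1 ≤ k) (i : Fin n) : ContDiffAt ℝ m (pd i f) x :=
  (hf.fderiv_right hm).clm_apply contDiffAt_const

theorem contDiffOn_pd {m k : WithTop ℕ∞} {U : Set (Pt n)} (hU : IsOpen U) {f : Pt n → ℝ}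
    (hf : ContDiffOn ℝ k f U) (hm : m + 1 ≤ k) (i : Fin n) : ContDiffOn ℝ m (pd i f) U :=
  fun _ hx => (contDiffAt_pd (hf.contDiffAt (hU.mem_nhds hx)) hm i).contDiffWithinAt

theorem pd_comm {f : Pt n → ℝ} {x : Pt n} (hf : ContDiffAt ℝ 2 f x) (i j : Fin n) :
    pd i (pd j f) x = pd j (pd i f) x := by
  have h := (hf.isSymmSndFDerivAt (by simp)).eq (Pi.single i 1) (Pi.single j 1)
  have hd : DifferentiableAt ℝ (fderiv ℝ f) x :=
    (hf.fderiv_right (m := 1) (by norm_num)).differentiableAt (by norm_num)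
  have key : ∀ k l : Fin n, pd k (pd l f) x
      = fderiv ℝ (fderiv ℝ f) x (Pi.single k 1) (Pi.single l 1) := by
    intro k l
    have h2 := hd.hasFDerivAt.clm_apply (hasFDerivAt_const (Pi.single l (1 : ℝ) : Pt n) x)
    have h3 : HasFDerivAt (pd l f) _ x := h2
    rw [h3.pd_eq]; simp
  rw [key, key, h]

theorem tsupport_pd_subset (f : Pt n → ℝ) (i : Fin n) : tsupport (pd i f) ⊆ tsupport f := by
  refine (closure_mono ?_).trans (tsupport_fderiv_subset ℝ (f := f))
  intro x hx h0
  exact hx (by simp [pd, h0])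

theorem hasCompactSupport_pd {f : Pt n → ℝ} (hf : HasCompactSupport f) (i : Fin n) :
    HasCompactSupport (pd i f) :=
  hf.of_isClosed_subset (isClosed_tsupport _) (tsupport_pd_subset f i)

theorem norm_fderiv_le_of_pd_le {f : Pt n → ℝ} {x : Pt n} {B : ℝ} (hB : ∀ i, |pd i f x| ≤ B) :
    ‖fderiv ℝ f x‖ ≤ n * |B| := by
  refine ContinuousLinearMap.opNorm_le_bound _ (by positivity) fun v => ?_
  rw [fderiv_apply_eq_sum, Real.norm_eq_abs]
  calc |∑ i, v i * pd i f x| ≤ ∑ i : Fin n, ‖v‖ * |B| := by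
        refine (Finset.abs_sum_le_sum_abs _ _).trans (Finset.sum_le_sum fun i _ => ?_)
        rw [abs_mul]
        exact mul_le_mul (norm_le_pi_norm v i) ((hB i).trans (le_abs_self B)) (abs_nonneg _)
          (norm_nonneg _)
    _ = n * |B| * ‖v‖ := by simp; ring

/-- A bound on all partial derivatives on a convex set gives a Lipschitz bound. -/
theorem abs_sub_le_of_pd_le {f : Pt n → ℝ} {s : Set (Pt n)} (hs : Convex ℝ s) {B : ℝ}
    (hB0 : 0 ≤ B) (hf : ∀ x ∈ s, DifferentiableAt ℝ f x) (hB : ∀ i, ∀ x ∈ s, |pd i f x| ≤ B)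
    {x y : Pt n} (hx : x ∈ s) (hy : y ∈ s) : |f x - f y| ≤ n * B * ‖x - y‖ := by
  have h := hs.norm_image_sub_le_of_norm_fderiv_le (𝕜 := ℝ) (f := f) (C := n * |B|) hf
    (fun z hz => norm_fderiv_le_of_pd_le fun i => hB i z hz) hy hx
  rwa [abs_of_nonneg hB0] at h

/-- Partial derivatives integrate by parts against compactly supported functions. -/
theorem integral_mul_pd_eq_neg {κ h : Pt n → ℝ} (hκ : ContDiff ℝ 1 κ)
    (hκc : HasCompactSupport κ) (hh : ContDiff ℝ 1 h) (i : Fin n) :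
    ∫ y, κ y * pd i h y = -∫ y, pd i κ y * h y := by
  have c1 : Continuous (pd i κ) := (contDiff_pd (m := 0) hκ (by norm_num) i).continuous
  have c2 : Continuous (pd i h) := (contDiff_pd (m := 0) hh (by norm_num) i).continuous
  refine integral_mul_fderiv_eq_neg_fderiv_mul_of_integrable ?_ ?_ ?_ ?_ ?_
  · exact (c1.mul hh.continuous).integrable_of_hasCompactSupport
      ((hasCompactSupport_pd hκc i).mul_right)
  · exact (hκ.continuous.mul c2).integrable_of_hasCompactSupport hκc.mul_right
  · exact (hκ.continuous.mul hh.continuous).integrable_of_hasCompactSupport hκc.mul_right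
  · exact fun x _ => hκ.differentiable (by norm_num) x
  · exact fun x _ => hh.differentiable (by norm_num) x

theorem integral_pd_eq_zero {κ : Pt n → ℝ} (hκ : ContDiff ℝ 1 κ)
    (hκc : HasCompactSupport κ) (i : Fin n) : ∫ y, pd i κ y = 0 := by
  have h := integral_mul_pd_eq_neg hκ hκc (contDiff_const (c := (1 : ℝ))) i
  have h0 : ∀ y, pd i (fun _ : Pt n => (1 : ℝ)) y = 0 := fun y => by simp [pd]
  simp only [h0, mul_zero, integral_zero, mul_one] at h
  linarith

end PartialDerivatives

section Averages

variable {n : ℕ}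

/-- The average `∫ κ(y) g(x - t y) dy` of `g` at scale `t` against the kernel `κ`. -/
def avg (κ : Pt n → ℝ) (t : ℝ) (g : Pt n → ℝ) (x : Pt n) : ℝ := ∫ y, κ y * g (x - t • y)

variable {κ g : Pt n → ℝ}

theorem integrable_avg (hκ : Continuous κ) (hκc : HasCompactSupport κ) (hg : Continuous g)
    (t : ℝ) (x : Pt n) : Integrable fun y => κ y * g (x - t • y) :=
  (hκ.mul (hg.comp (by fun_prop))).integrable_of_hasCompactSupport hκc.mul_right

theorem avg_zero (x : Pt n) : avg κ 0 g x = (∫ y, κ y) * g x := by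
  simp [avg, integral_mul_const]

theorem avg_const_mul (c : ℝ) (t : ℝ) (x : Pt n) :
    avg κ t (fun y => c * g y) x = c * avg κ t g x := by
  simp only [avg, ← integral_const_mul]
  congr 1; ext y; ring

theorem avg_sum {ι : Type*} (s : Finset ι) {h : ι → Pt n → ℝ} (hκ : Continuous κ)
    (hκc : HasCompactSupport κ) (hh : ∀ a ∈ s, Continuous (h a)) (t : ℝ) (x : Pt n) :
    avg κ t (fun y => ∑ a ∈ s, h a y) x = ∑ a ∈ s, avg κ t (h a) x := by
  simp only [avg, Finset.mul_sum]
  exact integral_finsetSum _ fun a ha => integrable_avg hκ hκc (hh a ha) t x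

theorem abs_avg_le (hκ : Continuous κ) (hκc : HasCompactSupport κ) {M : ℝ}
    (hg : ∀ x, |g x| ≤ M) (t : ℝ) (x : Pt n) : |avg κ t g x| ≤ (∫ y, |κ y|) * M := by
  rw [avg, ← integral_mul_const M fun y : Pt n => |κ y|]
  rw [← Real.norm_eq_abs]
  refine norm_integral_le_of_norm_le ?_ (ae_of_all _ fun y => ?_)
  · exact (hκ.abs.integrable_of_hasCompactSupport hκc.norm).mul_const M
  · rw [norm_mul]
    exact mul_le_mul_of_nonneg_left (hg _) (abs_nonneg _)

theorem abs_avg_sub_avg_le (hκ : Continuous κ) (hκc : HasCompactSupport κ)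
    (hgc : Continuous g) {M : ℝ} {x y : Pt n}
    (hg : ∀ z, |g (x - z) - g (y - z)| ≤ M) (t : ℝ) :
    |avg κ t g x - avg κ t g y| ≤ (∫ y, |κ y|) * M := by
  rw [← integral_mul_const M fun y : Pt n => |κ y|, avg, avg, ← integral_sub (integrable_avg hκ hκc hgc t x)
    (integrable_avg hκ hκc hgc t y)]
  rw [← Real.norm_eq_abs]
  refine norm_integral_le_of_norm_le ?_ (ae_of_all _ fun z => ?_)
  · exact (hκ.abs.integrable_of_hasCompactSupport hκc.norm).mul_const M
  · rw [← mul_sub, norm_mul]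
    exact mul_le_mul_of_nonneg_left (hg _) (abs_nonneg _)

/-- Averages against a kernel of mean zero are small on Hölder functions. -/
theorem abs_avg_le_of_integral_eq_zero (hκ : Continuous κ) (hκc : HasCompactSupport κ)
    (hκ0 : ∫ y, κ y = 0) (hgc : Continuous g) {α M : ℝ} (hα : 0 < α)
    (hg : ∀ x y, |g x - g y| ≤ M * ‖x - y‖ ^ α) {t : ℝ} (ht : 0 ≤ t) (x : Pt n) :
    |avg κ t g x| ≤ (∫ y, |κ y| * ‖y‖ ^ α) * M * t ^ α := by
  have h0 : avg κ t g x = ∫ y, κ y * (g (x - t • y) - g x) := by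
    have := integral_sub (integrable_avg hκ hκc hgc t x)
      ((hκ.integrable_of_hasCompactSupport hκc).mul_const (g x))
    rw [integral_mul_const, hκ0, zero_mul, sub_zero] at this
    rw [avg, ← this]
    congr 1; ext y; ring
  rw [h0, mul_assoc, ← integral_mul_const _ fun y : Pt n => |κ y| * ‖y‖ ^ α]
  have hc : Continuous fun y : Pt n => ‖y‖ ^ α :=
    continuous_norm.rpow_const fun _ => Or.inr hα.le
  rw [← Real.norm_eq_abs]
  refine norm_integral_le_of_norm_le ?_ (ae_of_all _ fun y => ?_)
  · exact ((hκ.abs.mul hc).integrable_of_hasCompactSupport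
      (hκc.norm.mul_right)).mul_const _
  · rw [norm_mul, mul_assoc]
    refine mul_le_mul_of_nonneg_left ?_ (abs_nonneg _)
    refine (hg _ _).trans (le_of_eq ?_)
    rw [sub_sub_cancel_left, norm_neg, norm_smul, Real.norm_eq_abs, abs_of_nonneg ht,
      Real.mul_rpow ht (norm_nonneg _)]
    ring

theorem avg_eq_convolution {t : ℝ} (ht : 0 < t) :
    avg κ t g = fun x => (t ^ n)⁻¹ * convolution (fun y => κ (t⁻¹ • y)) g
      (ContinuousLinearMap.mul ℝ ℝ) volume x := by
  ext x
  have h := Measure.integral_comp_smul (volume : Measure (Pt n))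
    (fun y => κ (t⁻¹ • y) * g (x - y)) t
  simp only [smul_smul, inv_mul_cancel₀ ht.ne', one_smul] at h
  rw [avg, h]
  simp [convolution_def, abs_of_pos ht]

theorem hasCompactSupport_scale (hκc : HasCompactSupport κ) {t : ℝ} (ht : 0 < t) :
    HasCompactSupport fun y => κ (t⁻¹ • y) :=
  hκc.comp_homeomorph (Homeomorph.smulOfNeZero t⁻¹ (inv_ne_zero ht.ne'))

theorem contDiff_avg (hκ : ContDiff ℝ ∞ κ) (hκc : HasCompactSupport κ) (hg : Continuous g)
    {t : ℝ} (ht : 0 < t) : ContDiff ℝ ∞ (avg κ t g) := by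
  rw [avg_eq_convolution ht]
  refine contDiff_const.mul ?_
  exact (hasCompactSupport_scale hκc ht).contDiff_convolution_left (n := ⊤) _
    (hκ.comp (contDiff_const_smul t⁻¹)) hg.locallyIntegrable

theorem pd_avg_eq_kernel (hκ : ContDiff ℝ ∞ κ) (hκc : HasCompactSupport κ) (hg : Continuous g)
    {t : ℝ} (ht : 0 < t) (i : Fin n) (x : Pt n) :
    pd i (avg κ t g) x = t⁻¹ * avg (pd i κ) t g x := by
  have hκt : ContDiff ℝ 1 fun y => κ (t⁻¹ • y) :=
    (hκ.of_le (by exact_mod_cast le_top)).comp (contDiff_const_smul t⁻¹)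
  have h := ((hasCompactSupport_scale hκc ht).hasFDerivAt_convolution_left
    (ContinuousLinearMap.mul ℝ ℝ) hκt (hg.locallyIntegrable (μ := volume)) x).const_mul
    ((t ^ n)⁻¹)
  rw [← avg_eq_convolution ht] at h
  rw [h.pd_eq, avg_eq_convolution ht]
  have hd : ∀ y, fderiv ℝ (fun y => κ (t⁻¹ • y)) y = t⁻¹ • fderiv ℝ κ (t⁻¹ • y) :=
    fun y => by rw [fderiv_comp_smul]
  have hi := ((hasCompactSupport_scale hκc ht).fderiv ℝ).convolutionExists_left
    ((ContinuousLinearMap.mul ℝ ℝ).precompL (Pt n)) (μ := volume)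
    (hκt.continuous_fderiv (by norm_num)) hg.locallyIntegrable x
  simp only [_root_.smul_apply, convolution_def, smul_eq_mul]
  rw [ContinuousLinearMap.integral_apply hi]
  rw [mul_left_comm, ← integral_const_mul t⁻¹]
  congr 2; funext y
  simp [hd, pd]

end Averages

section ScaleDerivative

variable {n : ℕ} {κ g : Pt n → ℝ}

theorem pd_comp_sub_smul (hg : Differentiable ℝ g) (x : Pt n) (t : ℝ) (y : Pt n) (i : Fin n) :
    pd i (fun y => g (x - t • y)) y = -t * pd i g (x - t • y) := by
  have h1 : HasFDerivAt (fun y : Pt n => x - t • y) (-(t • ContinuousLinearMap.id ℝ (Pt n))) y :=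
    ((hasFDerivAt_id y).const_smul t).const_sub x
  have h2 := (hg (x - t • y)).hasFDerivAt.comp y h1
  have h3 : HasFDerivAt (fun y => g (x - t • y)) _ y := h2
  rw [h3.pd_eq]
  simp [pd]

theorem avg_pd_kernel (hκ : ContDiff ℝ 1 κ) (hκc : HasCompactSupport κ) (hg : ContDiff ℝ 1 g)
    (t : ℝ) (i : Fin n) (x : Pt n) : avg (pd i κ) t g x = t * avg κ t (pd i g) x := by
  have h := integral_mul_pd_eq_neg hκ hκc (h := fun y => g (x - t • y))
    (hg.comp (by fun_prop)) i
  simp only [pd_comp_sub_smul (hg.differentiable (by norm_num))] at h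
  rw [avg, ← neg_eq_iff_eq_neg.mpr h, avg, ← integral_const_mul, ← integral_neg]
  congr 1; ext y; ring

theorem pd_avg (hκ : ContDiff ℝ ∞ κ) (hκc : HasCompactSupport κ) (hg : ContDiff ℝ 1 g)
    {t : ℝ} (ht : 0 < t) (i : Fin n) (x : Pt n) :
    pd i (avg κ t g) x = avg κ t (pd i g) x := by
  rw [pd_avg_eq_kernel hκ hκc hg.continuous ht,
    avg_pd_kernel (hκ.of_le (by exact_mod_cast le_top)) hκc hg, ← mul_assoc,
    inv_mul_cancel₀ ht.ne', one_mul]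

theorem continuous_avg_scale (hκ : Continuous κ) (hκc : HasCompactSupport κ) (hg : Continuous g)
    {M : ℝ} (hM : ∀ x, |g x| ≤ M) (x : Pt n) : Continuous fun t => avg κ t g x := by
  refine continuous_of_dominated (bound := fun y => |κ y| * M) (fun t => ?_) (fun t => ?_) ?_ ?_
  · exact (integrable_avg hκ hκc hg t x).aestronglyMeasurable
  · refine ae_of_all _ fun y => ?_
    rw [norm_mul]
    exact mul_le_mul_of_nonneg_left (hM _) (abs_nonneg _)
  · exact (hκ.abs.integrable_of_hasCompactSupport hκc.norm).mul_const M
  · exact ae_of_all _ fun y => by fun_prop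

theorem hasDerivAt_avg_scale (hκ : Continuous κ) (hκc : HasCompactSupport κ)
    (hg : ContDiff ℝ 1 g) {M : ℝ} (hM : ∀ i x, |pd i g x| ≤ M) (t : ℝ) (x : Pt n) :
    HasDerivAt (fun t => avg κ t g x) (-∑ i, avg (fun y => y i * κ y) t (pd i g) x) t := by
  have hpc : ∀ i, Continuous (pd i g) :=
    fun i => (contDiff_pd (m := 0) hg (by norm_num) i).continuous
  have hsum : -∑ i, avg (fun y => y i * κ y) t (pd i g) x
      = ∫ y, κ y * -∑ i, y i * pd i g (x - t • y) := by
    simp only [avg]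
    rw [← integral_finsetSum, ← integral_neg]
    · congr 1; ext y
      rw [mul_neg, Finset.mul_sum]
      congr 1; refine Finset.sum_congr rfl fun i _ => by ring
    · intro i _
      exact integrable_avg (by fun_prop) (hκc.mul_left) (hpc i) t x
  rw [hsum]
  refine (hasDerivAt_integral_of_dominated_loc_of_deriv_le (μ := volume) (s := univ)
    (bound := fun y => |κ y| * (‖y‖ * (n * |M|)))
    (F := fun t y => κ y * g (x - t • y)) (F' := fun t y => κ y * -∑ i, y i * pd i g (x - t • y))
    (x₀ := t) univ_mem ?_ ?_ ?_ ?_ ?_ ?_).2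
  · exact Eventually.of_forall fun t =>
      (integrable_avg hκ hκc hg.continuous t x).aestronglyMeasurable
  · exact integrable_avg hκ hκc hg.continuous t x
  · refine (Continuous.aestronglyMeasurable ?_)
    refine hκ.mul (continuous_finsetSum _ fun i _ => ?_).neg
    exact (continuous_apply i).mul ((hpc i).comp (by fun_prop))
  · refine ae_of_all _ fun y s _ => ?_
    rw [norm_mul, norm_neg]
    refine mul_le_mul_of_nonneg_left ?_ (abs_nonneg _)
    have h1 := (fderiv ℝ g (x - s • y)).le_opNorm y
    rw [fderiv_apply_eq_sum] at h1
    refine h1.trans ?_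
    rw [mul_comm]
    exact mul_le_mul_of_nonneg_left (norm_fderiv_le_of_pd_le fun i => hM i _) (norm_nonneg _)
  · exact (hκ.abs.mul (continuous_norm.mul continuous_const)).integrable_of_hasCompactSupport
      hκc.norm.mul_right
  · refine ae_of_all _ fun y s _ => ?_
    have h1 : HasDerivAt (fun s : ℝ => x - s • y) (-y) s := by
      simpa using ((hasDerivAt_id s).smul_const y).const_sub x
    have h2 := ((hg.differentiable (by norm_num)) (x - s • y)).hasFDerivAt.comp_hasDerivAt s h1
    rw [map_neg, fderiv_apply_eq_sum] at h2
    exact h2.const_mul (κ y)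

theorem bounded_of_hasCompactSupport {f : Pt n → ℝ} (hf : Continuous f)
    (hfc : HasCompactSupport f) : ∃ M, 0 ≤ M ∧ ∀ x, |f x| ≤ M := by
  obtain ⟨C, hC⟩ := hf.bounded_above_of_compact_support hfc
  exact ⟨C, (norm_nonneg _).trans (hC 0), hC⟩

theorem bounded_family_of_hasCompactSupport {ι : Type*} [Finite ι] {f : ι → Pt n → ℝ}
    (hf : ∀ i, Continuous (f i)) (hfc : ∀ i, HasCompactSupport (f i)) :
    ∃ M, 0 ≤ M ∧ ∀ i x, |f i x| ≤ M := by
  choose M hM0 hM using fun i => bounded_of_hasCompactSupport (hf i) (hfc i)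
  cases nonempty_fintype ι
  exact ⟨∑ i, M i, Finset.sum_nonneg fun i _ => hM0 i, fun i x => (hM i x).trans
    (Finset.single_le_sum (fun j _ => hM0 j) (Finset.mem_univ i))⟩

/-- Representation of a function through the operator `∑ Aᵢⱼ ∂ᵢ∂ⱼ` and a pair of kernels. -/
theorem avg_sub_self_eq_integral {A : Fin n → Fin n → ℝ} {φ η v : Pt n → ℝ}
    (hφ : Continuous φ) (hφc : HasCompactSupport φ) (hη : ContDiff ℝ 1 η)
    (hηc : HasCompactSupport η) (hφ1 : ∫ y, φ y = 1)
    (hφη : ∀ i y, y i * φ y = -∑ j, A i j * pd j η y)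
    (hv : ContDiff ℝ 2 v) (hvc : HasCompactSupport v) (x : Pt n) :
    avg φ 1 v x - v x
      = ∫ t in (0 : ℝ)..1, t * avg η t (fun z => ∑ i, ∑ j, A i j * pd j (pd i v) z) x := by
  have hpd1 : ∀ i, ContDiff ℝ 1 (pd i v) := fun i => contDiff_pd hv (by norm_num) i
  have hpdc : ∀ i, HasCompactSupport (pd i v) := hasCompactSupport_pd hvc
  have hpd2 : ∀ i j, Continuous (pd j (pd i v)) :=
    fun i j => (contDiff_pd (m := 0) (hpd1 i) (by norm_num) j).continuous
  have hg : Continuous fun z => ∑ i, ∑ j, A i j * pd j (pd i v) z :=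
    continuous_finsetSum _ fun i _ => continuous_finsetSum _ fun j _ =>
      continuous_const.mul (hpd2 i j)
  obtain ⟨M, -, hM⟩ := bounded_family_of_hasCompactSupport (fun i => (hpd1 i).continuous) hpdc
  have hgb : ∃ B, ∀ z, |∑ i, ∑ j, A i j * pd j (pd i v) z| ≤ B := by
    obtain ⟨B, -, hB⟩ := bounded_family_of_hasCompactSupport
      (f := fun p : Fin n × Fin n => pd p.2 (pd p.1 v)) (fun p => hpd2 p.1 p.2)
      (fun p => hasCompactSupport_pd (hpdc p.1) p.2)
    refine ⟨∑ i, ∑ j, |A i j| * B, fun z => ?_⟩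
    refine (Finset.abs_sum_le_sum_abs _ _).trans (Finset.sum_le_sum fun i _ => ?_)
    refine (Finset.abs_sum_le_sum_abs _ _).trans (Finset.sum_le_sum fun j _ => ?_)
    rw [abs_mul]
    exact mul_le_mul_of_nonneg_left (hB (i, j) z) (abs_nonneg _)
  obtain ⟨B, hB⟩ := hgb
  have hd : ∀ t, HasDerivAt (fun t => avg φ t v x)
      (t * avg η t (fun z => ∑ i, ∑ j, A i j * pd j (pd i v) z) x) t := by
    intro t
    convert hasDerivAt_avg_scale hφ hφc (hv.of_le (by norm_num)) hM t x using 1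
    rw [avg_sum (h := fun i z => ∑ j, A i j * pd j (pd i v) z) _ hη.continuous hηc
      fun i _ => continuous_finsetSum _ fun j _ => continuous_const.mul (hpd2 i j),
      Finset.mul_sum, ← Finset.sum_neg_distrib]
    refine Finset.sum_congr rfl fun i _ => ?_
    rw [avg_sum (h := fun j z => A i j * pd j (pd i v) z) _ hη.continuous hηc
      fun j _ => continuous_const.mul (hpd2 i j), Finset.mul_sum]
    simp only [avg_const_mul, mul_left_comm t, ← avg_pd_kernel hη hηc (hpd1 i)]
    simp only [avg, hφη]
    rw [← integral_neg]
    simp only [neg_mul, neg_neg, Finset.sum_mul, ← integral_const_mul]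
    rw [← integral_finsetSum]
    · simp only [mul_assoc]
    · intro j _
      exact (integrable_avg (contDiff_pd (m := 0) hη (by norm_num) j).continuous
        (hasCompactSupport_pd hηc j) (hpd1 i).continuous t x).const_mul _
  rw [intervalIntegral.integral_eq_sub_of_hasDerivAt (fun t _ => hd t), avg_zero, hφ1, one_mul]
  exact (continuous_id.mul (continuous_avg_scale hη.continuous hηc hg hB x)).intervalIntegrable _ _

end ScaleDerivative

section Kernels

variable {n : ℕ}

theorem posDef_quadratic_pos {B : Fin n → Fin n → ℝ} (hB : (Matrix.of B).PosDef) {y : Pt n}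
    (hy : y ≠ 0) : 0 < ∑ i, ∑ j, y i * B i j * y j := by
  have h := hB.dotProduct_mulVec_pos hy
  simp only [dotProduct, mulVec, Matrix.of_apply, Pi.star_apply, star_trivial,
    Finset.mul_sum] at h
  simpa [mul_assoc] using h

theorem exists_quadratic_lower_bound {B : Fin n → Fin n → ℝ} (hB : (Matrix.of B).PosDef) :
    ∃ m > 0, ∀ y : Pt n, m * ‖y‖ ^ 2 ≤ ∑ i, ∑ j, y i * B i j * y j := by
  have hQ : Continuous fun y : Pt n => ∑ i, ∑ j, y i * B i j * y j := by fun_prop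
  rcases (Metric.sphere (0 : Pt n) 1).eq_empty_or_nonempty with he | hne
  · refine ⟨1, one_pos, fun y => ?_⟩
    by_cases hy : y = 0
    · simp [hy]
    · exfalso
      have : ‖y‖⁻¹ • y ∈ Metric.sphere (0 : Pt n) 1 := by
        simp [norm_smul, inv_mul_cancel₀ (norm_ne_zero_iff.mpr hy)]
      rw [he] at this
      exact this
  · obtain ⟨z, hz, hmin⟩ := (isCompact_sphere (0 : Pt n) 1).exists_isMinOn hne hQ.continuousOn
    have hz0 : z ≠ 0 := by
      rintro rfl
      simp at hz
    refine ⟨_, posDef_quadratic_pos hB hz0, fun y => ?_⟩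
    by_cases hy : y = 0
    · simp [hy]
    · have hyn := norm_ne_zero_iff.mpr hy
      have hs : ‖y‖⁻¹ • y ∈ Metric.sphere (0 : Pt n) 1 := by
        simp [norm_smul, inv_mul_cancel₀ hyn]
      have h1 := hmin hs
      simp only [mem_ofPred_eq, Pi.smul_apply, smul_eq_mul] at h1
      have h2 := mul_le_mul_of_nonneg_right h1 (sq_nonneg ‖y‖)
      refine h2.trans (le_of_eq ?_)
      simp only [Finset.sum_mul]
      refine Finset.sum_congr rfl fun i _ => Finset.sum_congr rfl fun j _ => ?_
      field_simp

theorem hasFDerivAt_quadratic (B : Fin n → Fin n → ℝ) (y : Pt n) :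
    HasFDerivAt (fun y : Pt n => ∑ i, ∑ j, y i * B i j * y j)
      (∑ i, ∑ j, ((y i * B i j) • ContinuousLinearMap.proj (R := ℝ) (φ := fun _ => ℝ) j
        + y j • (B i j • ContinuousLinearMap.proj (R := ℝ) (φ := fun _ => ℝ) i))) y := by
  refine HasFDerivAt.fun_sum fun i _ => HasFDerivAt.fun_sum fun j _ => ?_
  exact ((hasFDerivAt_apply i y).mul_const (B i j)).mul (hasFDerivAt_apply j y)

theorem exists_kernels [NeZero n] {A : Fin n → Fin n → ℝ} (hA : (Matrix.of A).PosDef) :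
    ∃ φ η : Pt n → ℝ, ContDiff ℝ ∞ φ ∧ HasCompactSupport φ ∧ ContDiff ℝ ∞ η ∧
      HasCompactSupport η ∧ ∫ y, φ y = 1 ∧ ∀ i y, y i * φ y = -∑ j, A i j * pd j η y := by
  classical
  obtain ⟨B, hBA⟩ : ∃ B : Fin n → Fin n → ℝ, Matrix.of B = (Matrix.of A)⁻¹ :=
    ⟨fun i j => (Matrix.of A)⁻¹ i j, rfl⟩
  have hB : (Matrix.of B).PosDef := hBA ▸ hA.inv
  have hBs : ∀ i j, B i j = B j i := fun i j => by
    have := hB.isHermitian.apply i j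
    simpa using this.symm
  have hAB : ∀ i k, ∑ j, A i j * B j k = if i = k then 1 else 0 := fun i k => by
    have := congrFun (congrFun (Matrix.mul_nonsing_inv (Matrix.of A)
      ((Matrix.isUnit_iff_isUnit_det _).mp hA.isUnit)) i) k
    rw [← hBA] at this
    simpa [Matrix.mul_apply, Matrix.one_apply] using this
  obtain ⟨m, hm, hmQ⟩ := exists_quadratic_lower_bound hB
  set Q : Pt n → ℝ := fun y => ∑ i, ∑ j, y i * B i j * y j with hQ
  have hQs : ContDiff ℝ ∞ Q := by
    refine ContDiff.sum fun i _ => ContDiff.sum fun j _ => ?_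
    exact ((contDiff_apply ℝ ℝ i).mul contDiff_const).mul (contDiff_apply ℝ ℝ j)
  have hpdQ : ∀ j y, pd j Q y = 2 * ∑ k, B j k * y k := by
    intro j y
    rw [(hasFDerivAt_quadratic B y).pd_eq]
    simp only [_root_.sum_apply, _root_.add_apply,
      _root_.smul_apply, ContinuousLinearMap.proj_apply, smul_eq_mul,
      Finset.sum_add_distrib, Pi.single_apply, mul_ite, mul_one, mul_zero,
      Finset.sum_ite_eq', Finset.mem_univ, if_true]
    rw [two_mul]
    congr 1
    · exact Finset.sum_congr rfl fun k _ => by rw [hBs k j, mul_comm]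
    · rw [Finset.sum_comm]
      simp [mul_comm]
  have hbd : Bornology.IsBounded {y : Pt n | Q y ≤ 1} := by
    refine (Metric.isBounded_closedBall (x := (0 : Pt n)) (r := m⁻¹ + 1)).subset fun y hy => ?_
    rw [mem_closedBall_zero_iff]
    have h1 : m * ‖y‖ ^ 2 ≤ 1 := (hmQ y).trans hy
    have h2 : ‖y‖ ^ 2 ≤ m⁻¹ := by
      rw [← one_div, le_div_iff₀ hm]; linarith
    nlinarith [norm_nonneg y, sq_nonneg (‖y‖ - 1), inv_pos.mpr hm]
  have hT : ContDiff ℝ ∞ Real.smoothTransition := Real.smoothTransition.contDiff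
  have hT' : ContDiff ℝ ∞ (deriv Real.smoothTransition) :=
    (contDiff_infty_iff_deriv.mp hT).2
  have hT0 : ∀ s, s < 0 → deriv Real.smoothTransition s = 0 := fun s hs => by
    have : Real.smoothTransition =ᶠ[𝓝 s] fun _ => 0 :=
      (eventually_lt_nhds hs).mono fun z hz => Real.smoothTransition.zero_of_nonpos hz.le
    rw [this.deriv_eq]; simp
  have hcs : ∀ F : ℝ → ℝ, (∀ s < 0, F s = 0) → HasCompactSupport fun y => F (1 - Q y) := by
    intro F hF
    refine HasCompactSupport.intro' (K := {y | Q y ≤ 1}) ?_ ?_ ?_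
    · exact Metric.isCompact_of_isClosed_isBounded
        (isClosed_le hQs.continuous continuous_const) hbd
    · exact isClosed_le hQs.continuous continuous_const
    · intro y hy
      exact hF _ (by simp only [mem_ofPred_eq, not_le] at hy; linarith)
  set ψ : Pt n → ℝ := fun y => deriv Real.smoothTransition (1 - Q y) with hψ
  have hψs : ContDiff ℝ ∞ ψ := hT'.comp (contDiff_const.sub hQs)
  have hψc : HasCompactSupport ψ := hcs _ hT0
  have hψpos : 0 < ∫ y, ψ y := by
    obtain ⟨s, hs, hs1⟩ := exists_deriv_eq_slope Real.smoothTransition zero_lt_one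
      hT.continuous.continuousOn (hT.differentiable (by simp)).differentiableOn
    have hv0 : (Pi.single (0 : Fin n) 1 : Pt n) ≠ 0 := by simp
    have hq := posDef_quadratic_pos hB hv0
    set v : Pt n := Pi.single (0 : Fin n) 1
    have hQv : Q (√((1 - s) / Q v) • v) = 1 - s := by
      have h1 : ∀ r : ℝ, Q (r • v) = r ^ 2 * Q v := fun r => by
        simp only [hQ, Finset.mul_sum, Pi.smul_apply, smul_eq_mul]
        exact Finset.sum_congr rfl fun i _ => Finset.sum_congr rfl fun j _ => by ring
      rw [h1, Real.sq_sqrt (div_nonneg (by linarith [hs.2]) hq.le), div_mul_cancel₀ _ hq.ne']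
    refine hψs.continuous.integral_pos_of_hasCompactSupport_nonneg_nonzero hψc
      (fun y => Real.smoothTransition.monotone.deriv_nonneg)
      (x := √((1 - s) / Q v) • v) ?_
    simp only [hψ, hQv, sub_sub_cancel, hs1]
    simp
  set c := (∫ y, ψ y)⁻¹ with hc
  refine ⟨fun y => c * ψ y, fun y => c / 2 * Real.smoothTransition (1 - Q y),
    contDiff_const.mul hψs, hψc.mul_left, contDiff_const.mul (hT.comp (contDiff_const.sub hQs)),
    (hcs _ fun s hs => Real.smoothTransition.zero_of_nonpos hs.le).mul_left, ?_, ?_⟩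
  · rw [integral_const_mul, hc, inv_mul_cancel₀ hψpos.ne']
  · intro i y
    have hpd : ∀ j, pd j (fun y => c / 2 * Real.smoothTransition (1 - Q y)) y
        = -(c * ψ y * ∑ k, B j k * y k) := by
      intro j
      have h1 := ((hQs.differentiable (by simp)) y).hasFDerivAt
      have h2 := (((hT.differentiable (by simp)) (1 - Q y)).hasDerivAt.comp_hasFDerivAt y
        (h1.const_sub 1)).const_mul (c / 2)
      have h3 : HasFDerivAt (fun y => c / 2 * Real.smoothTransition (1 - Q y)) _ y := h2
      rw [h3.pd_eq]
      have h4 := hpdQ j y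
      rw [pd] at h4
      simp only [_root_.smul_apply, _root_.neg_apply, smul_eq_mul, h4, hψ]
      ring
    simp only [hpd, mul_neg, Finset.sum_neg_distrib, neg_neg]
    have h5 : ∑ j, A i j * (c * ψ y * ∑ k, B j k * y k)
        = c * ψ y * ∑ k, (∑ j, A i j * B j k) * y k := by
      simp only [Finset.mul_sum, Finset.sum_mul]
      rw [Finset.sum_comm]
      exact Finset.sum_congr rfl fun _ _ => Finset.sum_congr rfl fun _ _ => by ring
    rw [h5]
    simp only [hAB, ite_mul, one_mul, zero_mul, Finset.sum_ite_eq, Finset.mem_univ, if_true]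
    ring

end Kernels

section SplitIntegral

theorem abs_integral_le_rpow {F : ℝ → ℝ} (hF : Continuous F) {α P Q h : ℝ} (hα : α ∈ Ioo (0 : ℝ) 1)
    (hP : 0 ≤ P) (hQ : 0 ≤ Q) (hh : 0 < h) (h1 : ∀ t ∈ Ioc (0 : ℝ) 1, |F t| ≤ P * t ^ (α - 1))
    (h2 : ∀ t ∈ Ioc (0 : ℝ) 1, |F t| ≤ Q * h * t ^ (α - 2)) :
    |∫ t in (0 : ℝ)..1, F t| ≤ (P / α + Q / (1 - α)) * h ^ α := by
  obtain ⟨hα0, hα1⟩ := hα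
  have hα' : 0 < 1 - α := by linarith
  have near : ∀ s ∈ Ioc (0 : ℝ) 1, |∫ t in (0 : ℝ)..s, F t| ≤ P / α * s ^ α := by
    intro s hs
    have := intervalIntegral.norm_integral_le_of_norm_le (f := F) (g := fun t => P * t ^ (α - 1))
      hs.1.le (ae_of_all _ fun t ht => h1 t ⟨ht.1, ht.2.trans hs.2⟩)
      ((intervalIntegral.intervalIntegrable_rpow' (by linarith)).const_mul P) (μ := volume)
    refine this.trans (le_of_eq ?_)
    rw [intervalIntegral.integral_const_mul, integral_rpow (Or.inl (by linarith))]
    simp [Real.zero_rpow hα0.ne']; ring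
  by_cases hh1 : 1 ≤ h
  · have h3 := near 1 (by simp)
    have h4 : (1 : ℝ) ≤ h ^ α := Real.one_le_rpow hh1 hα0.le
    rw [Real.one_rpow, mul_one] at h3
    have : 0 ≤ P / α := by positivity
    have : 0 ≤ Q / (1 - α) := by positivity
    nlinarith
  · push Not at hh1
    have h3 := near h ⟨hh, hh1.le⟩
    have h4 : |∫ t in h..1, F t| ≤ Q / (1 - α) * h ^ α := by
      have hnot : (0 : ℝ) ∉ uIcc h 1 := by
        rw [uIcc_of_le hh1.le]; simp [hh]
      have := intervalIntegral.norm_integral_le_of_norm_le (f := F)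
        (g := fun t => Q * h * t ^ (α - 2)) hh1.le
        (ae_of_all _ fun t ht => h2 t ⟨hh.trans ht.1, ht.2⟩)
        ((intervalIntegral.intervalIntegrable_rpow (Or.inr hnot)).const_mul (Q * h)) (μ := volume)
      refine this.trans ?_
      rw [intervalIntegral.integral_const_mul,
        integral_rpow (Or.inr ⟨by linarith, hnot⟩), Real.one_rpow]
      have e1 : α - 2 + 1 = α - 1 := by ring
      rw [e1]
      have e2 : h * h ^ (α - 1) = h ^ α := by
        rw [← Real.rpow_one_add' hh.le (by linarith)]; congr 1; ring
      have e3 : Q * h * ((1 - h ^ (α - 1)) / (α - 1)) = Q / (1 - α) * (h * h ^ (α - 1) - h) := by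
        have : α - 1 ≠ 0 := by linarith
        field_simp
        ring
      rw [e3, e2]
      exact mul_le_mul_of_nonneg_left (by linarith) (by positivity)
    have h5 := intervalIntegral.integral_add_adjacent_intervals
      (hF.intervalIntegrable (μ := volume) 0 h) (hF.intervalIntegrable h 1)
    rw [← h5]
    refine (abs_add_le _ _).trans ?_
    linarith

end SplitIntegral

section ConstantCoefficients

variable {n : ℕ}

theorem two_le_infty : (2 : WithTop ℕ∞) ≤ ∞ :=
  WithTop.coe_le_coe.mpr (le_top : (2 : ℕ∞) ≤ ⊤)

/-- Global Hölder continuity with exponent `α` and constant `M`. -/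
def Hol (α M : ℝ) (f : Pt n → ℝ) : Prop := ∀ x y, |f x - f y| ≤ M * ‖x - y‖ ^ α

theorem Hol.mono {α M M' : ℝ} {f : Pt n → ℝ} (h : Hol α M f) (hM : M ≤ M') : Hol α M' f :=
  fun x y => (h x y).trans (by gcongr)

theorem Hol.add {α M M' : ℝ} {f h : Pt n → ℝ} (hf : Hol α M f) (hh : Hol α M' h) :
    Hol α (M + M') fun x => f x + h x := fun x y => by
  have e : f x + h x - (f y + h y) = (f x - f y) + (h x - h y) := by ring
  rw [e, add_mul]
  exact (abs_add_le _ _).trans (add_le_add (hf x y) (hh x y))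

theorem Hol.neg {α M : ℝ} {f : Pt n → ℝ} (hf : Hol α M f) : Hol α M fun x => -f x :=
  fun x y => by
    rw [neg_sub_neg, abs_sub_comm]
    exact hf x y

theorem Hol.sum {ι : Type*} (s : Finset ι) {α : ℝ} {M : ι → ℝ} {f : ι → Pt n → ℝ}
    (h : ∀ i ∈ s, Hol α (M i) (f i)) : Hol α (∑ i ∈ s, M i) fun x => ∑ i ∈ s, f i x :=
  fun x y => by
    rw [← Finset.sum_sub_distrib, Finset.sum_mul]
    exact (Finset.abs_sum_le_sum_abs _ _).trans (Finset.sum_le_sum fun i hi => h i hi x y)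

theorem hol_of_bounded_of_pd_le {f : Pt n → ℝ} {α B L : ℝ} (hα : α ∈ Ioo (0 : ℝ) 1)
    (hf : Differentiable ℝ f) (hL : 0 ≤ L) (hB : ∀ x, |f x| ≤ B) (hpd : ∀ i x, |pd i f x| ≤ L) :
    Hol α (2 * B + n * L) f := fun x y => by
  have hB0 : 0 ≤ B := (abs_nonneg _).trans (hB x)
  have hn : (0 : ℝ) ≤ n * L := by positivity
  by_cases hxy : ‖x - y‖ ≤ 1
  · have h1 := abs_sub_le_of_pd_le convex_univ hL (fun x _ => hf x) (fun i x _ => hpd i x)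
      (mem_univ x) (mem_univ y)
    have h2 : ‖x - y‖ ≤ ‖x - y‖ ^ α := by
      rcases (norm_nonneg (x - y)).eq_or_lt with h0 | h0
      · rw [← h0, Real.zero_rpow hα.1.ne']
      · simpa using Real.rpow_le_rpow_of_exponent_ge h0 hxy hα.2.le
    refine h1.trans ((mul_le_mul_of_nonneg_left h2 hn).trans ?_)
    gcongr
    linarith
  · push Not at hxy
    have h2 : 1 ≤ ‖x - y‖ ^ α := Real.one_le_rpow hxy.le hα.1.le
    have h3 : |f x - f y| ≤ 2 * B := (abs_sub _ _).trans (by linarith [hB x, hB y])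
    nlinarith

theorem hol_avg {κ g : Pt n → ℝ} (hκ : Continuous κ) (hκc : HasCompactSupport κ)
    (hg : Continuous g) {α M : ℝ} (h : Hol α M g) (t : ℝ) :
    Hol α ((∫ y, |κ y|) * M) (avg κ t g) := fun x y => by
  rw [mul_assoc]
  exact abs_avg_sub_avg_le hκ hκc hg (fun z => by simpa using h (x - z) (y - z)) t

theorem hasCompactSupport_avg {κ g : Pt n → ℝ} (hκc : HasCompactSupport κ)
    (hgc : HasCompactSupport g) {t : ℝ} (ht : 0 < t) : HasCompactSupport (avg κ t g) := by
  rw [avg_eq_convolution ht]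
  exact HasCompactSupport.mul_left (f := fun _ : Pt n => (t ^ n)⁻¹)
    ((hasCompactSupport_scale hκc ht).convolution _ hgc)

/-- The second order operator with coefficients `a`. -/
def op (a : Fin n → Fin n → Pt n → ℝ) (v : Pt n → ℝ) (x : Pt n) : ℝ :=
  ∑ i, ∑ j, a i j x * pd j (pd i v) x

theorem continuous_op {a : Fin n → Fin n → Pt n → ℝ} (ha : ∀ i j, Continuous (a i j))
    {v : Pt n → ℝ} (hv : ContDiff ℝ 2 v) : Continuous (op a v) :=
  continuous_finsetSum _ fun i _ => continuous_finsetSum _ fun j _ => (ha i j).mul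
    (contDiff_pd (m := 0) (contDiff_pd (m := 1) hv (by norm_num) i) (by norm_num) j).continuous

theorem contDiff_op_const {A : Fin n → Fin n → ℝ} {v : Pt n → ℝ} (hv : ContDiff ℝ ∞ v) :
    ContDiff ℝ ∞ (op (fun i j _ => A i j) v) :=
  ContDiff.sum fun i _ => ContDiff.sum fun j _ => contDiff_const.mul
    (contDiff_pd (contDiff_pd hv le_rfl i) le_rfl j)

theorem pd_op_const {A : Fin n → Fin n → ℝ} {v : Pt n → ℝ} (hv : ContDiff ℝ ∞ v) (l : Fin n) :
    pd l (op (fun i j _ => A i j) v) = op (fun i j _ => A i j) (pd l v) := by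
  have h1 : ∀ i, ContDiff ℝ ∞ (pd i v) := fun i => contDiff_pd hv le_rfl i
  have h2 : ∀ i j, ContDiff ℝ ∞ (pd j (pd i v)) := fun i j => contDiff_pd (h1 i) le_rfl j
  have hc : ∀ {w : Pt n → ℝ}, ContDiff ℝ ∞ w → ∀ i j, pd i (pd j w) = pd j (pd i w) :=
    fun hw i j => funext fun x => pd_comm (hw.of_le two_le_infty).contDiffAt i j
  funext x
  have hd : ∀ i j, DifferentiableAt ℝ (fun y => A i j * pd j (pd i v) y) x := fun i j =>
    ((h2 i j).differentiable (by simp) x).const_mul _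
  unfold op
  rw [pd_sum _ fun i _ => DifferentiableAt.fun_sum fun j _ => hd i j]
  refine Finset.sum_congr rfl fun i _ => ?_
  rw [pd_sum _ fun j _ => hd i j]
  refine Finset.sum_congr rfl fun j _ => ?_
  rw [pd_const_mul _ ((h2 i j).differentiable (by simp) x), hc (h1 i), hc hv]

theorem exists_hol_pd_pd_aux [NeZero n] {A : Fin n → Fin n → ℝ} (hA : (Matrix.of A).PosDef)
    {α : ℝ} (hα : α ∈ Ioo (0 : ℝ) 1) (k l : Fin n) :
    ∃ C, 0 ≤ C ∧ ∀ (v : Pt n → ℝ) (M M₀ : ℝ), 0 ≤ M → 0 ≤ M₀ → ContDiff ℝ ∞ v →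
      HasCompactSupport v → (∀ x, |v x| ≤ M₀) → Hol α M (op (fun i j _ => A i j) v) →
      Hol α (C * (M + M₀)) (pd k (pd l v)) := by
  obtain ⟨φ, η, hφ, hφc, hη, hηc, hφ1, hφη⟩ := exists_kernels hA
  have h1 : (1 : WithTop ℕ∞) ≤ ∞ := by exact_mod_cast le_top
  have h2 : (2 : WithTop ℕ∞) ≤ ∞ := two_le_infty
  have hpd : ∀ {w : Pt n → ℝ}, ContDiff ℝ ∞ w → ∀ i, ContDiff ℝ ∞ (pd i w) :=
    fun hw i => contDiff_pd hw le_rfl i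
  set ζ := pd l (pd k η) with hζdef
  have hζ : ContDiff ℝ ∞ ζ := hpd (hpd hη k) l
  have hζc : HasCompactSupport ζ := hasCompactSupport_pd (hasCompactSupport_pd hηc k) l
  set χ := pd l (pd k φ) with hχdef
  have hχ : ContDiff ℝ ∞ χ := hpd (hpd hφ k) l
  have hχc : HasCompactSupport χ := hasCompactSupport_pd (hasCompactSupport_pd hφc k) l
  set P := ∫ y, |ζ y| * ‖y‖ ^ α with hP
  set Q := ∑ i, ∫ y, |pd i ζ y| * ‖y‖ ^ α with hQ
  set R := ∫ y, |χ y| with hR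
  set S := ∑ i, ∫ y, |pd i χ y| with hS
  have hP0 : 0 ≤ P := integral_nonneg fun y => by positivity
  have hQi : ∀ i, 0 ≤ ∫ y, |pd i ζ y| * ‖y‖ ^ α := fun i => integral_nonneg fun y => by positivity
  have hQ0 : 0 ≤ Q := Finset.sum_nonneg fun i _ => hQi i
  have hR0 : 0 ≤ R := integral_nonneg fun y => by positivity
  have hSi : ∀ i, 0 ≤ ∫ y, |pd i χ y| := fun i => integral_nonneg fun y => by positivity
  have hS0 : 0 ≤ S := Finset.sum_nonneg fun i _ => hSi i
  have hα0 := hα.1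
  have hα1 : 0 < 1 - α := by linarith [hα.2]
  refine ⟨2 * P / α + n * Q / (1 - α) + (2 * R + n * S), by positivity, ?_⟩
  intro v M M₀ hM hM₀ hv hvc hvb hf
  set f := op (fun i j _ => A i j) v with hfdef
  have hfs : ContDiff ℝ ∞ f := contDiff_op_const hv
  have hfl : ContDiff ℝ ∞ (pd l f) := hpd hfs l
  set w := pd k (pd l v) with hw
  have hws : ContDiff ℝ ∞ w := hpd (hpd hv l) k
  have hwc : HasCompactSupport w := hasCompactSupport_pd (hasCompactSupport_pd hvc l) k
  have hopw : op (fun i j _ => A i j) w = pd k (pd l f) := by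
    rw [hfdef, pd_op_const hv, pd_op_const (hpd hv l)]
  set G : ℝ → Pt n → ℝ := fun t x => avg (pd k η) t (pd l f) x with hG
  have hrep : ∀ x, w x = avg χ 1 v x - ∫ t in (0 : ℝ)..1, G t x := by
    intro x
    have e := avg_sub_self_eq_integral hφ.continuous hφc (hη.of_le h1) hηc hφ1 hφη
      (hws.of_le h2) hwc x
    have e1 : ∀ t, t * avg η t (fun z => ∑ i, ∑ j, A i j * pd j (pd i w) z) x = G t x := by
      intro t
      have : (fun z => ∑ i, ∑ j, A i j * pd j (pd i w) z) = pd k (pd l f) := hopw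
      rw [this, hG]
      exact (avg_pd_kernel (hη.of_le h1) hηc (hfl.of_le h1) t k x).symm
    have e2 : avg φ 1 w x = avg χ 1 v x := by
      rw [hχdef, avg_pd_kernel ((hpd hφ k).of_le h1) (hasCompactSupport_pd hφc k) (hv.of_le h1),
        avg_pd_kernel (hφ.of_le h1) hφc ((hpd hv l).of_le h1)]
      simp [hw]
    simp only [e1, e2] at e
    linarith
  have hGeq : ∀ t, 0 < t → G t = fun x => t⁻¹ * avg ζ t f x := by
    intro t ht
    funext x
    rw [hζdef, avg_pd_kernel ((hpd hη k).of_le h1) (hasCompactSupport_pd hηc k) (hfs.of_le h1),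
      ← mul_assoc, inv_mul_cancel₀ ht.ne', one_mul]
  have hG1 : ∀ t, 0 < t → ∀ x, |G t x| ≤ P * M * t ^ (α - 1) := by
    intro t ht x
    rw [hGeq t ht, abs_mul, abs_of_pos (inv_pos.mpr ht), Real.rpow_sub_one ht.ne',
      div_eq_inv_mul, mul_left_comm]
    refine mul_le_mul_of_nonneg_left ?_ (inv_pos.mpr ht).le
    exact abs_avg_le_of_integral_eq_zero hζ.continuous hζc
      (integral_pd_eq_zero ((hpd hη k).of_le h1) (hasCompactSupport_pd hηc k) l)
      hfs.continuous hα0 hf ht.le x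
  have hG2 : ∀ t, 0 < t → ∀ x y, |G t x - G t y| ≤ n * Q * M * ‖x - y‖ * t ^ (α - 2) := by
    intro t ht x y
    have hdiff : ContDiff ℝ ∞ (avg ζ t f) := contDiff_avg hζ hζc hfs.continuous ht
    have hb : ∀ i, ∀ z ∈ (univ : Set (Pt n)), |pd i (G t) z| ≤ Q * M * t ^ (α - 2) := by
      intro i z _
      rw [hGeq t ht, pd_const_mul _ (hdiff.differentiable (by simp) z),
        pd_avg_eq_kernel hζ hζc hfs.continuous ht, ← mul_assoc, abs_mul,
        abs_of_pos (by positivity : 0 < t⁻¹ * t⁻¹)]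
      have e : Q * M * t ^ (α - 2) = t⁻¹ * t⁻¹ * (Q * M * t ^ α) := by
        have : t ^ (α - 2) = t ^ α / t ^ 2 := by
          have := Real.rpow_sub ht α 2
          simpa using this
        rw [this]; field_simp
      rw [e]
      refine mul_le_mul_of_nonneg_left ?_ (by positivity)
      refine (abs_avg_le_of_integral_eq_zero (hpd hζ i).continuous (hasCompactSupport_pd hζc i)
        (integral_pd_eq_zero (hζ.of_le h1) hζc i) hfs.continuous hα0 hf ht.le z).trans ?_
      gcongr
      exact Finset.single_le_sum (fun j _ => hQi j) (Finset.mem_univ i)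
    have := abs_sub_le_of_pd_le convex_univ (by positivity)
      (fun z _ => by
        rw [hGeq t ht]
        exact (hdiff.differentiable (by simp) z).const_mul _) hb (mem_univ x) (mem_univ y)
    refine this.trans (le_of_eq (by ring))
  have hT : Hol α (2 * (R * M₀) + n * (S * M₀)) (avg χ 1 v) := by
    refine hol_of_bounded_of_pd_le hα
      ((contDiff_avg hχ hχc hv.continuous one_pos).differentiable (by simp)) (by positivity)
      (fun x => abs_avg_le hχ.continuous hχc hvb 1 x) fun i x => ?_
    rw [pd_avg_eq_kernel hχ hχc hv.continuous one_pos, inv_one, one_mul]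
    refine (abs_avg_le (hpd hχ i).continuous (hasCompactSupport_pd hχc i) hvb 1 x).trans ?_
    gcongr
    exact Finset.single_le_sum (fun j _ => hSi j) (Finset.mem_univ i)
  have hflc : HasCompactSupport (pd l f) := by
    refine hasCompactSupport_pd (hvc.of_isClosed_subset (isClosed_tsupport _)
      (closure_minimal ?_ (isClosed_tsupport _))) l
    intro x hx
    by_contra hx0
    refine hx (Finset.sum_eq_zero fun i _ => Finset.sum_eq_zero fun j _ => ?_)
    rw [image_eq_zero_of_notMem_tsupport fun h =>
      hx0 (tsupport_pd_subset _ i (tsupport_pd_subset _ j h)), mul_zero]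
  obtain ⟨B, -, hB⟩ := bounded_of_hasCompactSupport hfl.continuous hflc
  have hGc : ∀ x, Continuous fun t => G t x := fun x =>
    continuous_avg_scale (hpd hη k).continuous (hasCompactSupport_pd hηc k) hfl.continuous hB x
  intro x y
  rcases (norm_nonneg (x - y)).eq_or_lt with h0 | h0
  · have : x = y := sub_eq_zero.mp (norm_eq_zero.mp h0.symm)
    subst this
    simp [Real.zero_rpow hα0.ne']
  have hI := abs_integral_le_rpow (F := fun t => G t x - G t y) ((hGc x).sub (hGc y)) hα
    (P := 2 * (P * M)) (Q := n * Q * M) (by positivity) (by positivity) h0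
    (fun t ht => (abs_sub _ _).trans (by linarith [hG1 t ht.1 x, hG1 t ht.1 y]))
    (fun t ht => hG2 t ht.1 x y)
  rw [intervalIntegral.integral_sub ((hGc x).intervalIntegrable _ _)
    ((hGc y).intervalIntegrable _ _)] at hI
  have e : w x - w y = (avg χ 1 v x - avg χ 1 v y)
      - ((∫ t in (0 : ℝ)..1, G t x) - ∫ t in (0 : ℝ)..1, G t y) := by
    rw [hrep x, hrep y]; ring
  rw [e]
  refine (abs_sub _ _).trans ((add_le_add (hT x y) hI).trans ?_)
  rw [← add_mul]
  refine mul_le_mul_of_nonneg_right ?_ (by positivity)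
  have e2 : (2 * P / α + n * Q / (1 - α) + (2 * R + n * S)) * (M + M₀)
      = 2 * (R * M₀) + n * (S * M₀) + (2 * (P * M) / α + n * Q * M / (1 - α))
        + ((2 * P / α + n * Q / (1 - α)) * M₀ + (2 * R + n * S) * M) := by ring
  rw [e2]
  have : 0 ≤ (2 * P / α + n * Q / (1 - α)) * M₀ + (2 * R + n * S) * M := by positivity
  linarith

/-- Schauder's estimate for constant coefficients. -/
theorem exists_hol_pd_pd [NeZero n] {A : Fin n → Fin n → ℝ} (hA : (Matrix.of A).PosDef)
    {α : ℝ} (hα : α ∈ Ioo (0 : ℝ) 1) :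
    ∃ C, 0 ≤ C ∧ ∀ (v : Pt n → ℝ) (M M₀ : ℝ), 0 ≤ M → 0 ≤ M₀ → ContDiff ℝ 2 v →
      HasCompactSupport v → (∀ x, |v x| ≤ M₀) → Hol α M (op (fun i j _ => A i j) v) →
      ∀ k l, Hol α (C * (M + M₀)) (pd k (pd l v)) := by
  choose c hc0 hc using exists_hol_pd_pd_aux hA hα
  obtain ⟨φ, -, hφ, hφc, -, -, hφ1, -⟩ := exists_kernels hA
  set R := ∫ y, |φ y| with hR
  have hR0 : 0 ≤ R := integral_nonneg fun y => abs_nonneg _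
  have hC0 : 0 ≤ ∑ k, ∑ l, c k l :=
    Finset.sum_nonneg fun k _ => Finset.sum_nonneg fun l _ => hc0 k l
  refine ⟨R * ∑ k, ∑ l, c k l, mul_nonneg hR0 hC0, ?_⟩
  intro v M M₀ hM hM₀ hv hvc hvb hf k l x y
  have hv1 : ContDiff ℝ 1 v := hv.of_le (by norm_num)
  have hpd1 : ∀ i, ContDiff ℝ 1 (pd i v) := fun i => contDiff_pd hv (by norm_num) i
  have hpd2 : ∀ i j, Continuous (pd j (pd i v)) :=
    fun i j => (contDiff_pd (m := 0) (hpd1 i) (by norm_num) j).continuous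
  have hcomm : ∀ t, 0 < t → ∀ i j, pd j (pd i (avg φ t v)) = avg φ t (pd j (pd i v)) := by
    intro t ht i j
    have : pd i (avg φ t v) = avg φ t (pd i v) := funext fun z => pd_avg hφ hφc hv1 ht i z
    rw [this]
    exact funext fun z => pd_avg hφ hφc (hpd1 i) ht j z
  have key : ∀ t, 0 < t → |avg φ t (pd k (pd l v)) x - avg φ t (pd k (pd l v)) y|
      ≤ R * (∑ k, ∑ l, c k l) * (M + M₀) * ‖x - y‖ ^ α := by
    intro t ht
    have hop : op (fun i j _ => A i j) (avg φ t v) = avg φ t (op (fun i j _ => A i j) v) := by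
      funext z
      have e1 := avg_sum (h := fun i z => ∑ j, A i j * pd j (pd i v) z) Finset.univ hφ.continuous
        hφc (fun i _ => continuous_finsetSum _ fun j _ => continuous_const.mul (hpd2 i j)) t z
      have e2 : ∀ i, _ := fun i => avg_sum (h := fun j z => A i j * pd j (pd i v) z) Finset.univ
        hφ.continuous hφc (fun j _ => continuous_const.mul (hpd2 i j)) t z
      unfold op
      rw [e1]
      simp only [e2, avg_const_mul, hcomm t ht]
    have h1 := hc k l (avg φ t v) (R * M) (R * M₀) (by positivity) (by positivity)
      (contDiff_avg hφ hφc hv.continuous ht) (hasCompactSupport_avg hφc hvc ht)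
      (abs_avg_le hφ.continuous hφc hvb t)
      (by
        rw [hop]
        exact hol_avg hφ.continuous hφc (continuous_op (fun _ _ => continuous_const) hv) hf t)
    rw [hcomm t ht] at h1
    refine (h1 x y).trans ?_
    have e : R * (∑ k, ∑ l, c k l) * (M + M₀) * ‖x - y‖ ^ α
        = (∑ k, ∑ l, c k l) * (R * M + R * M₀) * ‖x - y‖ ^ α := by ring
    rw [e]
    gcongr
    exact (Finset.single_le_sum (fun j _ => hc0 k j) (Finset.mem_univ l)).trans
      (Finset.single_le_sum (f := fun k => ∑ l, c k l)
        (fun i _ => Finset.sum_nonneg fun j _ => hc0 i j) (Finset.mem_univ k))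
  have hcont : ∀ z, Continuous fun t => avg φ t (pd k (pd l v)) z := by
    obtain ⟨B, -, hB⟩ := bounded_of_hasCompactSupport (hpd2 l k)
      (hasCompactSupport_pd (hasCompactSupport_pd hvc l) k)
    exact continuous_avg_scale hφ.continuous hφc (hpd2 l k) hB
  have hlim : Tendsto (fun t => |avg φ t (pd k (pd l v)) x - avg φ t (pd k (pd l v)) y|)
      (𝓝[>] 0) (𝓝 |pd k (pd l v) x - pd k (pd l v) y|) := by
    have h1 := (((hcont x).sub (hcont y)).abs).tendsto 0
    simp only [Pi.sub_apply, avg_zero, hφ1, one_mul] at h1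
    exact h1.mono_left nhdsWithin_le_nhds
  exact le_of_tendsto hlim (eventually_mem_nhdsWithin.mono fun t ht => key t ht)

end ConstantCoefficients

section LocalEstimate

variable {n : ℕ}

theorem exists_far_point [NeZero n] {x₀ y : Pt n} {r : ℝ} (hr : 0 < r)
    (hy : y ∈ Metric.ball x₀ r) : ∃ z, ‖y - z‖ = 2 * r ∧ z ∉ Metric.ball x₀ r := by
  have h1 : ‖(2 * r) • (Pi.single 0 1 : Pt n)‖ = 2 * r := by
    rw [norm_smul, Real.norm_of_nonneg (by positivity), Pi.norm_single, norm_one, mul_one]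
  refine ⟨y + (2 * r) • Pi.single 0 1, by simpa using h1, fun hz => ?_⟩
  have h2 := dist_triangle_right (y + (2 * r) • (Pi.single 0 1 : Pt n)) y x₀
  rw [dist_eq_norm, add_sub_cancel_left, h1] at h2
  rw [Metric.mem_ball] at hy hz
  linarith

theorem abs_le_of_hol_of_eq_zero [NeZero n] {h : Pt n → ℝ} {x₀ : Pt n} {r α N : ℝ} (hr : 0 < r)
    (hN : 0 ≤ N) (hs : ∀ x ∉ Metric.ball x₀ r, h x = 0) (hh : Hol α N h) (y : Pt n) :
    |h y| ≤ N * (2 * r) ^ α := by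
  by_cases hy : y ∈ Metric.ball x₀ r
  · obtain ⟨z, hz, hzb⟩ := exists_far_point hr hy
    simpa [hs z hzb, hz] using hh y z
  · rw [hs y hy, abs_zero]; positivity

theorem abs_le_of_pd_le_of_eq_zero [NeZero n] {h : Pt n → ℝ} {x₀ : Pt n} {r B : ℝ} (hr : 0 < r)
    (hB : 0 ≤ B) (hs : ∀ x ∉ Metric.ball x₀ r, h x = 0) (hd : Differentiable ℝ h)
    (hh : ∀ i x, |pd i h x| ≤ B) (y : Pt n) : |h y| ≤ n * B * (2 * r) := by
  by_cases hy : y ∈ Metric.ball x₀ r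
  · obtain ⟨z, hz, hzb⟩ := exists_far_point hr hy
    have := abs_sub_le_of_pd_le convex_univ hB (fun x _ => hd x) (fun i x _ => hh i x)
      (mem_univ y) (mem_univ z)
    simpa [hs z hzb, hz] using this
  · rw [hs y hy, abs_zero]; positivity

theorem eq_zero_of_tsupport_subset {h : Pt n → ℝ} {s : Set (Pt n)} (hs : tsupport h ⊆ s)
    {x : Pt n} (hx : x ∉ s) : h x = 0 :=
  image_eq_zero_of_notMem_tsupport fun h' => hx (hs h')

theorem hasCompactSupport_of_tsupport_subset_ball {h : Pt n → ℝ} {x₀ : Pt n} {r : ℝ}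
    (hs : tsupport h ⊆ Metric.ball x₀ r) : HasCompactSupport h :=
  Metric.isCompact_of_isClosed_isBounded (isClosed_tsupport _) (Metric.isBounded_ball.subset hs)

/-- Sup bounds for a function supported in a small ball from the Hölder bound of its Hessian. -/
theorem bounds_of_hol_pd_pd [NeZero n] {v : Pt n → ℝ} {x₀ : Pt n} {r α N : ℝ} (hr : 0 < r)
    (hr1 : 2 * r ≤ 1) (hα : α ∈ Ioo (0 : ℝ) 1) (hN : 0 ≤ N) (hv : ContDiff ℝ 2 v)
    (hs : tsupport v ⊆ Metric.ball x₀ r) (hh : ∀ k l, Hol α N (pd k (pd l v))) :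
    (∀ k l x, |pd k (pd l v) x| ≤ N) ∧ (∀ l x, |pd l v x| ≤ n * N) ∧
      (∀ x, |v x| ≤ n * (n * N) * (2 * r)) := by
  have hpd1 : ∀ i, ContDiff ℝ 1 (pd i v) := fun i => contDiff_pd hv (by norm_num) i
  have h2 : ∀ k l x, |pd k (pd l v) x| ≤ N := fun k l x => by
    refine (abs_le_of_hol_of_eq_zero hr hN (fun z hz => eq_zero_of_tsupport_subset
      ((tsupport_pd_subset _ k).trans ((tsupport_pd_subset _ l).trans hs)) hz) (hh k l) x).trans ?_
    exact mul_le_of_le_one_right hN (Real.rpow_le_one (by positivity) hr1 hα.1.le)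
  have h1 : ∀ l x, |pd l v x| ≤ n * N := fun l x => by
    refine (abs_le_of_pd_le_of_eq_zero hr hN (fun z hz => eq_zero_of_tsupport_subset
      ((tsupport_pd_subset _ l).trans hs) hz) ((hpd1 l).differentiable (by norm_num))
      (fun k z => h2 k l z) x).trans ?_
    exact mul_le_of_le_one_right (by positivity) hr1
  refine ⟨h2, h1, fun x => ?_⟩
  exact abs_le_of_pd_le_of_eq_zero hr (by positivity) (fun z hz => eq_zero_of_tsupport_subset
    hs hz) (hv.differentiable (by norm_num)) h1 x

theorem hol_mul_of_small [NeZero n] {b h : Pt n → ℝ} {x₀ : Pt n} {r α N L : ℝ} (hr : 0 < r)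
    (hα : α ∈ Ioo (0 : ℝ) 1) (hN : 0 ≤ N) (hL : 0 ≤ L) (hb0 : b x₀ = 0)
    (hb : ∀ x y, |b x - b y| ≤ L * ‖x - y‖) (hs : ∀ x ∉ Metric.ball x₀ r, h x = 0)
    (hh : Hol α N h) : Hol α (3 * L * r * N) fun x => b x * h x := by
  have hsup := abs_le_of_hol_of_eq_zero hr hN hs hh
  have key : ∀ x y, x ∈ Metric.ball x₀ r →
      |b x * h x - b y * h y| ≤ 3 * L * r * N * ‖x - y‖ ^ α := by
    intro x y hx
    have hbx : |b x| ≤ L * r := by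
      have := hb x x₀
      rw [hb0, sub_zero] at this
      refine this.trans (mul_le_mul_of_nonneg_left ?_ hL)
      rw [← dist_eq_norm]; exact (Metric.mem_ball.mp hx).le
    have e : b x * h x - b y * h y = b x * (h x - h y) + (b x - b y) * h y := by ring
    have h1 : |b x * (h x - h y)| ≤ L * r * (N * ‖x - y‖ ^ α) := by
      rw [abs_mul]
      exact mul_le_mul hbx (hh x y) (abs_nonneg _) (by positivity)
    have h2 : |(b x - b y) * h y| ≤ 2 * L * r * N * ‖x - y‖ ^ α := by
      by_cases hy : y ∈ Metric.ball x₀ r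
      · have hxy : ‖x - y‖ ≤ 2 * r := by
          rw [← dist_eq_norm]
          have := dist_triangle_right x y x₀
          rw [Metric.mem_ball] at hx hy
          linarith
        rw [abs_mul]
        refine (mul_le_mul (hb x y) (hsup y) (abs_nonneg _) (by positivity)).trans ?_
        have e1 : ‖x - y‖ * (2 * r) ^ α ≤ 2 * r * ‖x - y‖ ^ α := by
          have hd : ‖x - y‖ = ‖x - y‖ ^ (1 - α) * ‖x - y‖ ^ α := by
            rw [← Real.rpow_add' (norm_nonneg _) (by simp)]; simp
          have hd2 : 2 * r = (2 * r) ^ (1 - α) * (2 * r) ^ α := by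
            rw [← Real.rpow_add' (by positivity) (by simp)]; simp
          have h3 : ‖x - y‖ ^ (1 - α) ≤ (2 * r) ^ (1 - α) :=
            Real.rpow_le_rpow (norm_nonneg _) hxy (by linarith [hα.2])
          calc ‖x - y‖ * (2 * r) ^ α = ‖x - y‖ ^ (1 - α) * (‖x - y‖ ^ α * (2 * r) ^ α) := by
                rw [← mul_assoc, ← hd]
            _ ≤ (2 * r) ^ (1 - α) * (‖x - y‖ ^ α * (2 * r) ^ α) := by gcongr
            _ = (2 * r) ^ (1 - α) * (2 * r) ^ α * ‖x - y‖ ^ α := by ring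
            _ = 2 * r * ‖x - y‖ ^ α := by rw [← hd2]
        calc L * ‖x - y‖ * (N * (2 * r) ^ α) = L * N * (‖x - y‖ * (2 * r) ^ α) := by ring
          _ ≤ L * N * (2 * r * ‖x - y‖ ^ α) := by gcongr
          _ = 2 * L * r * N * ‖x - y‖ ^ α := by ring
      · rw [hs y hy, mul_zero, abs_zero]; positivity
    rw [e]
    refine (abs_add_le _ _).trans ((add_le_add h1 h2).trans (le_of_eq (by ring)))
  intro x y
  by_cases hx : x ∈ Metric.ball x₀ r
  · exact key x y hx
  · by_cases hy : y ∈ Metric.ball x₀ r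
    · rw [abs_sub_comm, norm_sub_rev]
      exact key y x hy
    · simp only [hs x hx, hs y hy, mul_zero, sub_zero, abs_zero]
      positivity

/-- Local a priori Schauder estimate for variable coefficients. -/
theorem exists_local_schauder [NeZero n] {a : Fin n → Fin n → Pt n → ℝ} {x₀ : Pt n} {L α : ℝ}
    (ha : (Matrix.of fun i j => a i j x₀).PosDef) (hL : 0 ≤ L)
    (haL : ∀ i j x y, |a i j x - a i j y| ≤ L * ‖x - y‖) (hα : α ∈ Ioo (0 : ℝ) 1) :
    ∃ r C, 0 < r ∧ 2 * r ≤ 1 ∧ 0 ≤ C ∧ ∀ (v : Pt n → ℝ) (M : ℝ), 0 ≤ M → ContDiff ℝ 2 v →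
      tsupport v ⊆ Metric.ball x₀ r → (∃ N, ∀ k l, Hol α N (pd k (pd l v))) →
      Hol α M (op a v) → ∀ k l, Hol α (C * M) (pd k (pd l v)) := by
  obtain ⟨C, hC, hCs⟩ := exists_hol_pd_pd ha hα
  set D := C * (n ^ 2 * (3 * L + 2)) with hD
  have hD0 : 0 ≤ D := by positivity
  set r := min (1 / 2) (1 / (2 * (D + 1))) with hr
  have hr0 : 0 < r := lt_min (by norm_num) (by positivity)
  have hr1 : 2 * r ≤ 1 := by linarith [min_le_left (1 / 2) (1 / (2 * (D + 1)))]
  have hDr : D * r ≤ 1 / 2 := by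
    have h1 : r ≤ 1 / (2 * (D + 1)) := min_le_right _ _
    have h2 : D * r ≤ D * (1 / (2 * (D + 1))) := mul_le_mul_of_nonneg_left h1 hD0
    refine h2.trans ?_
    rw [mul_one_div, div_le_div_iff₀ (by positivity) (by norm_num)]
    linarith
  refine ⟨r, 2 * C, hr0, hr1, by positivity, ?_⟩
  intro v M hM hv hvs ⟨N, hN⟩ hf
  have hvc := hasCompactSupport_of_tsupport_subset_ball hvs
  have step : ∀ N, 0 ≤ N → (∀ k l, Hol α N (pd k (pd l v))) →
      ∀ k l, Hol α (C * M + N / 2) (pd k (pd l v)) := by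
    intro N hN0 hN
    obtain ⟨-, -, hv0⟩ := bounds_of_hol_pd_pd hr0 hr1 hα hN0 hv hvs hN
    have hopA : Hol α (M + ∑ _i : Fin n, ∑ _j : Fin n, 3 * L * r * N)
        (op (fun i j _ => a i j x₀) v) := by
      have h1 := hf.add (Hol.sum Finset.univ fun i _ => Hol.sum Finset.univ fun j _ =>
        (hol_mul_of_small hr0 hα hN0 hL (b := fun x => a i j x - a i j x₀) (by simp)
          (fun x y => by simpa using haL i j x y) (fun x hx => eq_zero_of_tsupport_subset
            ((tsupport_pd_subset _ j).trans ((tsupport_pd_subset _ i).trans hvs)) hx)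
          (hN j i)).neg)
      convert h1 using 1
      funext x
      simp only [op, sub_mul, neg_sub, ← Finset.sum_add_distrib]
      refine Finset.sum_congr rfl fun i _ => Finset.sum_congr rfl fun j _ => by ring
    intro k l
    refine (hCs v _ _ (by positivity) (by positivity) hv hvc hv0 hopA k l).mono ?_
    have e : C * (M + ∑ _i : Fin n, ∑ _j : Fin n, 3 * L * r * N + n * (n * N) * (2 * r))
        = C * M + D * r * N := by
      simp only [Finset.sum_const, Finset.card_univ, Fintype.card_fin, nsmul_eq_mul, hD]
      ring
    rw [e]
    nlinarith
  have iter : ∀ m : ℕ, ∀ k l, Hol α (2 * C * M + |N| / 2 ^ m) (pd k (pd l v)) := by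
    intro m
    induction m with
    | zero =>
      intro k l
      refine (hN k l).mono ?_
      have : 0 ≤ 2 * C * M := by positivity
      simpa using (le_abs_self N).trans (by linarith)
    | succ m ih =>
      intro k l
      refine (step _ (by positivity) ih k l).mono (le_of_eq ?_)
      rw [pow_succ]; field_simp; ring
  intro k l x y
  have hlim : Tendsto (fun m : ℕ => (2 * C * M + |N| / 2 ^ m) * ‖x - y‖ ^ α) atTop
      (𝓝 ((2 * C * M + 0) * ‖x - y‖ ^ α)) := by
    refine (tendsto_const_nhds.add ?_).mul_const _
    exact tendsto_const_nhds.div_atTop (tendsto_pow_atTop_atTop_of_one_lt one_lt_two)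
  rw [add_zero] at hlim
  exact ge_of_tendsto' hlim fun m => iter m k l x y

end LocalEstimate

section Mollification

variable {n : ℕ}

theorem exists_mollifier [NeZero n] : ∃ ρ : Pt n → ℝ, ContDiff ℝ ∞ ρ ∧ HasCompactSupport ρ ∧
    ∫ y, ρ y = 1 := by
  obtain ⟨φ, -, hφ, hφc, -, -, hφ1, -⟩ := exists_kernels
    (A := fun i j => (1 : Matrix (Fin n) (Fin n) ℝ) i j) Matrix.PosDef.one
  exact ⟨φ, hφ, hφc, hφ1⟩

theorem tsupport_avg_subset {κ g : Pt n → ℝ} {x₀ : Pt n} {r R t : ℝ}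
    (hκ : ∀ y, R < ‖y‖ → κ y = 0) (hg : tsupport g ⊆ Metric.ball x₀ r) (ht : 0 ≤ t) :
    tsupport (avg κ t g) ⊆ Metric.closedBall x₀ (r + t * R) := by
  refine closure_minimal (fun x hx => ?_) Metric.isClosed_closedBall
  by_contra hxn
  refine hx (integral_eq_zero_of_ae (ae_of_all _ fun y => ?_))
  by_cases hy : R < ‖y‖
  · simp [hκ y hy]
  · refine mul_eq_zero_of_right _ (eq_zero_of_tsupport_subset hg fun hb => hxn ?_)
    rw [Metric.mem_ball] at hb
    rw [Metric.mem_closedBall]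
    have h1 := dist_triangle x (x - t • y) x₀
    have h2 : dist x (x - t • y) = t * ‖y‖ := by
      rw [dist_eq_norm, sub_sub_cancel, norm_smul, Real.norm_of_nonneg ht]
    have h3 : t * ‖y‖ ≤ t * R := mul_le_mul_of_nonneg_left (not_lt.mp hy) ht
    linarith

theorem hol_of_avg {φ g : Pt n → ℝ} (hφ : Continuous φ) (hφc : HasCompactSupport φ)
    (hφ1 : ∫ y, φ y = 1) (hg : Continuous g) (hgc : HasCompactSupport g) {α N : ℝ}
    (h : ∀ᶠ t in 𝓝[>] (0 : ℝ), Hol α N (avg φ t g)) : Hol α N g := by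
  intro x y
  obtain ⟨B, -, hB⟩ := bounded_of_hasCompactSupport hg hgc
  have hcont := continuous_avg_scale hφ hφc hg hB
  have h1 := (((hcont x).sub (hcont y)).abs).tendsto 0
  simp only [Pi.sub_apply, avg_zero, hφ1, one_mul] at h1
  exact le_of_tendsto (h1.mono_left nhdsWithin_le_nhds) (h.mono fun t ht => ht x y)

theorem abs_mul_avg_sub_avg_mul_le {κ a g : Pt n → ℝ} (hκ : Continuous κ)
    (hκc : HasCompactSupport κ) (ha : Continuous a) (hg : Continuous g) {L G : ℝ} (hL : 0 ≤ L)
    (haL : ∀ x y, |a x - a y| ≤ L * ‖x - y‖) (hG : ∀ x, |g x| ≤ G) {t : ℝ} (ht : 0 ≤ t)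
    (x : Pt n) :
    |a x * avg κ t g x - avg κ t (fun z => a z * g z) x| ≤ (∫ y, |κ y| * ‖y‖) * (L * G * t) := by
  have hga : Continuous fun z => a z * g z := ha.mul hg
  rw [avg, avg, ← integral_const_mul (a x), ← integral_sub
    ((integrable_avg hκ hκc hg t x).const_mul _) (integrable_avg hκ hκc hga t x),
    ← integral_mul_const _ fun y : Pt n => |κ y| * ‖y‖, ← Real.norm_eq_abs]
  refine norm_integral_le_of_norm_le ?_ (ae_of_all _ fun y => ?_)
  · exact ((hκ.abs.mul continuous_norm).integrable_of_hasCompactSupport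
      hκc.norm.mul_right).mul_const _
  · have e : a x * (κ y * g (x - t • y)) - κ y * (a (x - t • y) * g (x - t • y))
        = κ y * ((a x - a (x - t • y)) * g (x - t • y)) := by ring
    rw [e, Real.norm_eq_abs, abs_mul, abs_mul, mul_assoc]
    refine mul_le_mul_of_nonneg_left ?_ (abs_nonneg _)
    have h1 : |a x - a (x - t • y)| ≤ L * (t * ‖y‖) := by
      simpa [norm_smul, abs_of_nonneg ht] using haL x (x - t • y)
    calc _ ≤ L * (t * ‖y‖) * G := mul_le_mul h1 (hG _) (abs_nonneg _) (by positivity)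
      _ = ‖y‖ * (L * G * t) := by ring

/-- The commutator of a Lipschitz multiplier and a mollifier is uniformly Hölder. -/
theorem exists_hol_commutator {ρ a g : Pt n → ℝ} (hρ : ContDiff ℝ ∞ ρ)
    (hρc : HasCompactSupport ρ) (ha : ContDiff ℝ 1 a) (hg : Continuous g) {L G α : ℝ}
    (hL : 0 ≤ L) (haL : ∀ x y, |a x - a y| ≤ L * ‖x - y‖) (hap : ∀ i x, |pd i a x| ≤ L)
    (hG : ∀ x, |g x| ≤ G) (hα : α ∈ Ioo (0 : ℝ) 1) :
    ∃ K, 0 ≤ K ∧ ∀ t ∈ Ioc (0 : ℝ) 1,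
      Hol α K fun x => a x * avg ρ t g x - avg ρ t (fun z => a z * g z) x := by
  have hG0 : 0 ≤ G := (abs_nonneg _).trans (hG 0)
  have hpρ : ∀ i, Continuous (pd i ρ) := fun i => (contDiff_pd (m := ∞) hρ le_rfl i).continuous
  set S := ∑ i, ∫ y, |pd i ρ y| * ‖y‖ with hS
  have hSi : ∀ i, 0 ≤ ∫ y, |pd i ρ y| * ‖y‖ := fun i => integral_nonneg fun y => by positivity
  have hS0 : 0 ≤ S := Finset.sum_nonneg fun i _ => hSi i
  have hR0 : 0 ≤ ∫ y, |ρ y| := integral_nonneg fun y => by positivity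
  have hR1 : 0 ≤ ∫ y, |ρ y| * ‖y‖ := integral_nonneg fun y => by positivity
  refine ⟨2 * ((∫ y, |ρ y| * ‖y‖) * (L * G)) + n * (L * ((∫ y, |ρ y|) * G) + S * (L * G)),
    by positivity, fun t ht => ?_⟩
  have hga : Continuous fun z => a z * g z := ha.continuous.mul hg
  have hd1 := (contDiff_avg hρ hρc hg ht.1).differentiable (by simp)
  have hd2 := (contDiff_avg hρ hρc hga ht.1).differentiable (by simp)
  have hda := ha.differentiable (by norm_num)
  refine hol_of_bounded_of_pd_le hα ((hda.mul hd1).sub hd2) (by positivity) (fun x => ?_)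
    fun i x => ?_
  · refine (abs_mul_avg_sub_avg_mul_le hρ.continuous hρc ha.continuous hg hL haL hG ht.1.le
      x).trans ?_
    exact mul_le_mul_of_nonneg_left (mul_le_of_le_one_right (by positivity) ht.2) hR1
  · have e : pd i (fun x => a x * avg ρ t g x - avg ρ t (fun z => a z * g z) x) x
        = pd i a x * avg ρ t g x
          + t⁻¹ * (a x * avg (pd i ρ) t g x - avg (pd i ρ) t (fun z => a z * g z) x) := by
      have h0 : (fun x => a x * avg ρ t g x - avg ρ t (fun z => a z * g z) x)
          = fun x => a x * avg ρ t g x + (-1) * avg ρ t (fun z => a z * g z) x := by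
        funext z; ring
      rw [h0, pd_add ((hda x).fun_mul (hd1 x)) ((hd2 x).const_mul _), pd_mul (hda x) (hd1 x),
        pd_const_mul _ (hd2 x), pd_avg_eq_kernel hρ hρc hg ht.1,
        pd_avg_eq_kernel hρ hρc hga ht.1]
      ring
    rw [e]
    refine (abs_add_le _ _).trans (add_le_add ?_ ?_)
    · rw [abs_mul]
      exact mul_le_mul (hap i x) (abs_avg_le hρ.continuous hρc hG t x) (abs_nonneg _) hL
    · rw [abs_mul, abs_of_pos (inv_pos.mpr ht.1)]
      have h1 := abs_mul_avg_sub_avg_mul_le (hpρ i) (hasCompactSupport_pd hρc i) ha.continuous hg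
        hL haL hG ht.1.le x
      calc _ ≤ t⁻¹ * ((∫ y, |pd i ρ y| * ‖y‖) * (L * G * t)) :=
            mul_le_mul_of_nonneg_left h1 (inv_pos.mpr ht.1).le
        _ = (∫ y, |pd i ρ y| * ‖y‖) * (L * G) := by
            have := ht.1.ne'
            field_simp
        _ ≤ S * (L * G) := by
            gcongr
            exact Finset.single_le_sum (fun j _ => hSi j) (Finset.mem_univ i)

theorem hol_of_contDiff_of_hasCompactSupport {f : Pt n → ℝ} (hf : ContDiff ℝ 1 f)
    (hfc : HasCompactSupport f) {α : ℝ} (hα : α ∈ Ioo (0 : ℝ) 1) : ∃ N, 0 ≤ N ∧ Hol α N f := by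
  obtain ⟨B, hB0, hB⟩ := bounded_of_hasCompactSupport hf.continuous hfc
  obtain ⟨L, hL0, hL⟩ := bounded_family_of_hasCompactSupport
    (fun i => (contDiff_pd (m := 0) hf (by norm_num) i).continuous) (hasCompactSupport_pd hfc)
  exact ⟨_, by positivity, hol_of_bounded_of_pd_le hα (hf.differentiable (by norm_num)) hL0 hB hL⟩

/-- Bundled conclusion of the local Schauder theory: the a priori estimate holds for all `C²`
functions supported near `x₀`, without assuming their Hessian to be Hölder continuous. -/
theorem exists_local_schauder_C2 [NeZero n] {a : Fin n → Fin n → Pt n → ℝ} {x₀ : Pt n} {L α : ℝ}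
    (ha : (Matrix.of fun i j => a i j x₀).PosDef) (hac : ∀ i j, ContDiff ℝ 1 (a i j)) (hL : 0 ≤ L)
    (haL : ∀ i j x y, |a i j x - a i j y| ≤ L * ‖x - y‖)
    (hap : ∀ i j l x, |pd l (a i j) x| ≤ L) (hα : α ∈ Ioo (0 : ℝ) 1) :
    ∃ r C, 0 < r ∧ 2 * r ≤ 1 ∧ 0 ≤ C ∧ ∀ (v : Pt n → ℝ) (M : ℝ), 0 ≤ M → ContDiff ℝ 2 v →
      tsupport v ⊆ Metric.ball x₀ r → Hol α M (op a v) →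
      ∀ k l, Hol α (C * M) (pd k (pd l v)) := by
  obtain ⟨r, C, hr, hr1, hC, hS⟩ := exists_local_schauder ha hL haL hα
  refine ⟨r / 2, C, by positivity, by linarith, hC, ?_⟩
  intro v M hM hv hvs hf
  refine hS v M hM hv (hvs.trans (Metric.ball_subset_ball (by linarith))) ?_ hf
  obtain ⟨ρ, hρ, hρc, hρ1⟩ := exists_mollifier (n := n)
  obtain ⟨R, hR⟩ := hρc.isCompact.isBounded.exists_norm_le
  have hRz : ∀ y, |R| < ‖y‖ → ρ y = 0 := fun y hy => by
    by_contra h0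
    exact absurd (hR y (subset_tsupport _ h0)) (not_le.mpr ((le_abs_self R).trans_lt hy))
  have hvc := hasCompactSupport_of_tsupport_subset_ball hvs
  have hv1 : ContDiff ℝ 1 v := hv.of_le (by norm_num)
  have hpd1 : ∀ i, ContDiff ℝ 1 (pd i v) := fun i => contDiff_pd hv (by norm_num) i
  have hpd2 : ∀ i j, Continuous (pd j (pd i v)) :=
    fun i j => (contDiff_pd (m := 0) (hpd1 i) (by norm_num) j).continuous
  have hpdc : ∀ i j, HasCompactSupport (pd j (pd i v)) :=
    fun i j => hasCompactSupport_pd (hasCompactSupport_pd hvc i) j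
  choose G hG0 hG using fun i j => bounded_of_hasCompactSupport (hpd2 i j) (hpdc i j)
  choose K hK0 hK using fun i j => exists_hol_commutator hρ hρc (hac i j) (hpd2 i j) hL (haL i j)
    (hap i j) (hG i j) hα
  set M' := (∫ y, |ρ y|) * M + ∑ i, ∑ j, K i j with hM'
  have hM'0 : 0 ≤ M' := add_nonneg (mul_nonneg (integral_nonneg fun y => abs_nonneg _) hM)
    (Finset.sum_nonneg fun i _ => Finset.sum_nonneg fun j _ => hK0 i j)
  refine ⟨C * M', fun k l => ?_⟩
  refine hol_of_avg hρ.continuous hρc hρ1 (hpd2 l k) (hpdc l k) ?_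
  have hsmall : ∀ᶠ t in 𝓝[>] (0 : ℝ), t < min 1 (r / (2 * (|R| + 1))) :=
    nhdsWithin_le_nhds (eventually_lt_nhds (lt_min one_pos (by positivity)))
  filter_upwards [hsmall, eventually_mem_nhdsWithin] with t htlt ht
  have ht0 : 0 < t := ht
  have ht1 : t ≤ 1 := (htlt.trans_le (min_le_left _ _)).le
  have htR : t * |R| < r / 2 := by
    have h1 : t < r / (2 * (|R| + 1)) := htlt.trans_le (min_le_right _ _)
    rw [lt_div_iff₀ (by positivity)] at h1
    nlinarith [abs_nonneg R]
  have hcomm : ∀ i j, pd j (pd i (avg ρ t v)) = avg ρ t (pd j (pd i v)) := by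
    intro i j
    have : pd i (avg ρ t v) = avg ρ t (pd i v) := funext fun z => pd_avg hρ hρc hv1 ht0 i z
    rw [this]
    exact funext fun z => pd_avg hρ hρc (hpd1 i) ht0 j z
  have hvt : ContDiff ℝ ∞ (avg ρ t v) := contDiff_avg hρ hρc hv.continuous ht0
  have hvtc : HasCompactSupport (avg ρ t v) := hasCompactSupport_avg hρc hvc ht0
  have hop : Hol α M' (op a (avg ρ t v)) := by
    have h1 := (hol_avg hρ.continuous hρc (continuous_op (fun i j => (hac i j).continuous) hv)
      hf t).add (Hol.sum Finset.univ fun i _ => Hol.sum Finset.univ fun j _ =>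
        hK i j t ⟨ht0, ht1⟩)
    convert h1 using 1
    funext z
    have e1 := avg_sum (h := fun i z => ∑ j, a i j z * pd j (pd i v) z) Finset.univ hρ.continuous
      hρc (fun i _ => continuous_finsetSum _ fun j _ => (hac i j).continuous.mul (hpd2 i j)) t z
    have e2 : ∀ i, _ := fun i => avg_sum (h := fun j z => a i j z * pd j (pd i v) z) Finset.univ
      hρ.continuous hρc (fun j _ => (hac i j).continuous.mul (hpd2 i j)) t z
    unfold op
    rw [e1]
    simp only [e2, hcomm, ← Finset.sum_add_distrib, add_sub_cancel]
  have h := hS (avg ρ t v) M' hM'0 (hvt.of_le two_le_infty)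
    ((tsupport_avg_subset hRz hvs ht0.le).trans
      (Metric.closedBall_subset_ball (by linarith))) ?_ hop k l
  · rwa [hcomm] at h
  · choose N hN0 hN using fun p : Fin n × Fin n => hol_of_contDiff_of_hasCompactSupport
      ((contDiff_pd (m := ∞) (contDiff_pd (m := ∞) hvt le_rfl p.2) le_rfl p.1).of_le
        (by exact_mod_cast le_top))
      (hasCompactSupport_pd (hasCompactSupport_pd hvtc p.2) p.1) hα
    exact ⟨∑ p, N p, fun k l => (hN (k, l)).mono
      (Finset.single_le_sum (fun p _ => hN0 p) (Finset.mem_univ (k, l)))⟩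

end Mollification

section Cutoff

variable {n : ℕ}

theorem exists_cutoff (x₀ : Pt n) {r : ℝ} (hr : 0 < r) :
    ∃ χ : Pt n → ℝ, ContDiff ℝ ∞ χ ∧ tsupport χ ⊆ Metric.ball x₀ r ∧
      ∀ᶠ x in 𝓝 x₀, χ x = 1 := by
  let f : ContDiffBump x₀ := ⟨r / 4, r / 2, by positivity, by linarith⟩
  refine ⟨f, f.contDiff, ?_, f.eventuallyEq_one⟩
  rw [f.tsupport_eq]
  exact Metric.closedBall_subset_ball (by change r / 2 < r; linarith)

theorem contDiff_mul_of_tsupport_subset {U : Set (Pt n)} (hU : IsOpen U) {k : WithTop ℕ∞}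
    {χ f : Pt n → ℝ} (hχ : ContDiff ℝ k χ) (hs : tsupport χ ⊆ U) (hf : ContDiffOn ℝ k f U) :
    ContDiff ℝ k fun x => χ x * f x := by
  rw [contDiff_iff_contDiffAt]
  intro x
  by_cases hx : x ∈ tsupport χ
  · exact hχ.contDiffAt.mul (hf.contDiffAt (hU.mem_nhds (hs hx)))
  · have : (fun x => χ x * f x) =ᶠ[𝓝 x] fun _ => 0 := by
      filter_upwards [(isClosed_tsupport χ).isOpen_compl.mem_nhds hx] with y hy
      rw [image_eq_zero_of_notMem_tsupport hy, zero_mul]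
    exact contDiffAt_const.congr_of_eventuallyEq this

theorem op_congr {a b : Fin n → Fin n → Pt n → ℝ} {v w : Pt n → ℝ} {x : Pt n}
    (ha : ∀ i j, a i j x = b i j x) (h : v =ᶠ[𝓝 x] w) : op a v x = op b w x := by
  unfold op
  refine Finset.sum_congr rfl fun i _ => Finset.sum_congr rfl fun j _ => ?_
  rw [ha, ((h.pd i).pd j).eq_of_nhds]

theorem op_eq_zero_of_notMem_tsupport {a : Fin n → Fin n → Pt n → ℝ} {v : Pt n → ℝ} {x : Pt n}
    (hx : x ∉ tsupport v) : op a v x = 0 :=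
  Finset.sum_eq_zero fun i _ => Finset.sum_eq_zero fun j _ => by
    rw [image_eq_zero_of_notMem_tsupport fun h =>
      hx (tsupport_pd_subset _ i (tsupport_pd_subset _ j h)), mul_zero]

/-- Local Schauder estimate for coefficients which are `C¹` on an open set. -/
theorem exists_local_schauder_on [NeZero n] {U : Set (Pt n)} (hU : IsOpen U)
    {a : Fin n → Fin n → Pt n → ℝ} (hac : ∀ i j, ContDiffOn ℝ 1 (a i j) U) {x₀ : Pt n}
    (hx₀ : x₀ ∈ U) (ha : (Matrix.of fun i j => a i j x₀).PosDef) {α : ℝ}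
    (hα : α ∈ Ioo (0 : ℝ) 1) :
    ∃ r C, 0 < r ∧ 2 * r ≤ 1 ∧ 0 ≤ C ∧ Metric.ball x₀ r ⊆ U ∧ ∀ (v : Pt n → ℝ) (M : ℝ), 0 ≤ M →
      ContDiff ℝ 2 v → tsupport v ⊆ Metric.ball x₀ r → Hol α M (op a v) →
      ∀ k l, Hol α (C * M) (pd k (pd l v)) := by
  obtain ⟨δ, hδ, hδU⟩ := Metric.isOpen_iff.mp hU x₀ hx₀
  obtain ⟨χ, hχ, hχs, hχ1⟩ := exists_cutoff x₀ hδ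
  have hχc := hasCompactSupport_of_tsupport_subset_ball hχs
  have hbc : ∀ i j, ContDiff ℝ 1 fun x => χ x * a i j x := fun i j =>
    contDiff_mul_of_tsupport_subset hU (hχ.of_le (by exact_mod_cast le_top)) (hχs.trans hδU)
      (hac i j)
  have hbs : ∀ i j, HasCompactSupport fun x => χ x * a i j x := fun i j => hχc.mul_right
  obtain ⟨L, hL0, hL⟩ := bounded_family_of_hasCompactSupport
    (f := fun (p : Fin n × Fin n × Fin n) => pd p.2.2 fun x => χ x * a p.1 p.2.1 x)
    (fun p => (contDiff_pd (m := 0) (hbc p.1 p.2.1) (by norm_num) p.2.2).continuous)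
    (fun p => hasCompactSupport_pd (hbs p.1 p.2.1) p.2.2)
  have hx1 : χ x₀ = 1 := hχ1.self_of_nhds
  obtain ⟨r, C, hr, hr1, hC, h⟩ := exists_local_schauder_C2
    (a := fun i j x => χ x * a i j x) (x₀ := x₀) (L := (n + 1) * L) (by simpa [hx1] using ha) hbc
    (by positivity)
    (fun i j x y => (abs_sub_le_of_pd_le convex_univ hL0
      (fun z _ => (hbc i j).differentiable (by norm_num) z) (fun l z _ => hL (i, j, l) z)
      (mem_univ x) (mem_univ y)).trans (by gcongr; linarith))
    (fun i j l x => (hL (i, j, l) x).trans (le_mul_of_one_le_left hL0 (by simp))) hα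
  obtain ⟨s, hs, hsχ⟩ := Metric.eventually_nhds_iff_ball.mp hχ1
  refine ⟨min r (min s δ), C, by positivity, by linarith [min_le_left r (min s δ)], hC,
    (Metric.ball_subset_ball ((min_le_right _ _).trans (min_le_right _ _))).trans hδU, ?_⟩
  intro v M hM hv hvs hf
  refine h v M hM hv (hvs.trans (Metric.ball_subset_ball (min_le_left _ _))) ?_
  convert hf using 1
  funext x
  by_cases hx : x ∈ tsupport v
  · refine op_congr (fun i j => ?_) EventuallyEq.rfl
    rw [hsχ x (Metric.ball_subset_ball ((min_le_right _ _).trans (min_le_left _ _)) (hvs hx)),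
      one_mul]
  · rw [op_eq_zero_of_notMem_tsupport hx, op_eq_zero_of_notMem_tsupport hx]

end Cutoff

section HolderBounds

variable {n : ℕ}

/-- `f` is bounded by `M` and `α`-Hölder with constant `M` on `B`. -/
def HB (B : Set (Pt n)) (α M : ℝ) (f : Pt n → ℝ) : Prop :=
  (∀ x ∈ B, |f x| ≤ M) ∧ ∀ x ∈ B, ∀ y ∈ B, |f x - f y| ≤ M * ‖x - y‖ ^ α

variable {B : Set (Pt n)} {α M M' : ℝ} {f h : Pt n → ℝ}

theorem HB.mono (hf : HB B α M f) (hM : M ≤ M') : HB B α M' f :=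
  ⟨fun x hx => (hf.1 x hx).trans hM, fun x hx y hy => (hf.2 x hx y hy).trans (by gcongr)⟩

theorem HB.mono_set {B' : Set (Pt n)} (hf : HB B α M f) (hB : B' ⊆ B) : HB B' α M f :=
  ⟨fun x hx => hf.1 x (hB hx), fun x hx y hy => hf.2 x (hB hx) y (hB hy)⟩

theorem HB.congr (hf : HB B α M f) (he : ∀ x ∈ B, h x = f x) : HB B α M h :=
  ⟨fun x hx => by rw [he x hx]; exact hf.1 x hx,
    fun x hx y hy => by rw [he x hx, he y hy]; exact hf.2 x hx y hy⟩

theorem HB.add (hf : HB B α M f) (hh : HB B α M' h) : HB B α (M + M') fun x => f x + h x := by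
  refine ⟨fun x hx => (abs_add_le _ _).trans (add_le_add (hf.1 x hx) (hh.1 x hx)),
    fun x hx y hy => ?_⟩
  have e : f x + h x - (f y + h y) = (f x - f y) + (h x - h y) := by ring
  rw [e, add_mul]
  exact (abs_add_le _ _).trans (add_le_add (hf.2 x hx y hy) (hh.2 x hx y hy))

theorem HB.const_mul (c : ℝ) (hf : HB B α M f) : HB B α (|c| * M) fun x => c * f x := by
  refine ⟨fun x hx => ?_, fun x hx y hy => ?_⟩
  · rw [abs_mul]
    exact mul_le_mul_of_nonneg_left (hf.1 x hx) (abs_nonneg _)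
  · rw [← mul_sub, abs_mul, mul_assoc]
    exact mul_le_mul_of_nonneg_left (hf.2 x hx y hy) (abs_nonneg _)

theorem HB.sum {ι : Type*} (s : Finset ι) {M : ι → ℝ} {f : ι → Pt n → ℝ}
    (hf : ∀ i ∈ s, HB B α (M i) (f i)) : HB B α (∑ i ∈ s, M i) fun x => ∑ i ∈ s, f i x := by
  refine ⟨fun x hx => (Finset.abs_sum_le_sum_abs _ _).trans
    (Finset.sum_le_sum fun i hi => (hf i hi).1 x hx), fun x hx y hy => ?_⟩
  rw [← Finset.sum_sub_distrib, Finset.sum_mul]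
  exact (Finset.abs_sum_le_sum_abs _ _).trans
    (Finset.sum_le_sum fun i hi => (hf i hi).2 x hx y hy)

theorem HB.mul (hf : HB B α M f) (hh : HB B α M' h) :
    HB B α (2 * (M * M')) fun x => f x * h x := by
  refine ⟨fun x hx => ?_, fun x hx y hy => ?_⟩
  · have h1 := mul_le_mul (hf.1 x hx) (hh.1 x hx) (abs_nonneg _)
      ((abs_nonneg _).trans (hf.1 x hx))
    have h0 : 0 ≤ M * M' := (by positivity : 0 ≤ |f x| * |h x|).trans h1
    rw [abs_mul]; linarith
  · have hM : 0 ≤ M := (abs_nonneg _).trans (hf.1 x hx)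
    have hM' : 0 ≤ M' := (abs_nonneg _).trans (hh.1 x hx)
    have e : f x * h x - f y * h y = f x * (h x - h y) + (f x - f y) * h y := by ring
    rw [e]
    refine (abs_add_le _ _).trans ?_
    rw [abs_mul, abs_mul]
    have h1 := mul_le_mul (hf.1 x hx) (hh.2 x hx y hy) (abs_nonneg _) hM
    have h2 := mul_le_mul (hf.2 x hx y hy) (hh.1 y hy) (abs_nonneg _) (by positivity)
    linarith

theorem HB.of_hol (hb : ∀ x, |f x| ≤ M) (hf : Hol α M f) : HB B α M f :=
  ⟨fun x _ => hb x, fun x _ y _ => hf x y⟩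

/-- A product with a factor vanishing outside `B` only sees the other factor on `B`. -/
theorem HB.hol_mul {χ : Pt n → ℝ} (hχ : HB univ α M' χ) (hχ0 : ∀ x ∉ B, χ x = 0)
    (hM : 0 ≤ M) (hf : HB B α M f) : Hol α (2 * (M' * M)) fun x => χ x * f x := by
  have hM' : 0 ≤ M' := (abs_nonneg _).trans (hχ.1 0 (mem_univ _))
  have key : ∀ x ∈ B, ∀ y, |χ x * f x - χ y * f y| ≤ 2 * (M' * M) * ‖x - y‖ ^ α := by
    intro x hx y
    by_cases hy : y ∈ B
    · exact ((hχ.mono_set (subset_univ B)).mul hf).2 x hx y hy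
    · have h1 := mul_le_mul (hχ.2 x (mem_univ _) y (mem_univ _)) (hf.1 x hx) (abs_nonneg _)
        (by positivity)
      rw [hχ0 y hy, sub_zero, ← abs_mul] at h1
      rw [hχ0 y hy, zero_mul, sub_zero]
      refine h1.trans ?_
      have : 0 ≤ M' * M * ‖x - y‖ ^ α := by positivity
      linarith
  intro x y
  by_cases hx : x ∈ B
  · exact key x hx y
  · by_cases hy : y ∈ B
    · change |χ x * f x - χ y * f y| ≤ _
      rw [abs_sub_comm, norm_sub_rev]
      exact key y hy x
    · simp only [hχ0 x hx, hχ0 y hy, zero_mul, sub_zero, abs_zero]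
      positivity

theorem exists_hb_of_contDiff_of_hasCompactSupport (hf : ContDiff ℝ 1 f)
    (hfc : HasCompactSupport f) (hα : α ∈ Ioo (0 : ℝ) 1) : ∃ N, 0 ≤ N ∧ HB univ α N f := by
  obtain ⟨B, hB0, hB⟩ := bounded_of_hasCompactSupport hf.continuous hfc
  obtain ⟨N, hN0, hN⟩ := hol_of_contDiff_of_hasCompactSupport hf hfc hα
  exact ⟨B + N, by positivity, HB.of_hol (fun x => (hB x).trans (by linarith))
    (hN.mono (by linarith))⟩

/-- Local boundedness and Hölder continuity at a point. -/
def LH (α : ℝ) (f : Pt n → ℝ) (x : Pt n) : Prop := ∃ M, ∃ s ∈ 𝓝 x, HB s α M f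

theorem LH.add {x : Pt n} (hf : LH α f x) (hh : LH α h x) : LH α (fun x => f x + h x) x := by
  obtain ⟨M, s, hs, hfs⟩ := hf
  obtain ⟨M', s', hs', hhs⟩ := hh
  exact ⟨_, s ∩ s', inter_mem hs hs', (hfs.mono_set inter_subset_left).add
    (hhs.mono_set inter_subset_right)⟩

theorem LH.mul {x : Pt n} (hf : LH α f x) (hh : LH α h x) : LH α (fun x => f x * h x) x := by
  obtain ⟨M, s, hs, hfs⟩ := hf
  obtain ⟨M', s', hs', hhs⟩ := hh
  exact ⟨_, s ∩ s', inter_mem hs hs', (hfs.mono_set inter_subset_left).mul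
    (hhs.mono_set inter_subset_right)⟩

theorem LH.congr {x : Pt n} (hf : LH α f x) (he : h =ᶠ[𝓝 x] f) : LH α h x := by
  obtain ⟨M, s, hs, hfs⟩ := hf
  exact ⟨M, s ∩ {y | h y = f y}, inter_mem hs he, (hfs.mono_set inter_subset_left).congr
    fun y hy => hy.2⟩

theorem LH.exists_ball {x : Pt n} (hf : LH α f x) :
    ∃ M r, 0 ≤ M ∧ 0 < r ∧ HB (Metric.ball x r) α M f := by
  obtain ⟨M, s, hs, hfs⟩ := hf
  obtain ⟨r, hr, hrs⟩ := Metric.mem_nhds_iff.mp hs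
  exact ⟨M, r, (abs_nonneg _).trans (hfs.1 x (mem_of_mem_nhds hs)), hr, hfs.mono_set hrs⟩

theorem LH.exists_uniform {ι : Type*} [Finite ι] {f : ι → Pt n → ℝ} {x : Pt n}
    (hf : ∀ i, LH α (f i) x) :
    ∃ M r, 0 ≤ M ∧ 0 < r ∧ ∀ i, HB (Metric.ball x r) α M (f i) := by
  cases nonempty_fintype ι
  choose M r hM hr h using fun i => (hf i).exists_ball
  rcases isEmpty_or_nonempty ι with hι | hι
  · exact ⟨0, 1, le_rfl, one_pos, fun i => isEmptyElim i⟩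
  obtain ⟨i₀, hi₀⟩ := Finite.exists_min r
  exact ⟨∑ i, M i, r i₀, Finset.sum_nonneg fun i _ => hM i, hr i₀, fun i =>
    ((h i).mono_set (Metric.ball_subset_ball (hi₀ i))).mono
      (Finset.single_le_sum (fun j _ => hM j) (Finset.mem_univ i))⟩

theorem LH.continuousAt (hα : 0 < α) {x : Pt n} (hf : LH α f x) : ContinuousAt f x := by
  obtain ⟨M, r, hM, hr, h⟩ := hf.exists_ball
  rw [ContinuousAt, tendsto_iff_norm_sub_tendsto_zero]
  have hlim : Tendsto (fun y => M * ‖y - x‖ ^ α) (𝓝 x) (𝓝 0) := by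
    have : Continuous fun y : Pt n => M * ‖y - x‖ ^ α :=
      continuous_const.mul ((continuous_id.sub continuous_const).norm.rpow_const
        fun _ => Or.inr hα.le)
    simpa [Real.zero_rpow hα.ne'] using this.tendsto x
  refine squeeze_zero' (Eventually.of_forall fun y => norm_nonneg _) ?_ hlim
  filter_upwards [Metric.ball_mem_nhds x hr] with y hy
  exact h.2 y hy x (Metric.mem_ball_self hr)

theorem _root_.ContDiffAt.lh {x : Pt n} (hα : α ∈ Ioo (0 : ℝ) 1) (hf : ContDiffAt ℝ 1 f x) :
    LH α f x := by
  obtain ⟨K, t, ht, hK⟩ := hf.exists_lipschitzOnWith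
  obtain ⟨r, hr, hrt⟩ := Metric.mem_nhds_iff.mp ht
  have hxt : x ∈ t := mem_of_mem_nhds ht
  have hs : Metric.ball x (min r (1 / 2)) ⊆ t :=
    (Metric.ball_subset_ball (min_le_left _ _)).trans hrt
  refine ⟨K + |f x|, Metric.ball x (min r (1 / 2)), Metric.ball_mem_nhds x (by positivity), fun y hy => ?_,
    fun y hy z hz => ?_⟩
  · have h1 := hK.dist_le_mul y (hs hy) x hxt
    have h2 : dist y x ≤ 1 :=
      ((Metric.mem_ball.mp hy).trans_le (min_le_right _ _)).le.trans (by norm_num)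
    rw [Real.dist_eq] at h1
    have h3 : |f y| ≤ |f y - f x| + |f x| := by
      simpa using abs_add_le (f y - f x) (f x)
    nlinarith [K.2, (NNReal.coe_nonneg K)]
  · have h1 := hK.dist_le_mul y (hs hy) z (hs hz)
    rw [Real.dist_eq, dist_eq_norm] at h1
    have h2 : ‖y - z‖ ≤ 1 := by
      rw [← dist_eq_norm]
      have h3 := (Metric.mem_ball.mp hy).trans_le (min_le_right _ _)
      have h4 := (Metric.mem_ball.mp hz).trans_le (min_le_right _ _)
      linarith [dist_triangle_right y z x]
    have h5 : ‖y - z‖ ≤ ‖y - z‖ ^ α := by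
      rcases (norm_nonneg (y - z)).eq_or_lt with h0 | h0
      · rw [← h0, Real.zero_rpow hα.1.ne']
      · simpa using Real.rpow_le_rpow_of_exponent_ge h0 h2 hα.2.le
    refine h1.trans ?_
    have := NNReal.coe_nonneg K
    calc (K : ℝ) * ‖y - z‖ ≤ K * ‖y - z‖ ^ α := by gcongr
      _ ≤ (K + |f x|) * ‖y - z‖ ^ α := by
        gcongr
        linarith [abs_nonneg (f x)]

end HolderBounds

section HolderClasses

variable {n : ℕ} {α : ℝ} {U : Set (Pt n)} {f h : Pt n → ℝ}

/-- Functions on `U` all of whose iterated partial derivatives up to order `k` exist and are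
locally `α`-Hölder. -/
def HC (α : ℝ) (U : Set (Pt n)) : ℕ → (Pt n → ℝ) → Prop
  | 0, f => ∀ x ∈ U, LH α f x
  | k + 1, f => ContDiffOn ℝ 1 f U ∧ ∀ i, HC α U k (pd i f)

theorem pd_eqOn (hU : IsOpen U) (he : ∀ x ∈ U, h x = f x) (i : Fin n) :
    ∀ x ∈ U, pd i h x = pd i f x := fun _ hx =>
  (Filter.eventuallyEq_of_mem (hU.mem_nhds hx) he).pd_eq i

theorem HC.congr (hU : IsOpen U) {k : ℕ} (hf : HC α U k f) (he : ∀ x ∈ U, h x = f x) :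
    HC α U k h := by
  induction k generalizing f h with
  | zero => exact fun x hx => (hf x hx).congr (Filter.eventuallyEq_of_mem (hU.mem_nhds hx) he)
  | succ k ih => exact ⟨hf.1.congr he, fun i => ih (hf.2 i) (pd_eqOn hU he i)⟩

theorem HC.lower (hα : α ∈ Ioo (0 : ℝ) 1) (hU : IsOpen U) {k : ℕ} (hf : HC α U (k + 1) f) :
    HC α U k f := by
  induction k generalizing f with
  | zero => exact fun x hx => (hf.1.contDiffAt (hU.mem_nhds hx)).lh hα
  | succ k ih => exact ⟨hf.1, fun i => ih (hf.2 i)⟩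

theorem HC.mono (hα : α ∈ Ioo (0 : ℝ) 1) (hU : IsOpen U) {k m : ℕ} (hf : HC α U k f)
    (hm : m ≤ k) : HC α U m f := by
  induction k, hm using Nat.le_induction with
  | base => exact hf
  | succ k _ ih => exact ih (hf.lower hα hU)

theorem HC.contDiffOn (hα : 0 < α) (hU : IsOpen U) {k : ℕ} (hf : HC α U k f) :
    ContDiffOn ℝ k f U := by
  induction k generalizing f with
  | zero =>
    exact contDiffOn_zero.mpr fun x hx => ((hf x hx).continuousAt hα).continuousWithinAt
  | succ k ih =>
    push_cast
    rw [contDiffOn_succ_iff_fderiv_of_isOpen hU]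
    refine ⟨hf.1.differentiableOn one_ne_zero, by simp, ?_⟩
    rw [contDiffOn_clm_apply]
    intro y
    have : (fun x => fderiv ℝ f x y) = fun x => ∑ i, y i * pd i f x := by
      ext x
      exact fderiv_apply_eq_sum f x y
    rw [this]
    exact ContDiffOn.sum fun i _ => contDiffOn_const.mul (ih (hf.2 i))

theorem HC.differentiableAt (hU : IsOpen U) {k : ℕ} (hf : HC α U (k + 1) f) {x : Pt n}
    (hx : x ∈ U) : DifferentiableAt ℝ f x :=
  (hf.1.differentiableOn one_ne_zero).differentiableAt (hU.mem_nhds hx)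

theorem HC.of_contDiffOn (hα : α ∈ Ioo (0 : ℝ) 1) (hU : IsOpen U) {k : ℕ}
    (hf : ContDiffOn ℝ ((k + 1 : ℕ) : WithTop ℕ∞) f U) : HC α U k f := by
  induction k generalizing f with
  | zero => exact fun x hx => ((by simpa using hf : ContDiffOn ℝ 1 f U).contDiffAt
      (hU.mem_nhds hx)).lh hα
  | succ k ih =>
    exact ⟨hf.of_le (by push_cast; exact le_add_self),
      fun i => ih (contDiffOn_pd hU hf (by push_cast; rfl) i)⟩

theorem HC.const (hα : α ∈ Ioo (0 : ℝ) 1) (hU : IsOpen U) (k : ℕ) (c : ℝ) :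
    HC α U k fun _ => c :=
  HC.of_contDiffOn hα hU contDiffOn_const

theorem HC.add (hU : IsOpen U) {k : ℕ} (hf : HC α U k f) (hh : HC α U k h) :
    HC α U k fun x => f x + h x := by
  induction k generalizing f h with
  | zero => exact fun x hx => (hf x hx).add (hh x hx)
  | succ k ih =>
    exact ⟨hf.1.add hh.1, fun i => (ih (hf.2 i) (hh.2 i)).congr hU fun x hx =>
      pd_add (hf.differentiableAt hU hx) (hh.differentiableAt hU hx) i⟩

theorem HC.mul (hα : α ∈ Ioo (0 : ℝ) 1) (hU : IsOpen U) {k : ℕ} (hf : HC α U k f)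
    (hh : HC α U k h) : HC α U k fun x => f x * h x := by
  induction k generalizing f h with
  | zero => exact fun x hx => (hf x hx).mul (hh x hx)
  | succ k ih =>
    exact ⟨hf.1.mul hh.1, fun i => ((ih (hf.2 i) (hh.lower hα hU)).add hU
      (ih (hf.lower hα hU) (hh.2 i))).congr hU fun x hx =>
      pd_mul (hf.differentiableAt hU hx) (hh.differentiableAt hU hx) i⟩

theorem HC.sum (hα : α ∈ Ioo (0 : ℝ) 1) (hU : IsOpen U) {k : ℕ} {ι : Type*} (s : Finset ι)
    {f : ι → Pt n → ℝ} (hf : ∀ i ∈ s, HC α U k (f i)) :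
    HC α U k fun x => ∑ i ∈ s, f i x := by
  classical
  induction s using Finset.induction_on with
  | empty => simpa using HC.const hα hU k 0
  | insert a s ha ih =>
    simp only [Finset.sum_insert ha]
    exact (hf a (Finset.mem_insert_self a s)).add hU
      (ih fun i hi => hf i (Finset.mem_insert_of_mem hi))

theorem LH.comp {φ : ℝ → ℝ} {x : Pt n} (hα : 0 < α) (hφ : ContDiffAt ℝ 1 φ (f x))
    (hf : LH α f x) : LH α (fun y => φ (f y)) x := by
  obtain ⟨K, t, ht, hK⟩ := hφ.exists_lipschitzOnWith
  have hc := hf.continuousAt hα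
  have hxt : f x ∈ t := mem_of_mem_nhds ht
  obtain ⟨M, s, hs, hfs⟩ := hf
  have hM : 0 ≤ M := (abs_nonneg _).trans (hfs.1 x (mem_of_mem_nhds hs))
  refine ⟨2 * (K * M) + |φ (f x)|, s ∩ f ⁻¹' t, inter_mem hs (hc ht), fun y hy => ?_,
    fun y hy z hz => ?_⟩
  · have h1 := hK.dist_le_mul _ hy.2 _ hxt
    rw [Real.dist_eq, Real.dist_eq] at h1
    have h2 : |f y - f x| ≤ 2 * M := by
      have := abs_sub (f y) (f x)
      linarith [hfs.1 y hy.1, hfs.1 x (mem_of_mem_nhds hs)]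
    have h3 : |φ (f y)| ≤ |φ (f y) - φ (f x)| + |φ (f x)| := by
      simpa using abs_add_le (φ (f y) - φ (f x)) (φ (f x))
    have h4 := mul_le_mul_of_nonneg_left h2 K.2
    simp only [NNReal.val_eq_coe] at h4
    linarith
  · have h1 := hK.dist_le_mul _ hy.2 _ hz.2
    rw [Real.dist_eq, Real.dist_eq] at h1
    refine h1.trans ?_
    calc (K : ℝ) * |f y - f z| ≤ K * (M * ‖y - z‖ ^ α) := by
          gcongr
          exact hfs.2 y hy.1 z hz.1
      _ = (K * M) * ‖y - z‖ ^ α := by ring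
      _ ≤ _ := by
          gcongr
          have : 0 ≤ K * M := by positivity
          linarith [abs_nonneg (φ (f x))]

theorem pd_comp {φ : ℝ → ℝ} {x : Pt n} (hφ : DifferentiableAt ℝ φ (f x))
    (hf : DifferentiableAt ℝ f x) (i : Fin n) :
    pd i (fun y => φ (f y)) x = deriv φ (f x) * pd i f x := by
  exact (hφ.hasDerivAt.comp_hasFDerivAt x hf.hasFDerivAt).pd_eq i

theorem HC.comp (hα : α ∈ Ioo (0 : ℝ) 1) (hU : IsOpen U) {V : Set ℝ} (hV : IsOpen V)
    {φ : ℝ → ℝ} (hφ : AnalyticOnNhd ℝ φ V) {k : ℕ} (hfV : MapsTo f U V) (hf : HC α U k f) :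
    HC α U k fun x => φ (f x) := by
  induction k generalizing φ with
  | zero => exact fun x hx => (hf x hx).comp hα.1 (hφ _ (hfV hx)).contDiffAt
  | succ k ih =>
    refine ⟨(hφ.contDiffOn hV.uniqueDiffOn).comp hf.1 hfV, fun i => ?_⟩
    refine ((ih hφ.deriv (hf.lower hα hU)).mul hα hU (hf.2 i)).congr hU fun x hx => ?_
    exact pd_comp (hφ _ (hfV hx)).differentiableAt (hf.differentiableAt hU hx) i

end HolderClasses

section VectorHolder

variable {n : ℕ} {r : NNReal} {U : Set (Pt n)}

/-- `F` is locally `r`-Hölder within `U` at `x`. -/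
def HolAt {G : Type*} [PseudoEMetricSpace G] (r : NNReal) (U : Set (Pt n)) (F : Pt n → G)
    (x : Pt n) : Prop :=
  ∃ C : NNReal, ∃ t ∈ 𝓝[U] x, HolderOnWith C r F t

theorem HolAt.comp {G G' : Type*} [PseudoEMetricSpace G] [PseudoEMetricSpace G']
    {F : Pt n → G} {x : Pt n} (hF : HolAt r U F x) {K : NNReal} {L : G → G'}
    (hL : LipschitzWith K L) : HolAt r U (fun y => L (F y)) x := by
  obtain ⟨C, t, ht, h⟩ := hF
  have := (holderWith_one.mpr hL).comp_holderOnWith h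
  rw [one_mul] at this
  exact ⟨_, t, ht, this⟩

theorem HolAt.congr {G : Type*} [PseudoEMetricSpace G] {F H : Pt n → G} {x : Pt n}
    (hF : HolAt r U F x) (h : EqOn H F U) : HolAt r U H x := by
  obtain ⟨C, t, ht, hC⟩ := hF
  refine ⟨C, t ∩ U, inter_mem ht self_mem_nhdsWithin, fun y hy z hz => ?_⟩
  rw [h hy.2, h hz.2]
  exact hC y hy.1 z hz.1

theorem HolAt.add {G : Type*} [SeminormedAddCommGroup G] {F H : Pt n → G} {x : Pt n}
    (hF : HolAt r U F x) (hH : HolAt r U H x) : HolAt r U (fun y => F y + H y) x := by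
  obtain ⟨C, t, ht, hC⟩ := hF
  obtain ⟨D, s, hs, hD⟩ := hH
  refine ⟨C + D, t ∩ s, inter_mem ht hs, fun y hy z hz => ?_⟩
  refine (edist_add_add_le _ _ _ _).trans ?_
  push_cast
  rw [add_mul]
  exact add_le_add (hC y hy.1 z hz.1) (hD y hy.2 z hz.2)

variable {E E' : Type} [NormedAddCommGroup E] [NormedSpace ℝ E] [NormedAddCommGroup E']
  [NormedSpace ℝ E']

/-- Vector valued functions of class `C^{k+r}` on `U`. -/
def VH (r : NNReal) (U : Set (Pt n)) (k : ℕ) (F : Pt n → E) : Prop :=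
  ContDiffOn ℝ k F U ∧ ∀ x ∈ U, HolAt r U (iteratedFDerivWithin ℝ k F U) x

theorem VH.congr {k : ℕ} {F H : Pt n → E} (hF : VH r U k F) (h : EqOn H F U) : VH r U k H :=
  ⟨hF.1.congr h, fun x hx => (hF.2 x hx).congr fun _ hy => iteratedFDerivWithin_congr h hy k⟩

theorem VH.clm (hU : IsOpen U) {k : ℕ} {F : Pt n → E} (hF : VH r U k F) (L : E →L[ℝ] E') :
    VH r U k fun x => L (F x) := by
  refine ⟨L.contDiff.comp_contDiffOn hF.1, fun x hx => ?_⟩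
  refine ((hF.2 x hx).comp
    (ContinuousLinearMap.compContinuousMultilinearMapL ℝ (fun _ : Fin k => Pt n) E E'
      L).lipschitz).congr fun y hy => ?_
  exact L.iteratedFDerivWithin_comp_left (hF.1 y hy) hU.uniqueDiffOn hy le_rfl

theorem VH.add (hU : IsOpen U) {k : ℕ} {F H : Pt n → E} (hF : VH r U k F) (hH : VH r U k H) :
    VH r U k fun x => F x + H x :=
  ⟨hF.1.add hH.1, fun x hx => ((hF.2 x hx).add (hH.2 x hx)).congr fun y hy =>
    iteratedFDerivWithin_add_apply (hF.1 y hy) (hH.1 y hy) hU.uniqueDiffOn hy⟩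

theorem VH.zero (k : ℕ) : VH r U k fun _ => (0 : E) := by
  refine ⟨contDiffOn_const, fun x _ => ⟨0, univ, univ_mem, fun y _ z _ => ?_⟩⟩
  have : iteratedFDerivWithin ℝ k (fun _ : Pt n => (0 : E)) U = 0 := iteratedFDerivWithin_fun_zero
  simp [this]

theorem VH.sum (hU : IsOpen U) {k : ℕ} {ι : Type*} (s : Finset ι) {F : ι → Pt n → E}
    (hF : ∀ i ∈ s, VH r U k (F i)) : VH r U k fun x => ∑ i ∈ s, F i x := by
  classical
  induction s using Finset.induction_on with
  | empty => simpa using VH.zero k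
  | insert a s ha ih =>
    simp only [Finset.sum_insert ha]
    exact (hF a (Finset.mem_insert_self a s)).add hU
      (ih fun i hi => hF i (Finset.mem_insert_of_mem hi))

theorem vh_zero_iff {F : Pt n → E} (hr : 0 < r) :
    VH r U 0 F ↔ ∀ x ∈ U, HolAt r U F x := by
  constructor
  · intro h x hx
    exact (h.2 x hx).comp (continuousMultilinearCurryFin0 ℝ (Pt n) E).lipschitz
  · intro h
    refine ⟨contDiffOn_zero.mpr fun x hx => ?_, fun x hx => ?_⟩
    · obtain ⟨C, t, ht, hC⟩ := h x hx
      exact ((hC.continuousOn hr) x (mem_of_mem_nhdsWithin hx ht)).mono_of_mem_nhdsWithin ht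
    · exact (h x hx).comp (continuousMultilinearCurryFin0 ℝ (Pt n) E).symm.lipschitz

theorem vh_succ_iff (hU : IsOpen U) {k : ℕ} {F : Pt n → E} :
    VH r U (k + 1) F ↔ DifferentiableOn ℝ F U ∧ VH r U k (fderiv ℝ F) := by
  have hfd : EqOn (fderivWithin ℝ F U) (fderiv ℝ F) U := fun x hx => fderivWithin_of_isOpen hU hx
  have hcd : ContDiffOn ℝ ((k + 1 : ℕ) : WithTop ℕ∞) F U ↔
      DifferentiableOn ℝ F U ∧ ContDiffOn ℝ k (fderiv ℝ F) U := by
    push_cast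
    rw [contDiffOn_succ_iff_fderiv_of_isOpen hU]
    simp
  constructor
  · rintro ⟨h1, h2⟩
    refine ⟨(hcd.mp h1).1, (hcd.mp h1).2, fun x hx => ?_⟩
    refine ((h2 x hx).comp (continuousMultilinearCurryRightEquiv' ℝ k (Pt n) E).lipschitz).congr
      fun y hy => ?_
    beta_reduce
    rw [iteratedFDerivWithin_succ_eq_comp_right hU.uniqueDiffOn hy, Function.comp_apply,
      LinearIsometryEquiv.apply_symm_apply]
    exact (iteratedFDerivWithin_congr hfd hy k).symm
  · rintro ⟨h1, h2, h3⟩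
    refine ⟨hcd.mpr ⟨h1, h2⟩, fun x hx => ?_⟩
    refine ((h3 x hx).comp
      (continuousMultilinearCurryRightEquiv' ℝ k (Pt n) E).symm.lipschitz).congr fun y hy => ?_
    rw [iteratedFDerivWithin_succ_eq_comp_right hU.uniqueDiffOn hy, Function.comp_apply]
    congr 1
    exact iteratedFDerivWithin_congr hfd hy k

theorem vh_fderiv_iff (hU : IsOpen U) {k : ℕ} {f : Pt n → ℝ} :
    VH r U k (fderiv ℝ f) ↔ ∀ i, VH r U k (pd i f) := by
  constructor
  · intro h i
    exact h.clm hU (ContinuousLinearMap.apply ℝ ℝ (Pi.single i (1 : ℝ) : Pt n))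
  · intro h
    have h1 : VH r U k fun x => ∑ i, (pd i f x) •
        (ContinuousLinearMap.proj i : Pt n →L[ℝ] ℝ) :=
      VH.sum hU _ fun i _ => (h i).clm hU
        ((ContinuousLinearMap.id ℝ ℝ).smulRight (ContinuousLinearMap.proj i : Pt n →L[ℝ] ℝ))
    refine h1.congr fun x _ => ?_
    ext1 v
    rw [fderiv_apply_eq_sum, _root_.sum_apply]
    exact Finset.sum_congr rfl fun i _ => by
      simp [mul_comm]

theorem lh_iff_holAt (hU : IsOpen U) {α : ℝ} (hα : 0 < α) {f : Pt n → ℝ} {x : Pt n}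
    (hx : x ∈ U) : LH α f x ↔ HolAt α.toNNReal U f x := by
  have hα' : ((α.toNNReal : NNReal) : ℝ) = α := Real.coe_toNNReal α hα.le
  constructor
  · rintro ⟨M, s, hs, h⟩
    have hM : 0 ≤ M := (abs_nonneg _).trans (h.1 x (mem_of_mem_nhds hs))
    refine ⟨M.toNNReal, s, mem_nhdsWithin_of_mem_nhds hs, fun y hy z hz => ?_⟩
    have h1 := h.2 y hy z hz
    rw [edist_dist, edist_dist, Real.dist_eq, dist_eq_norm, hα',
      ENNReal.ofReal_rpow_of_nonneg (norm_nonneg _) hα.le]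
    rw [← ENNReal.ofReal, ← ENNReal.ofReal_mul hM]
    exact ENNReal.ofReal_le_ofReal h1
  · rintro ⟨C, t, ht, h⟩
    rw [hU.nhdsWithin_eq hx] at ht
    obtain ⟨ε, hε, hεt⟩ := Metric.mem_nhds_iff.mp ht
    have hxt := mem_of_mem_nhds ht
    have key : ∀ y ∈ t, ∀ z ∈ t, |f y - f z| ≤ C * ‖y - z‖ ^ α := by
      intro y hy z hz
      have := h.dist_le hy hz
      rwa [hα', Real.dist_eq, dist_eq_norm] at this
    refine ⟨C * ε ^ α + C + |f x|, Metric.ball x ε, Metric.ball_mem_nhds x hε, fun y hy => ?_,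
      fun y hy z hz => ?_⟩
    · have h1 := key y (hεt hy) x hxt
      have h2 : ‖y - x‖ ^ α ≤ ε ^ α := by
        gcongr
        exact (mem_ball_iff_norm.mp hy).le
      have h3 : |f y| ≤ |f y - f x| + |f x| := by simpa using abs_add_le (f y - f x) (f x)
      have h4 := mul_le_mul_of_nonneg_left h2 C.2
      simp only [NNReal.val_eq_coe] at h4
      linarith [NNReal.coe_nonneg C]
    · refine (key y (hεt hy) z (hεt hz)).trans ?_
      gcongr
      have : 0 ≤ (C : ℝ) * ε ^ α := by positivity
      linarith [abs_nonneg (f x)]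

theorem hc_iff_cHolderOn (hU : IsOpen U) {α : ℝ} (hα : 0 < α) {k : ℕ}
    {f : Pt n → ℝ} : HC α U k f ↔ CHolderOn k α U f := by
  change HC α U k f ↔ VH α.toNNReal U k f
  induction k generalizing f with
  | zero =>
    rw [vh_zero_iff (Real.toNNReal_pos.mpr hα)]
    exact forall₂_congr fun x hx => lh_iff_holAt hU hα hx
  | succ k ih =>
    rw [vh_succ_iff hU, vh_fderiv_iff hU]
    constructor
    · exact fun h => ⟨h.1.differentiableOn one_ne_zero, fun i => (ih (f := pd i f)).mp (h.2 i)⟩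
    · intro h
      have h2 : ∀ i, HC α U k (pd i f) := fun i => ih.mpr (h.2 i)
      refine ⟨?_, h2⟩
      rw [← zero_add (1 : WithTop ℕ∞), contDiffOn_succ_iff_fderiv_of_isOpen hU]
      refine ⟨h.1, by simp, ?_⟩
      exact ((vh_fderiv_iff hU).mpr h.2).1.of_le (by exact_mod_cast zero_le)

end VectorHolder

section InteriorRegularity

variable {n : ℕ} {α : ℝ} {U : Set (Pt n)} {a : Fin n → Fin n → Pt n → ℝ}

theorem pd_pd_mul {χ w : Pt n → ℝ} {x : Pt n} (hχ : ContDiffAt ℝ 2 χ x)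
    (hw : ContDiffAt ℝ 2 w x) (i j : Fin n) :
    pd j (pd i fun y => χ y * w y) x = χ x * pd j (pd i w) x + pd i χ x * pd j w x
      + pd j χ x * pd i w x + pd j (pd i χ) x * w x := by
  have hev : pd i (fun y => χ y * w y) =ᶠ[𝓝 x] fun y => pd i χ y * w y + χ y * pd i w y := by
    filter_upwards [hχ.eventually (by simp), hw.eventually (by simp)] with y h1 h2
    exact pd_mul (h1.differentiableAt two_ne_zero) (h2.differentiableAt two_ne_zero) i
  have d1 := hχ.differentiableAt two_ne_zero
  have d2 := hw.differentiableAt two_ne_zero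
  have d3 := (contDiffAt_pd (m := 1) hχ (by norm_num) i).differentiableAt one_ne_zero
  have d4 := (contDiffAt_pd (m := 1) hw (by norm_num) i).differentiableAt one_ne_zero
  rw [hev.pd_eq, pd_add (d3.fun_mul d2) (d1.fun_mul d4), pd_mul d3 d2, pd_mul d1 d4]
  ring

theorem op_mul {χ w : Pt n → ℝ} {x : Pt n} (hχ : ContDiffAt ℝ 2 χ x) (hw : ContDiffAt ℝ 2 w x) :
    op a (fun y => χ y * w y) x = χ x * op a w x
      + ∑ i, ∑ j, (pd i χ x * (a i j x * pd j w x) + pd j χ x * (a i j x * pd i w x)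
        + pd j (pd i χ) x * (a i j x * w x)) := by
  unfold op
  simp only [pd_pd_mul hχ hw, Finset.mul_sum, ← Finset.sum_add_distrib]
  refine Finset.sum_congr rfl fun i _ => Finset.sum_congr rfl fun j _ => ?_
  ring

theorem Hol.lh {M : ℝ} {f : Pt n → ℝ} (hM : 0 ≤ M) (hα : 0 < α) (hf : Hol α M f) (x : Pt n) :
    LH α f x := by
  refine ⟨M + |f x|, Metric.ball x 1, Metric.ball_mem_nhds x one_pos, fun y hy => ?_,
    fun y _ z _ => (hf y z).trans ?_⟩
  · have h1 : ‖y - x‖ ^ α ≤ 1 :=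
      Real.rpow_le_one (norm_nonneg _) (mem_ball_iff_norm.mp hy).le hα.le
    have h2 := mul_le_mul_of_nonneg_left h1 hM
    have h3 : |f y| ≤ |f y - f x| + |f x| := by simpa using abs_add_le (f y - f x) (f x)
    linarith [hf y x]
  · gcongr
    linarith [abs_nonneg (f x)]

/-- Interior Schauder estimate in terms of a cutoff function. -/
theorem exists_cutoff_schauder [NeZero n] (hU : IsOpen U)
    (hac : ∀ i j, ContDiffOn ℝ 1 (a i j) U) {x₀ : Pt n} (hx₀ : x₀ ∈ U)
    (ha : (Matrix.of fun i j => a i j x₀).PosDef) (hα : α ∈ Ioo (0 : ℝ) 1) {ε : ℝ} (hε : 0 < ε) :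
    ∃ χ : Pt n → ℝ, ∃ C, ContDiff ℝ ∞ χ ∧ tsupport χ ⊆ Metric.ball x₀ ε ∧
      (∀ᶠ x in 𝓝 x₀, χ x = 1) ∧ 0 ≤ C ∧ ∀ (w : Pt n → ℝ) (M : ℝ),
      ContDiffOn ℝ 2 w (Metric.ball x₀ ε) →
      HB (Metric.ball x₀ ε) α M (op a w) → HB (Metric.ball x₀ ε) α M w →
      (∀ i, HB (Metric.ball x₀ ε) α M (pd i w)) →
      ∀ k l, Hol α (C * M) (pd k (pd l fun x => χ x * w x)) := by
  obtain ⟨r₀, C₀, hr₀, -, hC₀, hr₀U, hS⟩ := exists_local_schauder_on hU hac hx₀ ha hα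
  obtain ⟨A, r₁, hA0, hr₁, hA⟩ := LH.exists_uniform (f := fun p : Fin n × Fin n => a p.1 p.2)
    (x := x₀) fun p => ((hac p.1 p.2).contDiffAt (hU.mem_nhds hx₀)).lh hα
  set r := min ε (min r₀ r₁) with hr
  have hr0 : 0 < r := by positivity
  have hB1 : Metric.ball x₀ r ⊆ Metric.ball x₀ ε := Metric.ball_subset_ball (min_le_left _ _)
  have hB2 : Metric.ball x₀ r ⊆ Metric.ball x₀ r₀ :=
    Metric.ball_subset_ball ((min_le_right _ _).trans (min_le_left _ _))
  have hB3 : Metric.ball x₀ r ⊆ Metric.ball x₀ r₁ :=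
    Metric.ball_subset_ball ((min_le_right _ _).trans (min_le_right _ _))
  obtain ⟨χ, hχ, hχs, hχ1⟩ := exists_cutoff x₀ hr0
  have hχc := hasCompactSupport_of_tsupport_subset_ball hχs
  have hone : (1 : WithTop ℕ∞) ≤ ∞ := by exact_mod_cast le_top
  have hd1 : ∀ i, ContDiff ℝ ∞ (pd i χ) := fun i => contDiff_pd hχ le_rfl i
  have hd2 : ∀ i j, ContDiff ℝ ∞ (pd j (pd i χ)) := fun i j => contDiff_pd (hd1 i) le_rfl j
  obtain ⟨N₀, hN₀, hb0⟩ := exists_hb_of_contDiff_of_hasCompactSupport (hχ.of_le hone) hχc hα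
  choose N₁ hN₁ hb1 using fun i => exists_hb_of_contDiff_of_hasCompactSupport
    ((hd1 i).of_le hone) (hasCompactSupport_pd hχc i) hα
  choose N₂ hN₂ hb2 using fun i j => exists_hb_of_contDiff_of_hasCompactSupport
    ((hd2 i j).of_le hone) (hasCompactSupport_pd (hasCompactSupport_pd hχc i) j) hα
  have hz0 : ∀ x ∉ Metric.ball x₀ r, χ x = 0 := fun x hx => eq_zero_of_tsupport_subset hχs hx
  have hz1 : ∀ i, ∀ x ∉ Metric.ball x₀ r, pd i χ x = 0 := fun i x hx =>
    eq_zero_of_tsupport_subset ((tsupport_pd_subset _ i).trans hχs) hx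
  have hz2 : ∀ i j, ∀ x ∉ Metric.ball x₀ r, pd j (pd i χ) x = 0 := fun i j x hx =>
    eq_zero_of_tsupport_subset
      ((tsupport_pd_subset _ j).trans ((tsupport_pd_subset _ i).trans hχs)) hx
  refine ⟨χ, C₀ * (2 * N₀ + ∑ i, ∑ j, (4 * (N₁ i * A) + 4 * (N₁ j * A) + 4 * (N₂ i j * A))), hχ,
    hχs.trans hB1, hχ1, mul_nonneg hC₀ (add_nonneg (by positivity)
      (Finset.sum_nonneg fun i _ => Finset.sum_nonneg fun j _ => ?_)), ?_⟩
  · have := hN₁ i; have := hN₁ j; have := hN₂ i j; positivity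
  intro w M hw hF hw0 hw1 k l
  have hM : 0 ≤ M := (abs_nonneg _).trans (hw0.1 x₀ (Metric.mem_ball_self hε))
  have hv2 : ContDiff ℝ 2 fun x => χ x * w x :=
    contDiff_mul_of_tsupport_subset Metric.isOpen_ball (hχ.of_le two_le_infty) (hχs.trans hB1) hw
  have hvs : tsupport (fun x => χ x * w x) ⊆ Metric.ball x₀ r :=
    (tsupport_mul_subset_left (f := χ) (g := w)).trans hχs
  have hop : op a (fun x => χ x * w x) = fun x => χ x * op a w x
      + ∑ i, ∑ j, (pd i χ x * (a i j x * pd j w x) + pd j χ x * (a i j x * pd i w x)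
        + pd j (pd i χ) x * (a i j x * w x)) := by
    ext x
    by_cases hx : x ∈ Metric.ball x₀ r
    · exact op_mul (hχ.contDiffAt.of_le two_le_infty)
        (hw.contDiffAt (Metric.isOpen_ball.mem_nhds (hB1 hx)))
    · rw [op_eq_zero_of_notMem_tsupport fun h => hx (hvs h)]
      simp only [hz0 x hx, hz1 _ x hx, hz2 _ _ x hx, zero_mul, add_zero, Finset.sum_const_zero]
  have hA' : ∀ i j, HB (Metric.ball x₀ r) α A (a i j) := fun i j => (hA (i, j)).mono_set hB3
  have hw1' := fun i => (hw1 i).mono_set hB1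
  have hw0' := hw0.mono_set hB1
  have hAM : 0 ≤ 2 * (A * M) := by positivity
  have key : Hol α (2 * (N₀ * M) + ∑ i, ∑ j, (2 * (N₁ i * (2 * (A * M)))
      + 2 * (N₁ j * (2 * (A * M))) + 2 * (N₂ i j * (2 * (A * M)))))
      (op a fun x => χ x * w x) := by
    rw [hop]
    exact (HB.hol_mul hb0 hz0 hM (hF.mono_set hB1)).add (Hol.sum _ fun i _ => Hol.sum _ fun j _ =>
      (((HB.hol_mul (hb1 i) (hz1 i) hAM ((hA' i j).mul (hw1' j))).add
        (HB.hol_mul (hb1 j) (hz1 j) hAM ((hA' i j).mul (hw1' i)))).add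
        (HB.hol_mul (hb2 i j) (hz2 i j) hAM ((hA' i j).mul hw0'))))
  refine (hS _ _ ?_ hv2 (hvs.trans hB2) key k l).mono (le_of_eq ?_)
  · refine add_nonneg (by positivity)
      (Finset.sum_nonneg fun i _ => Finset.sum_nonneg fun j _ => ?_)
    have := hN₁ i; have := hN₁ j; have := hN₂ i j; positivity
  · rw [mul_assoc]
    congr 1
    rw [add_mul, Finset.sum_mul]
    congr 1
    · ring
    · refine Finset.sum_congr rfl fun i _ => ?_
      rw [Finset.sum_mul]
      exact Finset.sum_congr rfl fun j _ => by ring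

theorem eventuallyEq_cutoff_mul {χ w : Pt n → ℝ} {x₀ : Pt n} (hχ1 : ∀ᶠ x in 𝓝 x₀, χ x = 1) :
    (fun x => χ x * w x) =ᶠ[𝓝 x₀] w :=
  hχ1.mono fun x hx => by simp [hx]

/-- Interior regularity: `C²` solutions with Hölder continuous right-hand side are `C^{2+α}`. -/
theorem hc_two_of_op [NeZero n] (hU : IsOpen U) (hac : ∀ i j, ContDiffOn ℝ 1 (a i j) U)
    (ha : ∀ x ∈ U, (Matrix.of fun i j => a i j x).PosDef) (hα : α ∈ Ioo (0 : ℝ) 1)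
    {w : Pt n → ℝ} (hw : ContDiffOn ℝ 2 w U) (hF : HC α U 0 (op a w)) : HC α U 2 w := by
  have hw1 : ∀ i, ContDiffOn ℝ 1 (pd i w) U := fun i => contDiffOn_pd hU hw (by norm_num) i
  refine ⟨hw.of_le (by norm_num), fun i => ⟨hw1 i, fun j x₀ hx₀ => ?_⟩⟩
  have hU₀ := hU.mem_nhds hx₀
  obtain ⟨M₁, r₁, hM₁, hr₁, h1⟩ := (hF x₀ hx₀).exists_ball
  obtain ⟨M₂, r₂, hM₂, hr₂, h2⟩ := (((hw.of_le (by norm_num)).contDiffAt hU₀).lh hα).exists_ball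
  obtain ⟨M₃, r₃, hM₃, hr₃, h3⟩ := LH.exists_uniform fun i => ((hw1 i).contDiffAt hU₀).lh hα
  obtain ⟨r₄, hr₄, h4⟩ := Metric.isOpen_iff.mp hU x₀ hx₀
  obtain ⟨χ, C, -, -, hχ1, hC, h⟩ := exists_cutoff_schauder hU hac hx₀ (ha x₀ hx₀) hα
    (ε := min (min r₁ r₂) (min r₃ r₄)) (by positivity)
  have := h w (M₁ + M₂ + M₃)
    (hw.mono ((Metric.ball_subset_ball ((min_le_right _ _).trans (min_le_right _ _))).trans h4))
    ((h1.mono_set (Metric.ball_subset_ball ((min_le_left _ _).trans (min_le_left _ _)))).mono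
      (by linarith))
    ((h2.mono_set (Metric.ball_subset_ball ((min_le_left _ _).trans (min_le_right _ _)))).mono
      (by linarith))
    (fun i => ((h3 i).mono_set
      (Metric.ball_subset_ball ((min_le_right _ _).trans (min_le_left _ _)))).mono
      (by linarith)) j i
  exact (this.lh (by positivity) hα.1 x₀).congr
    (((eventuallyEq_cutoff_mul hχ1).pd i).pd j).symm

end InteriorRegularity

section LimitDerivative

variable {n : ℕ} {α : ℝ}

theorem abs_sub_sub_sum_pd_le {g : Pt n → ℝ} {N : ℝ} (hN : 0 ≤ N) (hα : 0 < α)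
    (hg : Differentiable ℝ g) (hH : ∀ k, Hol α N (pd k g)) (x v : Pt n) :
    |g (x + v) - g x - ∑ k, v k * pd k g x| ≤ n * N * ‖v‖ ^ α * ‖v‖ := by
  have h := (convex_closedBall x ‖v‖).norm_image_sub_le_of_norm_hasFDerivWithin_le'
    (𝕜 := ℝ) (f := g) (f' := fderiv ℝ g) (φ := fderiv ℝ g x) (C := n * (N * ‖v‖ ^ α)) (y := x + v)
    (fun y _ => (hg y).hasFDerivAt.hasFDerivWithinAt) (fun y hy => ?_)
    (Metric.mem_closedBall_self (norm_nonneg v)) (by simp)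
  · rw [add_sub_cancel_left, fderiv_apply_eq_sum, Real.norm_eq_abs] at h
    calc _ ≤ _ := h
      _ = _ := by ring
  · refine ContinuousLinearMap.opNorm_le_bound _ (by positivity) fun u => ?_
    rw [_root_.sub_apply, fderiv_apply_eq_sum, fderiv_apply_eq_sum,
      ← Finset.sum_sub_distrib, Real.norm_eq_abs]
    calc |∑ i, (u i * pd i g y - u i * pd i g x)| ≤ ∑ i : Fin n, ‖u‖ * (N * ‖v‖ ^ α) := by
          refine (Finset.abs_sum_le_sum_abs _ _).trans (Finset.sum_le_sum fun i _ => ?_)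
          rw [← mul_sub, abs_mul]
          refine mul_le_mul (norm_le_pi_norm u i) ((hH i y x).trans ?_) (abs_nonneg _)
            (norm_nonneg _)
          gcongr
          exact mem_closedBall_iff_norm.mp hy
      _ = _ := by simp; ring

theorem tendsto_rpow_zero (hα : 0 < α) : Tendsto (fun t : ℝ => t ^ α) (𝓝[>] 0) (𝓝 0) := by
  have := (Real.continuousAt_rpow_const 0 α (Or.inr hα.le)).tendsto
  rw [Real.zero_rpow hα.ne'] at this
  exact this.mono_left nhdsWithin_le_nhds

theorem cauchySeq_pd_of_tendsto {g : ℕ → Pt n → ℝ} {h : Pt n → ℝ} {N : ℝ} (hN : 0 ≤ N)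
    (hα : 0 < α) (hg : ∀ j, Differentiable ℝ (g j)) (hH : ∀ j k, Hol α N (pd k (g j)))
    (hlim : ∀ x, Tendsto (fun j => g j x) atTop (𝓝 (h x))) (k : Fin n) (x : Pt n) :
    CauchySeq fun j => pd k (g j) x := by
  have key : ∀ t, 0 < t → ∀ j, |g j (x + Pi.single k t) - g j x - t * pd k (g j) x|
      ≤ n * N * t ^ α * t := by
    intro t ht j
    have := abs_sub_sub_sum_pd_le hN hα (hg j) (hH j) x (Pi.single k t)
    simpa [Pi.norm_single, abs_of_pos ht, Pi.single_apply] using this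
  rw [Metric.cauchySeq_iff']
  intro ε hε
  have hc : Tendsto (fun t : ℝ => n * N * t ^ α) (𝓝[>] 0) (𝓝 0) := by
    simpa using (tendsto_rpow_zero hα).const_mul (n * N)
  obtain ⟨t, ht1, ht⟩ := ((hc.eventually (gt_mem_nhds (show (0 : ℝ) < ε / 4 by positivity))).and
    self_mem_nhdsWithin).exists
  have ht0 : (0 : ℝ) < t := ht
  have h1 : CauchySeq fun j => g j (x + Pi.single k t) - g j x :=
    ((hlim _).sub (hlim _)).cauchySeq
  obtain ⟨J, hJ⟩ := Metric.cauchySeq_iff'.mp h1 (ε / 4 * t) (by positivity)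
  refine ⟨J, fun j hj => ?_⟩
  have h2 := hJ j hj
  rw [Real.dist_eq] at h2 ⊢
  have h3 := key t ht0 j
  have h4 := key t ht0 J
  have h5 : n * N * t ^ α * t ≤ ε / 4 * t := by gcongr
  rw [abs_le] at h3 h4
  rw [abs_lt] at h2 ⊢
  constructor
  · by_contra hcon
    have := mul_le_mul_of_nonneg_left (not_lt.mp hcon) ht0.le
    nlinarith [mul_pos hε ht0]
  · by_contra hcon
    have := mul_le_mul_of_nonneg_left (not_lt.mp hcon) ht0.le
    nlinarith [mul_pos hε ht0]

/-- A pointwise limit of functions with uniformly Hölder partial derivatives is `C^{1+α}`. -/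
theorem contDiff_of_tendsto_of_hol {g : ℕ → Pt n → ℝ} {h : Pt n → ℝ} {N : ℝ} (hN : 0 ≤ N)
    (hα : 0 < α) (hg : ∀ j, Differentiable ℝ (g j)) (hH : ∀ j k, Hol α N (pd k (g j)))
    (hlim : ∀ x, Tendsto (fun j => g j x) atTop (𝓝 (h x))) :
    ContDiff ℝ 1 h ∧ ∀ k, Hol α N (pd k h) := by
  choose D hD using fun k x => cauchySeq_tendsto_of_complete
    (cauchySeq_pd_of_tendsto hN hα hg hH hlim k x)
  have hDH : ∀ k, Hol α N (D k) := fun k x y =>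
    le_of_tendsto ((hD k x).sub (hD k y)).abs (Eventually.of_forall fun j => hH j k x y)
  have hT : ∀ x v, |h (x + v) - h x - ∑ k, v k * D k x| ≤ n * N * ‖v‖ ^ α * ‖v‖ := fun x v =>
    le_of_tendsto (((hlim _).sub (hlim _)).sub
      (tendsto_finsetSum _ fun k _ => (hD k x).const_mul (v k))).abs
      (Eventually.of_forall fun j => abs_sub_sub_sum_pd_le hN hα (hg j) (hH j) x v)
  have hder : ∀ x, HasFDerivAt h
      (∑ k, D k x • (ContinuousLinearMap.proj k : Pt n →L[ℝ] ℝ)) x := by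
    intro x
    rw [hasFDerivAt_iff_isLittleO_nhds_zero]
    have hlit : (fun v : Pt n => n * N * ‖v‖ ^ α * ‖v‖) =o[𝓝 0] fun v => v := by
      have h1 : Tendsto (fun v : Pt n => n * N * ‖v‖ ^ α) (𝓝 0) (𝓝 0) := by
        have : Continuous fun v : Pt n => n * N * ‖v‖ ^ α :=
          continuous_const.mul (continuous_norm.rpow_const fun _ => Or.inr hα.le)
        simpa [Real.zero_rpow hα.ne'] using this.tendsto 0
      have h2 := ((Asymptotics.isLittleO_one_iff ℝ).mpr h1).mul_isBigO
        (Asymptotics.isBigO_refl (fun v : Pt n => ‖v‖) (𝓝 0))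
      rw [← Asymptotics.isLittleO_norm_right]
      simpa using h2
    refine (Asymptotics.IsBigO.of_bound 1 (Eventually.of_forall fun v => ?_)).trans_isLittleO hlit
    rw [one_mul, Real.norm_eq_abs, Real.norm_of_nonneg (by positivity)]
    convert hT x v using 3
    rw [_root_.sum_apply]
    exact Finset.sum_congr rfl fun k _ => by simp [mul_comm]
  have hpd : ∀ k, pd k h = D k := by
    intro k
    ext x
    rw [(hder x).pd_eq, _root_.sum_apply]
    simp [Pi.single_apply]
  refine ⟨?_, fun k => by rw [hpd]; exact hDH k⟩
  rw [contDiff_one_iff_hasFDerivAt]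
  refine ⟨_, ?_, hder⟩
  refine continuous_finsetSum _ fun k _ => Continuous.fun_smul ?_ continuous_const
  exact continuous_iff_continuousAt.mpr fun x => ((hDH k).lh hN hα x).continuousAt hα

end LimitDerivative

section DifferenceQuotient

variable {n : ℕ} {α : ℝ}

/-- The difference quotient of `f` in direction `l` with step `s`. -/
def dq (l : Fin n) (s : ℝ) (f : Pt n → ℝ) (x : Pt n) : ℝ := s⁻¹ * (f (x + Pi.single l s) - f x)

theorem hasDerivAt_add_single {f : Pt n → ℝ} {x : Pt n} {l : Fin n} {t : ℝ}
    (hf : DifferentiableAt ℝ f (x + Pi.single l t)) :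
    HasDerivAt (fun s => f (x + Pi.single l s)) (pd l f (x + Pi.single l t)) t := by
  have h1 : HasDerivAt (fun s : ℝ => x + (Pi.single l s : Pt n)) (Pi.single l 1) t := by
    have h2 : (fun s : ℝ => x + (Pi.single l s : Pt n)) = fun s => x + s • Pi.single l (1 : ℝ) := by
      ext s : 1
      rw [← Pi.single_smul, smul_eq_mul, mul_one]
    rw [h2]
    simpa using ((hasDerivAt_id t).smul_const (Pi.single l (1 : ℝ) : Pt n)).const_add x
  exact hf.hasFDerivAt.comp_hasDerivAt t h1

theorem tendsto_dq {f : Pt n → ℝ} {x : Pt n} (l : Fin n) (hf : DifferentiableAt ℝ f x) :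
    Tendsto (fun s => dq l s f x) (𝓝[≠] 0) (𝓝 (pd l f x)) := by
  have h := hasDerivAt_add_single (f := f) (x := x) (l := l) (t := 0) (by simpa using hf)
  rw [hasDerivAt_iff_tendsto_slope_zero] at h
  simpa [dq] using h

theorem abs_dq_le {φ : ℝ → ℝ} {φ' : ℝ → ℝ} {s B : ℝ} (hs : 0 < s)
    (h : ∀ t ∈ Icc 0 s, HasDerivAt φ (φ' t) t) (hB : ∀ t ∈ Icc 0 s, |φ' t| ≤ B) :
    |s⁻¹ * (φ s - φ 0)| ≤ B := by
  have := (convex_Icc 0 s).norm_image_sub_le_of_norm_hasDerivWithin_le (f := φ) (f' := φ')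
    (fun t ht => (h t ht).hasDerivWithinAt) hB (left_mem_Icc.mpr hs.le) (right_mem_Icc.mpr hs.le)
  rw [sub_zero, Real.norm_eq_abs, Real.norm_of_nonneg hs.le] at this
  rw [abs_mul, abs_inv, abs_of_pos hs, inv_mul_le_iff₀ hs]
  linarith

theorem add_single_mem_ball {x₀ x : Pt n} {ρ s t : ℝ} {l : Fin n} (hs : s < ρ)
    (ht : t ∈ Icc 0 s) (hx : x ∈ Metric.ball x₀ ρ) :
    x + Pi.single l t ∈ Metric.ball x₀ (2 * ρ) := by
  rw [mem_ball_iff_norm] at hx ⊢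
  have : ‖(Pi.single l t : Pt n)‖ = t := by
    rw [Pi.norm_single, Real.norm_of_nonneg ht.1]
  have h2 := norm_add_le (x - x₀) (Pi.single l t)
  rw [show x + Pi.single l t - x₀ = x - x₀ + Pi.single l t by abel]
  linarith [ht.2]

theorem HB.dq {f : Pt n → ℝ} {x₀ : Pt n} {ρ s M : ℝ} {l : Fin n} (hs : 0 < s) (hsρ : s < ρ)
    (hf : ∀ x ∈ Metric.ball x₀ (2 * ρ), DifferentiableAt ℝ f x)
    (h : HB (Metric.ball x₀ (2 * ρ)) α M (pd l f)) :
    HB (Metric.ball x₀ ρ) α M (dq l s f) := by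
  refine ⟨fun x hx => ?_, fun x hx y hy => ?_⟩
  · have := abs_dq_le (φ := fun t => f (x + Pi.single l t)) (B := M) hs
      (fun t ht => hasDerivAt_add_single (hf _ (add_single_mem_ball hsρ ht hx)))
      (fun t ht => h.1 _ (add_single_mem_ball hsρ ht hx))
    simpa [EllipticReg.dq] using this
  · have := abs_dq_le (φ := fun t => f (x + Pi.single l t) - f (y + Pi.single l t))
      (B := M * ‖x - y‖ ^ α) hs
      (fun t ht => (hasDerivAt_add_single (hf _ (add_single_mem_ball hsρ ht hx))).sub
        (hasDerivAt_add_single (hf _ (add_single_mem_ball hsρ ht hy))))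
      (fun t ht => by
        simpa using h.2 _ (add_single_mem_ball (l := l) hsρ ht hx) _
          (add_single_mem_ball (l := l) hsρ ht hy))
    convert this using 2
    simp [EllipticReg.dq]
    ring

theorem pd_dq {f : Pt n → ℝ} {x : Pt n} {l : Fin n} {s : ℝ} (i : Fin n)
    (h1 : DifferentiableAt ℝ f x) (h2 : DifferentiableAt ℝ f (x + Pi.single l s)) :
    pd i (dq l s f) x = dq l s (pd i f) x := by
  have h3 : HasFDerivAt (fun y => f (y + Pi.single l s)) (fderiv ℝ f (x + Pi.single l s)) x := by
    have h4 := h2.hasFDerivAt.comp x ((hasFDerivAt_id x).add_const (Pi.single l s))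
    rwa [ContinuousLinearMap.comp_id] at h4
  exact ((h3.fun_sub h1.hasFDerivAt).const_mul s⁻¹).pd_eq i

end DifferenceQuotient

section HigherRegularity

variable {n : ℕ} {α : ℝ} {U : Set (Pt n)} {a : Fin n → Fin n → Pt n → ℝ}

theorem HB.translate {f : Pt n → ℝ} {x₀ : Pt n} {ρ s M : ℝ} {l : Fin n} (hs : 0 < s)
    (hsρ : s < ρ) (h : HB (Metric.ball x₀ (2 * ρ)) α M f) :
    HB (Metric.ball x₀ ρ) α M fun x => f (x + Pi.single l s) := by
  have hm : ∀ x ∈ Metric.ball x₀ ρ, x + Pi.single l s ∈ Metric.ball x₀ (2 * ρ) := fun x hx =>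
    add_single_mem_ball hsρ (right_mem_Icc.mpr hs.le) hx
  exact ⟨fun x hx => h.1 _ (hm x hx), fun x hx y hy => by simpa using h.2 _ (hm x hx) _ (hm y hy)⟩

theorem contDiffOn_dq {f : Pt n → ℝ} {k : WithTop ℕ∞} {x₀ : Pt n} {ρ s : ℝ} {l : Fin n}
    (hs : 0 < s) (hsρ : s < ρ) (hf : ContDiffOn ℝ k f (Metric.ball x₀ (2 * ρ))) :
    ContDiffOn ℝ k (dq l s f) (Metric.ball x₀ ρ) := by
  have hm : ∀ x ∈ Metric.ball x₀ ρ, x + Pi.single l s ∈ Metric.ball x₀ (2 * ρ) := fun x hx =>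
    add_single_mem_ball hsρ (right_mem_Icc.mpr hs.le) hx
  have hρ : 0 < ρ := hs.trans hsρ
  exact contDiffOn_const.mul ((hf.comp (contDiff_id.add contDiff_const).contDiffOn hm).sub
    (hf.mono (Metric.ball_subset_ball (by linarith))))

theorem op_dq {w : Pt n → ℝ} {x : Pt n} {l : Fin n} {s : ℝ}
    (h : ∀ i j, pd j (pd i (dq l s w)) x = dq l s (pd j (pd i w)) x) :
    op a (dq l s w) x = dq l s (op a w) x
      + ∑ i, ∑ j, (-1) * (dq l s (a i j) x * pd j (pd i w) (x + Pi.single l s)) := by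
  simp only [op, h, dq]
  simp only [← Finset.sum_sub_distrib, Finset.mul_sum, ← Finset.sum_add_distrib]
  refine Finset.sum_congr rfl fun i _ => Finset.sum_congr rfl fun j _ => ?_
  ring

theorem tendsto_div_add_two (ρ : ℝ) (hρ : 0 < ρ) :
    Tendsto (fun j : ℕ => ρ / ((j : ℝ) + 2)) atTop (𝓝[≠] 0) := by
  refine tendsto_nhdsWithin_iff.mpr ⟨?_, Eventually.of_forall fun j => ?_⟩
  · exact tendsto_const_nhds.div_atTop
      (tendsto_atTop_add_const_right _ _ tendsto_natCast_atTop_atTop)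
  · exact (by positivity : ρ / ((j : ℝ) + 2) ≠ 0)

/-- Solutions with `C^{1+α}` right-hand side and coefficients are `C^{3+α}`. -/
theorem hc_three_of_op [NeZero n] (hU : IsOpen U) (hac : ∀ i j, HC α U 1 (a i j))
    (ha : ∀ x ∈ U, (Matrix.of fun i j => a i j x).PosDef) (hα : α ∈ Ioo (0 : ℝ) 1)
    {w : Pt n → ℝ} (hw : HC α U 2 w) (hF : HC α U 1 (op a w)) : HC α U 3 w := by
  have hw2 : ContDiffOn ℝ 2 w U := hw.contDiffOn hα.1 hU
  suffices H : ∀ m l, ∀ x₀ ∈ U, ContDiffAt ℝ 1 (pd l (pd m w)) x₀ ∧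
      ∀ k, LH α (pd k (pd l (pd m w))) x₀ from
    ⟨hw.1, fun m => ⟨(hw.2 m).1, fun l => ⟨fun x hx => (H m l x hx).1.contDiffWithinAt,
      fun k x hx => (H m l x hx).2 k⟩⟩⟩
  intro m l x₀ hx₀
  obtain ⟨r₀, hr₀, h0⟩ := Metric.isOpen_iff.mp hU x₀ hx₀
  obtain ⟨M₁, r₁, hM₁, hr₁, h1⟩ := (hF.2 l x₀ hx₀).exists_ball
  obtain ⟨M₂, r₂, hM₂, hr₂, h2⟩ := LH.exists_uniform
    (f := fun p : Fin n × Fin n => pd l (a p.1 p.2)) fun p => (hac p.1 p.2).2 l x₀ hx₀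
  obtain ⟨M₃, r₃, hM₃, hr₃, h3⟩ := LH.exists_uniform
    (f := fun p : Fin n × Fin n => pd p.2 (pd p.1 w)) fun p => (hw.2 p.1).2 p.2 x₀ hx₀
  obtain ⟨M₄, r₄, hM₄, hr₄, h4⟩ := (((hw.2 l).1.contDiffAt (hU.mem_nhds hx₀)).lh hα).exists_ball
  set ρ := min r₀ (min (min r₁ r₂) (min r₃ r₄)) / 2 with hρ
  have hρ0 : 0 < ρ := by positivity
  have hρ2 : 2 * ρ = min r₀ (min (min r₁ r₂) (min r₃ r₄)) := by rw [hρ]; ring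
  set M := M₁ + M₂ + M₃ + M₄ with hM
  have hM0 : 0 ≤ M := by positivity
  have hB0 : Metric.ball x₀ (2 * ρ) ⊆ U :=
    (Metric.ball_subset_ball (by rw [hρ2]; exact min_le_left _ _)).trans h0
  have hBF : HB (Metric.ball x₀ (2 * ρ)) α M (pd l (op a w)) :=
    (h1.mono_set (Metric.ball_subset_ball (by rw [hρ2]; simp))).mono (by linarith)
  have hBa : ∀ i j, HB (Metric.ball x₀ (2 * ρ)) α M (pd l (a i j)) := fun i j =>
    ((h2 (i, j)).mono_set (Metric.ball_subset_ball (by rw [hρ2]; simp))).mono (by linarith)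
  have hBw2 : ∀ i j, HB (Metric.ball x₀ (2 * ρ)) α M (pd j (pd i w)) := fun i j =>
    ((h3 (i, j)).mono_set (Metric.ball_subset_ball (by rw [hρ2]; simp))).mono (by linarith)
  have hBw1 : HB (Metric.ball x₀ (2 * ρ)) α M (pd l w) :=
    (h4.mono_set (Metric.ball_subset_ball (by rw [hρ2]; simp))).mono (by linarith)
  have hsub : Metric.ball x₀ ρ ⊆ Metric.ball x₀ (2 * ρ) := Metric.ball_subset_ball (by linarith)
  obtain ⟨χ, C, hχ, hχs, hχ1, hC, hS⟩ := exists_cutoff_schauder hU (fun i j => (hac i j).1) hx₀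
    (ha x₀ hx₀) hα hρ0
  set M' := M + ∑ _i : Fin n, ∑ _j : Fin n, |(-1 : ℝ)| * (2 * (M * M)) with hM'
  have hMM' : M ≤ M' := by
    rw [hM']
    have : 0 ≤ ∑ _i : Fin n, ∑ _j : Fin n, |(-1 : ℝ)| * (2 * (M * M)) :=
      Finset.sum_nonneg fun i _ => Finset.sum_nonneg fun j _ => by positivity
    linarith
  have dw : ∀ x ∈ Metric.ball x₀ (2 * ρ), DifferentiableAt ℝ w x := fun x hx =>
    hw.differentiableAt hU (hB0 hx)
  have dw1 : ∀ i, ∀ x ∈ Metric.ball x₀ (2 * ρ), DifferentiableAt ℝ (pd i w) x := fun i x hx =>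
    (hw.2 i).differentiableAt hU (hB0 hx)
  have hpd1 : ∀ s, 0 < s → s < ρ → ∀ i, ∀ x ∈ Metric.ball x₀ ρ,
      pd i (dq l s w) x = dq l s (pd i w) x := fun s hs hsρ i x hx =>
    pd_dq i (dw x (hsub hx)) (dw _ (add_single_mem_ball hsρ (right_mem_Icc.mpr hs.le) hx))
  have hpd2 : ∀ s, 0 < s → s < ρ → ∀ i j, ∀ x ∈ Metric.ball x₀ ρ,
      pd j (pd i (dq l s w)) x = dq l s (pd j (pd i w)) x := by
    intro s hs hsρ i j x hx
    rw [pd_eqOn Metric.isOpen_ball (hpd1 s hs hsρ i) j x hx]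
    exact pd_dq j (dw1 i x (hsub hx))
      (dw1 i _ (add_single_mem_ball hsρ (right_mem_Icc.mpr hs.le) hx))
  have hcd : ∀ s, 0 < s → s < ρ → ContDiffOn ℝ 2 (dq l s w) (Metric.ball x₀ ρ) :=
    fun s hs hsρ => contDiffOn_dq hs hsρ (hw2.mono hB0)
  have key : ∀ s, 0 < s → s < ρ → ∀ k,
      Hol α (C * M') (pd k (pd m fun x => χ x * dq l s w x)) := by
    intro s hs hsρ k
    refine hS _ M' (hcd s hs hsρ) ?_ ((hBw1.dq hs hsρ dw).mono hMM')
      (fun i => (((hBw2 i l).dq hs hsρ (dw1 i)).congr (hpd1 s hs hsρ i)).mono hMM') k m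
    refine HB.congr ?_ fun x hx => op_dq fun i j => hpd2 s hs hsρ i j x hx
    exact (hBF.dq hs hsρ fun x hx => hF.differentiableAt hU (hB0 hx)).add
      (HB.sum _ fun i _ => HB.sum _ fun j _ => HB.const_mul (-1)
        (((hBa i j).dq hs hsρ fun x hx => (hac i j).differentiableAt hU (hB0 hx)).mul
          ((hBw2 i j).translate hs hsρ)))
  have hsj : ∀ j : ℕ, 0 < ρ / ((j : ℝ) + 2) ∧ ρ / ((j : ℝ) + 2) < ρ := fun j => by
    refine ⟨by positivity, div_lt_self hρ0 ?_⟩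
    have : (0 : ℝ) ≤ j := Nat.cast_nonneg j
    linarith
  have hlim : ∀ x, Tendsto (fun j : ℕ => pd m (fun x => χ x * dq l (ρ / ((j : ℝ) + 2)) w x) x)
      atTop (𝓝 (pd m χ x * pd l w x + χ x * pd l (pd m w) x)) := by
    intro x
    by_cases hx : x ∈ Metric.ball x₀ ρ
    · have e : ∀ j : ℕ, pd m (fun x => χ x * dq l (ρ / ((j : ℝ) + 2)) w x) x
          = pd m χ x * dq l (ρ / ((j : ℝ) + 2)) w x
            + χ x * dq l (ρ / ((j : ℝ) + 2)) (pd m w) x := fun j => by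
        rw [pd_mul (hχ.differentiable (by simp) x) (((hcd _ (hsj j).1 (hsj j).2).contDiffAt
          (Metric.isOpen_ball.mem_nhds hx)).differentiableAt two_ne_zero),
          hpd1 _ (hsj j).1 (hsj j).2 m x hx]
      simp only [e]
      exact (((tendsto_dq l (dw x (hsub hx))).comp (tendsto_div_add_two ρ hρ0)).const_mul _).add
        (((tendsto_dq l (dw1 m x (hsub hx))).comp (tendsto_div_add_two ρ hρ0)).const_mul _)
    · have e : ∀ j : ℕ, pd m (fun x => χ x * dq l (ρ / ((j : ℝ) + 2)) w x) x = 0 := fun j =>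
        eq_zero_of_tsupport_subset ((tsupport_pd_subset _ m).trans
          ((tsupport_mul_subset_left (f := χ) (g := dq l (ρ / ((j : ℝ) + 2)) w)).trans hχs)) hx
      simp only [e, eq_zero_of_tsupport_subset hχs hx,
        eq_zero_of_tsupport_subset ((tsupport_pd_subset _ m).trans hχs) hx, zero_mul, add_zero]
      exact tendsto_const_nhds
  have hCM : 0 ≤ C * M' := mul_nonneg hC (hM0.trans hMM')
  obtain ⟨hc, hHol⟩ := contDiff_of_tendsto_of_hol hCM hα.1
    (fun j => (contDiff_pd (m := 1) (contDiff_mul_of_tsupport_subset Metric.isOpen_ball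
      (hχ.of_le two_le_infty) hχs (hcd _ (hsj j).1 (hsj j).2)) (by norm_num) m).differentiable
      one_ne_zero)
    (fun j k => key _ (hsj j).1 (hsj j).2 k) hlim
  have hev : pd l (pd m w) =ᶠ[𝓝 x₀]
      fun x => pd m χ x * pd l w x + χ x * pd l (pd m w) x := by
    have hev0 : χ =ᶠ[𝓝 x₀] fun _ => (1 : ℝ) := hχ1
    filter_upwards [hev0, hev0.pd m] with x h1 h2
    rw [h1, h2]
    simp [pd]
  exact ⟨hc.contDiffAt.congr_of_eventuallyEq hev, fun k =>
    ((hHol k).lh hCM hα.1 x₀).congr (hev.pd k)⟩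

theorem op_pd (hU : IsOpen U) {w : Pt n → ℝ} (hac : ∀ i j, ContDiffOn ℝ 1 (a i j) U)
    (hw : ContDiffOn ℝ 3 w U) (l : Fin n) {x : Pt n} (hx : x ∈ U) :
    op a (pd l w) x = pd l (op a w) x + ∑ i, ∑ j, (-1) * (pd l (a i j) x * pd j (pd i w) x) := by
  have hU' := hU.mem_nhds hx
  have h3 : ContDiffAt ℝ 3 w x := hw.contDiffAt hU'
  have h2 : ∀ i, ContDiffAt ℝ 2 (pd i w) x := fun i => contDiffAt_pd h3 (by norm_num) i
  have h1 : ∀ i j, ContDiffAt ℝ 1 (pd j (pd i w)) x := fun i j =>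
    contDiffAt_pd (h2 i) (by norm_num) j
  have da : ∀ i j, DifferentiableAt ℝ (a i j) x := fun i j =>
    ((hac i j).contDiffAt hU').differentiableAt one_ne_zero
  have dw : ∀ i j, DifferentiableAt ℝ (pd j (pd i w)) x := fun i j =>
    (h1 i j).differentiableAt one_ne_zero
  have e1 : ∀ i j, pd j (pd i (pd l w)) x = pd l (pd j (pd i w)) x := by
    intro i j
    have : pd i (pd l w) =ᶠ[𝓝 x] pd l (pd i w) := by
      filter_upwards [h3.eventually (by simp)] with y hy
      exact pd_comm (hy.of_le (by norm_num)) i l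
    rw [this.pd_eq, pd_comm (h2 i)]
  have e2 : pd l (op a w) x
      = ∑ i, ∑ j, (pd l (a i j) x * pd j (pd i w) x + a i j x * pd l (pd j (pd i w)) x) := by
    unfold op
    rw [pd_sum _ fun i _ => DifferentiableAt.fun_sum fun j _ => (da i j).fun_mul (dw i j)]
    refine Finset.sum_congr rfl fun i _ => ?_
    rw [pd_sum _ fun j _ => (da i j).fun_mul (dw i j)]
    exact Finset.sum_congr rfl fun j _ => pd_mul (da i j) (dw i j) l
  rw [e2]
  simp only [op, e1, ← Finset.sum_add_distrib]
  refine Finset.sum_congr rfl fun i _ => Finset.sum_congr rfl fun j _ => ?_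
  ring

/-- Elliptic regularity for the operator `a ∂∂`. -/
theorem hc_add_two_of_op [NeZero n] (hU : IsOpen U)
    (ha : ∀ x ∈ U, (Matrix.of fun i j => a i j x).PosDef) (hα : α ∈ Ioo (0 : ℝ) 1) {k : ℕ}
    (hac : ∀ i j, HC α U (k + 1) (a i j)) {w : Pt n → ℝ} (hw : ContDiffOn ℝ 2 w U)
    (hF : HC α U k (op a w)) : HC α U (k + 2) w := by
  induction k generalizing w with
  | zero => exact hc_two_of_op hU (fun i j => (hac i j).1) ha hα hw hF
  | succ k ih =>
    have hac' : ∀ i j, HC α U (k + 1) (a i j) := fun i j => (hac i j).lower hα hU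
    have h2 : HC α U (k + 2) w := ih hac' hw (hF.lower hα hU)
    have h3 : HC α U 3 w := hc_three_of_op hU (fun i j => (hac i j).mono hα hU (by omega)) ha hα
      (h2.mono hα hU (by omega)) (hF.mono hα hU (by omega))
    have hw3 : ContDiffOn ℝ 3 w U := h3.contDiffOn hα.1 hU
    refine ⟨hw.of_le (by norm_num), fun l => ih hac' (contDiffOn_pd hU hw3 (by norm_num) l) ?_⟩
    refine HC.congr hU ?_ fun x hx => op_pd hU (fun i j => (hac i j).1) hw3 l hx
    exact (hF.2 l).add hU (HC.sum hα hU _ fun i _ => HC.sum hα hU _ fun j _ =>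
      (HC.const hα hU k (-1)).mul hα hU
        ((((hac i j).2 l).lower hα hU).mul hα hU ((h2.2 i).2 j)))

/-- Elliptic regularity for homogeneous linear second order equations. -/
theorem hc_add_two_of_eq_zero [NeZero n] (hU : IsOpen U)
    (ha : ∀ x ∈ U, (Matrix.of fun i j => a i j x).PosDef) (hα : α ∈ Ioo (0 : ℝ) 1) {k : ℕ}
    (hac : ∀ i j, HC α U (k + 1) (a i j)) {b : Fin n → Pt n → ℝ} (hb : ∀ i, HC α U k (b i))
    {c : Pt n → ℝ} (hc : HC α U k c) {w : Pt n → ℝ} (hw : ContDiffOn ℝ 2 w U)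
    (h : ∀ x ∈ U, op a w x + ∑ i, b i x * pd i w x + c x * w x = 0) : HC α U (k + 2) w := by
  have key : ∀ m ≤ k, HC α U m w → (∀ i, HC α U m (pd i w)) → HC α U (m + 2) w := by
    intro m hm h0 h1
    refine hc_add_two_of_op hU ha hα (fun i j => (hac i j).mono hα hU (by omega)) hw ?_
    refine HC.congr (f := fun x => (-1) * (∑ i, b i x * pd i w x + c x * w x)) hU ?_
      fun x hx => by linarith [h x hx]
    exact (HC.const hα hU m (-1)).mul hα hU ((HC.sum hα hU _ fun i _ =>
      ((hb i).mono hα hU hm).mul hα hU (h1 i)).add hU ((hc.mono hα hU hm).mul hα hU h0))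
  have main : ∀ m ≤ k, HC α U (m + 2) w := by
    intro m
    induction m with
    | zero =>
      intro hm
      exact key 0 hm (HC.of_contDiffOn hα hU (hw.of_le (by norm_num)))
        fun i => HC.of_contDiffOn hα hU (by simpa using contDiffOn_pd hU hw (by norm_num) i)
    | succ m ih =>
      intro hm
      have h2 := ih (by omega)
      exact key (m + 1) hm (h2.lower hα hU) h2.2
  exact main k le_rfl

end HigherRegularity

section Coefficients

variable {n : ℕ} {U : Set (Pt n)}

/-- A scale of regularity classes on `U` closed under the operations that build the coefficients of
the conformal Laplacian from the metric. -/
structure IsRegScale (U : Set (Pt n)) (P : ℕ → (Pt n → ℝ) → Prop) : Prop where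
  congr : ∀ {k f h}, P k f → (∀ x ∈ U, h x = f x) → P k h
  const : ∀ k c, P k fun _ => c
  add : ∀ {k f h}, P k f → P k h → P k fun x => f x + h x
  mul : ∀ {k f h}, P k f → P k h → P k fun x => f x * h x
  comp : ∀ {k f} {V : Set ℝ} {φ : ℝ → ℝ}, IsOpen V → AnalyticOnNhd ℝ φ V → MapsTo f U V → P k f →
    P k fun x => φ (f x)
  lower : ∀ {k f}, P (k + 1) f → P k f
  pd : ∀ {k f} i, P (k + 1) f → P k (pd i f)
  differentiableAt : ∀ {k f} {x}, P (k + 1) f → x ∈ U → DifferentiableAt ℝ f x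

theorem isRegScale_hc (hU : IsOpen U) {α : ℝ} (hα : α ∈ Ioo (0 : ℝ) 1) : IsRegScale U (HC α U) where
  congr hf he := hf.congr hU he
  const k c := HC.const hα hU k c
  add hf hh := hf.add hU hh
  mul hf hh := hf.mul hα hU hh
  comp hV hφ hfV hf := hf.comp hα hU hV hφ hfV
  lower hf := hf.lower hα hU
  pd i hf := hf.2 i
  differentiableAt hf hx := hf.differentiableAt hU hx

theorem analyticOnNhd_pd {f : Pt n → ℝ} (hf : AnalyticOnNhd ℝ f U) (i : Fin n) :
    AnalyticOnNhd ℝ (pd i f) U := fun x hx =>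
  ((ContinuousLinearMap.apply ℝ ℝ (Pi.single i 1 : Pt n)).analyticAt _).comp (hf.fderiv x hx)

theorem isRegScale_analyticOnNhd (hU : IsOpen U) :
    IsRegScale U fun _ f => AnalyticOnNhd ℝ f U where
  congr hf he := hf.congr hU fun x hx => (he x hx).symm
  const _ _ := analyticOnNhd_const
  add hf hh := hf.add hh
  mul hf hh := hf.mul hh
  comp _ hφ hfV hf := fun x hx => (hφ _ (hfV hx)).comp (hf x hx)
  lower hf := hf
  pd i hf := analyticOnNhd_pd hf i
  differentiableAt hf hx := (hf _ hx).differentiableAt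

namespace IsRegScale

variable {P : ℕ → (Pt n → ℝ) → Prop} {k : ℕ}

theorem sum (hP : IsRegScale U P) {ι : Type*} (s : Finset ι) {f : ι → Pt n → ℝ}
    (hf : ∀ i ∈ s, P k (f i)) : P k fun x => ∑ i ∈ s, f i x := by
  classical
  induction s using Finset.induction_on with
  | empty => simpa using hP.const k 0
  | insert a s ha ih =>
    simp_rw [Finset.sum_insert ha]
    exact hP.add (hf a (by simp)) (ih fun i hi => hf i (by simp [hi]))

theorem prod (hP : IsRegScale U P) {ι : Type*} (s : Finset ι) {f : ι → Pt n → ℝ}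
    (hf : ∀ i ∈ s, P k (f i)) : P k fun x => ∏ i ∈ s, f i x := by
  classical
  induction s using Finset.induction_on with
  | empty => simpa using hP.const k 1
  | insert a s ha ih =>
    simp_rw [Finset.prod_insert ha]
    exact hP.mul (hf a (by simp)) (ih fun i hi => hf i (by simp [hi]))

theorem neg (hP : IsRegScale U P) {f : Pt n → ℝ} (hf : P k f) : P k fun x => -f x := by
  simpa using hP.mul (hP.const k (-1)) hf

theorem sub (hP : IsRegScale U P) {f h : Pt n → ℝ} (hf : P k f) (hh : P k h) :
    P k fun x => f x - h x := by
  simpa [sub_eq_add_neg] using hP.add hf (hP.neg hh)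

theorem det (hP : IsRegScale U P) {m : Type*} [Fintype m] [DecidableEq m]
    {A : Pt n → Matrix m m ℝ} (hA : ∀ i j, P k fun x => A x i j) : P k fun x => (A x).det := by
  simp_rw [Matrix.det_apply']
  exact hP.sum _ fun σ _ => hP.mul (hP.const _ _) (hP.prod _ fun i _ => hA _ _)

theorem inv (hP : IsRegScale U P) {f : Pt n → ℝ} (hf : P k f) (h0 : ∀ x ∈ U, 0 < f x) :
    P k fun x => (f x)⁻¹ :=
  hP.comp isOpen_Ioi (φ := fun t => t⁻¹)
    (fun _ ht => analyticAt_inv (ne_of_gt (mem_Ioi.mp ht))) h0 hf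

theorem sqrt (hP : IsRegScale U P) {f : Pt n → ℝ} (hf : P k f) (h0 : ∀ x ∈ U, 0 < f x) :
    P k fun x => Real.sqrt (f x) :=
  hP.comp isOpen_Ioi (φ := Real.sqrt)
    (fun _ ht => (Real.contDiffAt_sqrt (ne_of_gt (mem_Ioi.mp ht)) (n := ω)).analyticAt) h0 hf

theorem matrix_inv (hP : IsRegScale U P) {m : Type*} [Fintype m] [DecidableEq m]
    {A : Pt n → Matrix m m ℝ} (hA : ∀ i j, P k fun x => A x i j) (h0 : ∀ x ∈ U, 0 < (A x).det)
    (i j : m) : P k fun x => (A x)⁻¹ i j := by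
  simp_rw [Matrix.inv_def, Matrix.smul_apply, Matrix.adjugate_apply, Ring.inverse_eq_inv', smul_eq_mul]
  refine hP.mul (hP.inv (hP.det hA) h0) (hP.det fun a b => ?_)
  by_cases h : a = j
  · subst h
    simpa using hP.const k _
  · simpa [Matrix.updateRow_ne h] using hA a b

variable {g : Met n}

theorem metric_inv (hP : IsRegScale U P) (hg : IsMetricOn g U) (h : ∀ a b, P k fun x => g x a b)
    (a b : Fin n) : P k fun x => (g x)⁻¹ a b :=
  hP.matrix_inv h (fun x hx => (hg x hx).2.det_pos) a b

theorem christoffel (hP : IsRegScale U P) (hg : IsMetricOn g U)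
    (h : ∀ a b, P (k + 1) fun x => g x a b) (c a b : Fin n) : P k (christoffel g c a b) :=
  hP.mul (hP.const _ _) <| hP.sum _ fun d _ =>
    hP.mul (hP.metric_inv hg (fun a b => hP.lower (h a b)) c d)
      (hP.sub (hP.add (hP.pd a (h b d)) (hP.pd b (h a d))) (hP.pd d (h a b)))

theorem scalarCurv (hP : IsRegScale U P) (hg : IsMetricOn g U)
    (h : ∀ a b, P (k + 2) fun x => g x a b) : P k (scalarCurv g) := by
  have h1 := fun a b => hP.lower (h a b)
  have hc := fun c a b => hP.christoffel hg (k := k) h1 c a b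
  refine hP.sum _ fun a _ => hP.sum _ fun b _ =>
    hP.mul (hP.metric_inv hg (fun a b => hP.lower (h1 a b)) a b) ?_
  refine hP.sub (hP.add (hP.sub ?_ ?_) ?_) ?_
  · exact hP.sum _ fun c _ => hP.pd c (hP.christoffel hg h c a b)
  · exact hP.sum _ fun c _ => hP.pd a (hP.christoffel hg h c c b)
  · exact hP.sum _ fun c _ => hP.sum _ fun d _ => hP.mul (hc _ _ _) (hc _ _ _)
  · exact hP.sum _ fun c _ => hP.sum _ fun d _ => hP.mul (hc _ _ _) (hc _ _ _)

end IsRegScale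

/-- First-order coefficients of (minus) the Laplace–Beltrami operator. -/
def lapDrift (g : Met n) (b : Fin n) (x : Pt n) : ℝ :=
  ∑ a, (Real.sqrt (g x).det)⁻¹ * pd a (fun y => Real.sqrt (g y).det * (g y)⁻¹ a b) x

/-- Zeroth-order coefficient of (minus) the conformal Laplacian. -/
def confPot (g : Met n) (x : Pt n) : ℝ :=
  -(((n : ℝ) - 2) / (4 * ((n : ℝ) - 1))) * scalarCurv g x

theorem IsRegScale.lapDrift {P : ℕ → (Pt n → ℝ) → Prop} {k : ℕ} (hP : IsRegScale U P) {g : Met n}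
    (hg : IsMetricOn g U) (h : ∀ a b, P (k + 1) fun x => g x a b) (b : Fin n) :
    P k (lapDrift g b) := by
  have hpos : ∀ x ∈ U, 0 < (g x).det := fun x hx => (hg x hx).2.det_pos
  have hs : P (k + 1) fun x => Real.sqrt (g x).det := hP.sqrt (hP.det h) hpos
  exact hP.sum _ fun a _ => hP.mul
    (hP.inv (hP.lower hs) fun x hx => Real.sqrt_pos.mpr (hpos x hx))
    (hP.pd a (hP.mul hs (hP.metric_inv hg h a b)))

theorem IsRegScale.confPot {P : ℕ → (Pt n → ℝ) → Prop} {k : ℕ} (hP : IsRegScale U P) {g : Met n}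
    (hg : IsMetricOn g U) (h : ∀ a b, P (k + 2) fun x => g x a b) : P k (confPot g) :=
  hP.mul (hP.const _ _) (hP.scalarCurv hg h)

theorem confLap_eq (hU : IsOpen U) {P : ℕ → (Pt n → ℝ) → Prop} {k : ℕ} (hP : IsRegScale U P)
    {g : Met n} (hg : IsMetricOn g U) (h : ∀ a b, P (k + 1) fun x => g x a b) {u : Pt n → ℝ}
    (hu : ContDiffOn ℝ 2 u U) {x : Pt n} (hx : x ∈ U) :
    confLap g u x = -(op (fun i j y => (g y)⁻¹ i j) u x + ∑ b, lapDrift g b x * pd b u x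
      + confPot g x * u x) := by
  have hpos : ∀ x ∈ U, 0 < (g x).det := fun x hx => (hg x hx).2.det_pos
  have hs0 : Real.sqrt (g x).det ≠ 0 := (Real.sqrt_pos.mpr (hpos x hx)).ne'
  have hs : P (k + 1) fun x => Real.sqrt (g x).det := hP.sqrt (hP.det h) hpos
  have hsg : ∀ a b, DifferentiableAt ℝ (fun y => Real.sqrt (g y).det * (g y)⁻¹ a b) x := fun a b =>
    hP.differentiableAt (hP.mul hs (hP.metric_inv hg h a b)) hx
  have hdu : ∀ b, DifferentiableAt ℝ (pd b u) x := fun b =>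
    ((contDiffOn_pd hU hu (m := 1) (by norm_num) b).differentiableOn one_ne_zero).differentiableAt
      (hU.mem_nhds hx)
  have hkey : ∀ a, pd a (fun y => Real.sqrt (g y).det * ∑ b, (g y)⁻¹ a b * pd b u y) x
      = ∑ b, (pd a (fun y => Real.sqrt (g y).det * (g y)⁻¹ a b) x * pd b u x
        + Real.sqrt (g x).det * (g x)⁻¹ a b * pd b (pd a u) x) := by
    intro a
    have : (fun y => Real.sqrt (g y).det * ∑ b, (g y)⁻¹ a b * pd b u y)
        = fun y => ∑ b, Real.sqrt (g y).det * (g y)⁻¹ a b * pd b u y := by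
      ext y; rw [Finset.mul_sum]; simp_rw [mul_assoc]
    rw [this, pd_sum]
    · refine Finset.sum_congr rfl fun b _ => ?_
      rw [pd_mul (hsg a b) (hdu b), pd_comm (hu.contDiffAt (hU.mem_nhds hx)) a b]
    · exact fun b _ => (hsg a b).fun_mul (hdu b)
  unfold confLap laplaceBeltrami op lapDrift confPot
  simp_rw [hkey, Finset.sum_add_distrib, Finset.sum_mul, mul_add, Finset.mul_sum]
  rw [Finset.sum_comm (f := fun b a => (Real.sqrt (g x).det)⁻¹ *
    pd a (fun y => Real.sqrt (g y).det * (g y)⁻¹ a b) x * pd b u x)]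
  have : ∀ a b, -(Real.sqrt (g x).det)⁻¹ * (Real.sqrt (g x).det * (g x)⁻¹ a b * pd b (pd a u) x)
      = -((g x)⁻¹ a b * pd b (pd a u) x) := by
    intro a b; field_simp
  simp_rw [this, neg_mul, Finset.sum_neg_distrib, mul_assoc]
  ring

end Coefficients

section Quotient

variable {n : ℕ} {U : Set (Pt n)} {α : ℝ} {a : Fin n → Fin n → Pt n → ℝ} {b : Fin n → Pt n → ℝ}
  {c : Pt n → ℝ}

theorem div_equation (hU : IsOpen U) {u f : Pt n → ℝ} (hu : ContDiffOn ℝ 2 u U)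
    (hf : ContDiffOn ℝ 2 f U) (hpos : ∀ x ∈ U, 0 < f x)
    (hLu : ∀ x ∈ U, op a u x + ∑ i, b i x * pd i u x + c x * u x = 0)
    (hLf : ∀ x ∈ U, op a f x + ∑ i, b i x * pd i f x + c x * f x = 0) {x : Pt n} (hx : x ∈ U) :
    op a (fun y => u y / f y) x + ∑ i, (b i x + (f x)⁻¹ * ∑ j, (a i j x + a j i x) * pd j f x)
      * pd i (fun y => u y / f y) x = 0 := by
  set w := fun y => u y / f y with hw
  have hwC : ContDiffOn ℝ 2 w U := hu.div hf fun y hy => (hpos y hy).ne'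
  have hfx := (hpos x hx).ne'
  have hUx := hU.mem_nhds hx
  have huw : u =ᶠ[𝓝 x] fun y => f y * w y :=
    Filter.eventually_of_mem hUx fun y hy => (mul_div_cancel₀ _ (hpos y hy).ne').symm
  have h1 : op a u x = op a (fun y => f y * w y) x := op_congr (fun _ _ => rfl) huw
  rw [op_mul (hf.contDiffAt hUx) (hwC.contDiffAt hUx)] at h1
  have h2 : ∀ i, pd i u x = pd i f x * w x + f x * pd i w x := fun i => by
    rw [← pd_mul ((hf.contDiffAt hUx).differentiableAt two_ne_zero)
      ((hwC.contDiffAt hUx).differentiableAt two_ne_zero)]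
    exact huw.pd_eq i
  have hu0 := hLu x hx
  have hf0 := hLf x hx
  have h3 : u x = f x * w x := huw.eq_of_nhds
  rw [h1, h3] at hu0
  simp_rw [h2] at hu0
  have h4 : ∑ i, ∑ j, pd i f x * (a i j x * pd j w x)
      = ∑ i, ∑ j, a j i x * pd j f x * pd i w x := by
    rw [Finset.sum_comm]
    exact Finset.sum_congr rfl fun i _ => Finset.sum_congr rfl fun j _ => by ring
  have h5 : ∑ i, ∑ j, pd j (pd i f) x * (a i j x * w x) = op a f x * w x := by
    simp_rw [op, Finset.sum_mul]
    exact Finset.sum_congr rfl fun i _ => Finset.sum_congr rfl fun j _ => by ring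
  have h6 : ∀ i, b i x * (pd i f x * w x + f x * pd i w x)
      = b i x * pd i f x * w x + f x * (b i x * pd i w x) := fun i => by ring
  have h7 : ∀ i, (b i x + (f x)⁻¹ * ∑ j, (a i j x + a j i x) * pd j f x) * pd i w x
      = b i x * pd i w x + (f x)⁻¹ * (∑ j, pd j f x * (a i j x * pd i w x)
        + ∑ j, a j i x * pd j f x * pd i w x) := fun i => by
    rw [add_mul, mul_assoc, Finset.sum_mul, ← Finset.sum_add_distrib]
    congr 2
    exact Finset.sum_congr rfl fun j _ => by ring
  simp_rw [h7, Finset.sum_add_distrib, ← Finset.mul_sum, Finset.sum_add_distrib]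
  simp_rw [h6, Finset.sum_add_distrib] at hu0
  rw [h4, h5, ← Finset.sum_mul, ← Finset.mul_sum] at hu0
  have hmul : f x * (op a w x + (∑ i, b i x * pd i w x + (f x)⁻¹ *
      (∑ i, ∑ j, pd j f x * (a i j x * pd i w x)
        + ∑ i, ∑ j, a j i x * pd j f x * pd i w x))) = 0 := by
    rw [mul_add, mul_add, mul_inv_cancel_left₀ hfx]
    linear_combination hu0 - w x * hf0
  exact (mul_eq_zero.mp hmul).resolve_left hfx

theorem hc_div [NeZero n] (hU : IsOpen U)
    (ha : ∀ x ∈ U, (Matrix.of fun i j => a i j x).PosDef) (hα : α ∈ Ioo (0 : ℝ) 1) {k : ℕ}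
    (hac : ∀ i j, HC α U (k + 2) (a i j)) (hb : ∀ i, HC α U (k + 1) (b i)) (hc : HC α U k c)
    {u f : Pt n → ℝ} (hu : ContDiffOn ℝ 2 u U) (hf : ContDiffOn ℝ 2 f U) (hpos : ∀ x ∈ U, 0 < f x)
    (hLu : ∀ x ∈ U, op a u x + ∑ i, b i x * pd i u x + c x * u x = 0)
    (hLf : ∀ x ∈ U, op a f x + ∑ i, b i x * pd i f x + c x * f x = 0) :
    HC α U (k + 3) fun x => u x / f x := by
  have hS := isRegScale_hc (n := n) hU hα
  have hf2 : HC α U (k + 2) f := hc_add_two_of_eq_zero hU ha hα (fun i j => (hac i j).lower hα hU)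
    (fun i => (hb i).lower hα hU) hc hf hLf
  refine hc_add_two_of_eq_zero hU ha hα hac (c := fun _ => 0)
    (b := fun i x => b i x + (f x)⁻¹ * ∑ j, (a i j x + a j i x) * pd j f x) (fun i => ?_)
    (HC.const hα hU _ 0) (hu.div hf fun y hy => (hpos y hy).ne') fun x hx => ?_
  · exact hS.add (hb i) (hS.mul (hS.lower (hS.inv hf2 hpos)) (hS.sum _ fun j _ => hS.mul
      (hS.lower (hS.add (hac i j) (hac j i))) (hf2.2 j)))
  · rw [zero_mul, add_zero]
    exact div_equation hU hu hf hpos hLu hLf hx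

theorem posDef_inv_metric {g : Met n} (hg : IsMetricOn g U) :
    ∀ x ∈ U, (Matrix.of fun i j => (g x)⁻¹ i j).PosDef := fun x hx => (hg x hx).2.inv

theorem equation_of_confLap_eq_zero (hU : IsOpen U) {P : ℕ → (Pt n → ℝ) → Prop} {k : ℕ}
    (hP : IsRegScale U P) {g : Met n} (hg : IsMetricOn g U)
    (h : ∀ a b, P (k + 1) fun x => g x a b) {u : Pt n → ℝ} (hu : ContDiffOn ℝ 2 u U)
    (hL : ∀ x ∈ U, confLap g u x = 0) : ∀ x ∈ U, op (fun i j y => (g y)⁻¹ i j) u x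
      + ∑ b, lapDrift g b x * pd b u x + confPot g x * u x = 0 := fun x hx =>
  neg_eq_zero.mp ((confLap_eq hU hP hg h hu hx).symm.trans (hL x hx))

theorem hc_div_of_confLap [NeZero n] (hU : IsOpen U) {g : Met n} (hg : IsMetricOn g U)
    (hα : α ∈ Ioo (0 : ℝ) 1) {k : ℕ} (h : ∀ a b, HC α U (k + 2) fun x => g x a b) {u f : Pt n → ℝ}
    (hu : ContDiffOn ℝ 2 u U) (hf : ContDiffOn ℝ 2 f U) (hLu : ∀ x ∈ U, confLap g u x = 0)
    (hLf : ∀ x ∈ U, confLap g f x = 0) (hpos : ∀ x ∈ U, 0 < f x) :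
    HC α U (k + 3) fun x => u x / f x := by
  have hP := isRegScale_hc (n := n) hU hα
  exact hc_div hU (posDef_inv_metric hg) hα (hP.metric_inv hg h) (hP.lapDrift hg h)
    (hP.confPot hg h) hu hf hpos (equation_of_confLap_eq_zero hU hP hg h hu hLu)
    (equation_of_confLap_eq_zero hU hP hg h hf hLf)

theorem contDiffOn_infty_of_hc (hU : IsOpen U) (hα : 0 < α) {f : Pt n → ℝ}
    (h : ∀ k, HC α U k f) : ContDiffOn ℝ ∞ f U :=
  contDiffOn_infty.mpr fun k => (h k).contDiffOn hα hU

theorem HC.of_contDiffOn_infty (hU : IsOpen U) (hα : α ∈ Ioo (0 : ℝ) 1) {f : Pt n → ℝ}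
    (h : ContDiffOn ℝ ∞ f U) (k : ℕ) : HC α U k f :=
  HC.of_contDiffOn hα hU (contDiffOn_infty.mp h _)

end Quotient

section AnalyticityCriterion

variable {E : Type*} [NormedAddCommGroup E] [NormedSpace ℝ E]

/-- Polarization: the symmetrization of a multilinear map is determined by the diagonal. -/
theorem sum_perm_eq_sum_powerset {k : ℕ} (A : ContinuousMultilinearMap ℝ (fun _ : Fin k => E) ℝ)
    (h : Fin k → E) : ∑ σ : Equiv.Perm (Fin k), A (fun i => h (σ i))
      = ∑ t : Finset (Fin k), (-1) ^ t.card * A fun _ => ∑ j ∈ tᶜ, h j := by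
  have h1 : ∀ t : Finset (Fin k), (A fun _ => ∑ j ∈ tᶜ, h j)
      = ∑ r : Fin k → Fin k, if ∀ i, r i ∉ t then A fun i => h (r i) else 0 := fun t => by
    rw [A.map_sum_finset (fun _ => h) (fun _ => tᶜ), ← Finset.sum_filter]
    refine Finset.sum_congr ?_ fun _ _ => rfl
    ext r
    simp [Fintype.mem_piFinset]
  have h2 : ∀ r : Fin k → Fin k, ∑ t : Finset (Fin k), (-1 : ℝ) ^ t.card *
      (if ∀ i, r i ∉ t then A fun i => h (r i) else 0)
      = if Function.Bijective r then A fun i => h (r i) else 0 := fun r => by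
    have hf : (Finset.univ.filter fun t : Finset (Fin k) => ∀ i, r i ∉ t)
        = (Finset.univ.image r)ᶜ.powerset := by
      ext t
      simp only [Finset.mem_filter, Finset.mem_univ, true_and, Finset.mem_powerset,
        Finset.subset_iff, Finset.mem_image, Finset.mem_compl]
      exact ⟨fun ht j hj ⟨i, hi⟩ => ht i (hi ▸ hj), fun ht i hi => ht hi ⟨i, rfl⟩⟩
    have hs : ∑ t ∈ (Finset.univ.image r)ᶜ.powerset, (-1 : ℝ) ^ t.card
        = if (Finset.univ.image r)ᶜ = ∅ then 1 else 0 := by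
      exact_mod_cast Finset.sum_powerset_neg_one_pow_card (x := (Finset.univ.image r)ᶜ)
    simp_rw [mul_ite, mul_zero]
    rw [← Finset.sum_filter, hf, ← Finset.sum_mul, hs, ite_mul, one_mul, zero_mul]
    refine if_congr ?_ rfl rfl
    rw [Finset.compl_eq_empty_iff, ← Finite.surjective_iff_bijective, Finset.eq_univ_iff_forall]
    simp [Function.Surjective]
  simp_rw [h1, Finset.mul_sum]
  rw [Finset.sum_comm]
  simp_rw [h2]
  rw [← Finset.sum_filter]
  refine Finset.sum_bij (fun σ _ => ⇑σ) (fun σ _ => Finset.mem_filter.mpr ⟨Finset.mem_univ _, σ.bijective⟩)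
    (fun σ _ τ _ e => DFunLike.coe_injective e) (fun r hr => ?_) fun σ _ => rfl
  exact ⟨Equiv.ofBijective r (by simpa using hr), Finset.mem_univ _, rfl⟩

/-- The symmetrization of a continuous multilinear map, divided by `k!`. -/
def symm {k : ℕ} (A : ContinuousMultilinearMap ℝ (fun _ : Fin k => E) ℝ) :
    ContinuousMultilinearMap ℝ (fun _ : Fin k => E) ℝ :=
  (k.factorial : ℝ)⁻¹ • ∑ σ : Equiv.Perm (Fin k), A.domDomCongr σ

theorem symm_apply {k : ℕ} (A : ContinuousMultilinearMap ℝ (fun _ : Fin k => E) ℝ)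
    (h : Fin k → E) :
    symm A h = (k.factorial : ℝ)⁻¹ * ∑ σ : Equiv.Perm (Fin k), A (fun i => h (σ i)) := by
  simp [symm]

theorem symm_apply_diag {k : ℕ} (A : ContinuousMultilinearMap ℝ (fun _ : Fin k => E) ℝ) (e : E) :
    symm A (fun _ => e) = A fun _ => e := by
  have : (k.factorial : ℝ) ≠ 0 := by positivity
  simp [symm_apply, Fintype.card_perm, this]

theorem abs_apply_diag_le {k : ℕ} (A : ContinuousMultilinearMap ℝ (fun _ : Fin k => E) ℝ) {C : ℝ}
    (hA : ∀ e, ‖e‖ ≤ 1 → |A fun _ => e| ≤ C) (e : E) : |A fun _ => e| ≤ C * ‖e‖ ^ k := by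
  have he : e = ‖e‖ • (‖e‖⁻¹ • e) := by
    by_cases h : ‖e‖ = 0
    · simp [norm_eq_zero.mp h]
    · rw [smul_smul, mul_inv_cancel₀ h, one_smul]
  have h1 : ‖‖e‖⁻¹ • e‖ ≤ 1 := by
    rw [norm_smul, norm_inv, norm_norm]
    exact inv_mul_le_one
  have h2 : (A fun _ => e) = ‖e‖ ^ k * A fun _ => ‖e‖⁻¹ • e := by
    have := A.map_smul_univ (fun _ => ‖e‖) fun _ => ‖e‖⁻¹ • e
    rw [← he] at this
    simpa using this
  rw [h2, abs_mul, abs_of_nonneg (by positivity), mul_comm]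
  exact mul_le_mul_of_nonneg_right (hA _ h1) (by positivity)

theorem norm_symm_le {k : ℕ} (A : ContinuousMultilinearMap ℝ (fun _ : Fin k => E) ℝ) {C : ℝ}
    (hC : 0 ≤ C) (hA : ∀ e, ‖e‖ ≤ 1 → |A fun _ => e| ≤ C) :
    ‖symm A‖ ≤ C * (2 * Real.exp 1) ^ k := by
  have hunit : ∀ h : Fin k → E, (∀ i, ‖h i‖ ≤ 1) → |symm A h| ≤ C * (2 * Real.exp 1) ^ k := by
    intro h hh
    rw [symm_apply, sum_perm_eq_sum_powerset, abs_mul, abs_of_nonneg (by positivity)]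
    have h1 : |∑ t : Finset (Fin k), (-1 : ℝ) ^ t.card * A fun _ => ∑ j ∈ tᶜ, h j|
        ≤ 2 ^ k * (C * (k : ℝ) ^ k) := by
      refine (Finset.abs_sum_le_sum_abs _ _).trans ?_
      refine (Finset.sum_le_card_nsmul _ _ (C * (k : ℝ) ^ k) fun t _ => ?_).trans (by simp)
      rw [abs_mul, abs_pow, abs_neg, abs_one, one_pow, one_mul]
      refine (abs_apply_diag_le A hA _).trans ?_
      gcongr
      refine (norm_sum_le_of_le _ fun j _ => hh j).trans ?_
      simpa using Finset.card_le_univ tᶜ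
    have h2 : (k.factorial : ℝ)⁻¹ * (k : ℝ) ^ k ≤ Real.exp 1 ^ k := by
      rw [← Real.exp_nat_mul, mul_one, inv_mul_eq_div]
      exact Real.pow_div_factorial_le_exp _ (by positivity) k
    calc _ ≤ (k.factorial : ℝ)⁻¹ * (2 ^ k * (C * (k : ℝ) ^ k)) := by gcongr
      _ = C * 2 ^ k * ((k.factorial : ℝ)⁻¹ * (k : ℝ) ^ k) := by ring
      _ ≤ C * 2 ^ k * Real.exp 1 ^ k := by gcongr
      _ = _ := by ring
  refine ContinuousMultilinearMap.opNorm_le_bound (by positivity) fun m => ?_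
  have hm : ∀ i, m i = ‖m i‖ • (‖m i‖⁻¹ • m i) := fun i => by
    by_cases h : ‖m i‖ = 0
    · simp [norm_eq_zero.mp h]
    · rw [smul_smul, mul_inv_cancel₀ h, one_smul]
  have h1 : ∀ i, ‖‖m i‖⁻¹ • m i‖ ≤ 1 := fun i => by
    rw [norm_smul, norm_inv, norm_norm]
    exact inv_mul_le_one
  have h2 := (symm A).map_smul_univ (fun i => ‖m i‖) fun i => ‖m i‖⁻¹ • m i
  simp_rw [← hm] at h2
  rw [h2, smul_eq_mul, norm_mul, Real.norm_of_nonneg (Finset.prod_nonneg fun i _ => norm_nonneg _),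
    mul_comm]
  exact mul_le_mul_of_nonneg_right (hunit _ h1) (Finset.prod_nonneg fun i _ => norm_nonneg _)

/-- Factorial bounds on the pure directional derivatives imply analyticity. -/
theorem analyticAt_of_iteratedFDeriv_le {f : E → ℝ} {x₀ : E} {r T ρ : ℝ} (hr : 0 < r)
    (hf : ContDiffOn ℝ ∞ f (Metric.ball x₀ r)) (hT : 0 ≤ T) (hρ : 0 ≤ ρ)
    (hb : ∀ x ∈ Metric.ball x₀ r, ∀ e : E, ‖e‖ ≤ 1 → ∀ k : ℕ,
      |iteratedFDeriv ℝ k f x fun _ => e| ≤ T * ρ ^ k * k.factorial) : AnalyticAt ℝ f x₀ := by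
  set p : FormalMultilinearSeries ℝ E ℝ :=
    fun k => (k.factorial : ℝ)⁻¹ • symm (iteratedFDeriv ℝ k f x₀) with hp
  have hx₀ : x₀ ∈ Metric.ball x₀ r := Metric.mem_ball_self hr
  have hdiag : ∀ k (e : E), p k (fun _ => e)
      = (k.factorial : ℝ)⁻¹ • iteratedFDeriv ℝ k f x₀ fun _ => e := fun k e => by
    simp [hp, symm_apply_diag]
  have hnorm : ∀ k, ‖p k‖ ≤ T * (ρ * (2 * Real.exp 1)) ^ k := fun k => by
    have h0 : (k.factorial : ℝ) ≠ 0 := by positivity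
    calc ‖p k‖ = (k.factorial : ℝ)⁻¹ * ‖symm (iteratedFDeriv ℝ k f x₀)‖ := by
          rw [hp, norm_smul, norm_inv, Real.norm_natCast]
      _ ≤ (k.factorial : ℝ)⁻¹ * (T * ρ ^ k * k.factorial * (2 * Real.exp 1) ^ k) := by
          gcongr
          exact norm_symm_le _ (by positivity) fun e he => hb x₀ hx₀ e he k
      _ = _ := by field_simp; rw [mul_pow]; ring
  set R := ρ * (2 * Real.exp 1) + 1 with hR
  have hR0 : 0 < R := by positivity
  have hρR : ρ < R := by nlinarith [Real.add_one_le_exp (1 : ℝ)]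
  set s := min r R⁻¹ with hs
  have hs0 : 0 < s := lt_min hr (inv_pos.mpr hR0)
  refine ⟨p, ENNReal.ofReal s, ?_, ENNReal.ofReal_pos.mpr hs0, ?_⟩
  · refine p.le_radius_of_bound T (r := s.toNNReal) fun k => ?_
    rw [Real.coe_toNNReal _ hs0.le]
    calc ‖p k‖ * s ^ k ≤ T * (ρ * (2 * Real.exp 1)) ^ k * s ^ k := by gcongr; exact hnorm k
      _ = T * (ρ * (2 * Real.exp 1) * s) ^ k := by ring
      _ ≤ T * 1 := by
          refine mul_le_mul_of_nonneg_left (pow_le_one₀ (by positivity) ?_) hT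
          calc ρ * (2 * Real.exp 1) * s ≤ R * R⁻¹ := by
                refine mul_le_mul (by linarith) (min_le_right _ _) hs0.le hR0.le
            _ = 1 := mul_inv_cancel₀ hR0.ne'
      _ = T := mul_one T
  · intro y hy
    have hys : ‖y‖ < s := by
      rwa [Metric.eball_ofReal, Metric.mem_ball, dist_zero_right] at hy
    have hq : ρ * ‖y‖ < 1 := by
      calc ρ * ‖y‖ ≤ ρ * R⁻¹ := by
            refine mul_le_mul_of_nonneg_left (hys.le.trans (min_le_right _ _)) hρ
        _ < R * R⁻¹ := by gcongr
        _ = 1 := mul_inv_cancel₀ hR0.ne'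
    have hq0 : 0 ≤ ρ * ‖y‖ := by positivity
    have hmem : ∀ t ∈ Icc (0 : ℝ) 1, x₀ + t • y ∈ Metric.ball x₀ r := fun t ht => by
      rw [Metric.mem_ball, dist_eq_norm, add_sub_cancel_left, norm_smul, Real.norm_of_nonneg ht.1]
      exact (mul_le_of_le_one_left (norm_nonneg _) ht.2).trans_lt
        (hys.trans_le (min_le_left _ _))
    have hdir : ∀ x ∈ Metric.ball x₀ r, ∀ k : ℕ,
        |iteratedFDeriv ℝ k f x fun _ => y| ≤ T * (ρ * ‖y‖) ^ k * k.factorial := fun x hx k => by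
      refine (abs_apply_diag_le _ (fun e he => hb x hx e he k) y).trans (le_of_eq ?_)
      rw [mul_pow]; ring
    have hsum : Summable fun k => p k fun _ => y := by
      refine Summable.of_norm_bounded (g := fun k => T * (ρ * ‖y‖) ^ k)
        ((summable_geometric_of_lt_one hq0 hq).mul_left T) fun k => ?_
      have h0 : (0 : ℝ) < k.factorial := by positivity
      rw [hdiag, norm_smul, norm_inv, Real.norm_natCast, inv_mul_le_iff₀ h0, mul_comm]
      exact hdir x₀ hx₀ k
    refine hsum.hasSum_iff_tendsto_nat.mpr ((tendsto_add_atTop_iff_nat 1).mp ?_)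
    refine tendsto_iff_norm_sub_tendsto_zero.mpr (squeeze_zero (fun _ => norm_nonneg _)
      (g := fun m : ℕ => T * (((m + 1 : ℕ) : ℝ) * (ρ * ‖y‖) ^ (m + 1))) (fun m => ?_) ?_)
    · have hT' := map_add_eq_sum_add_integral_iteratedFDeriv (f := f) (x := x₀) (y := y) (n := m)
        fun t ht => ((hf.contDiffAt (Metric.isOpen_ball.mem_nhds (hmem t ht))).of_le
          (by exact_mod_cast le_top))
      have h0 : (0 : ℝ) < m.factorial := by positivity
      simp_rw [hdiag]
      rw [hT', sub_add_cancel_left, norm_neg, norm_smul, norm_inv, Real.norm_natCast,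
        inv_mul_le_iff₀ h0]
      refine (intervalIntegral.norm_integral_le_of_norm_le_const
        (C := T * (ρ * ‖y‖) ^ (m + 1) * (m + 1).factorial) fun t ht => ?_).trans (le_of_eq ?_)
      · rw [uIoc_of_le zero_le_one] at ht
        rw [norm_smul, norm_pow, Real.norm_of_nonneg (sub_nonneg.mpr ht.2)]
        refine (mul_le_of_le_one_left (norm_nonneg _) (pow_le_one₀ (sub_nonneg.mpr ht.2)
          (by linarith [ht.1]))).trans (hdir _ (hmem t ⟨ht.1.le, ht.2⟩) (m + 1))
      · rw [Nat.factorial_succ]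
        push_cast
        simp
        ring
    · have := (tendsto_self_mul_const_pow_of_lt_one hq0 hq).const_mul T
      rw [mul_zero] at this
      exact (tendsto_add_atTop_iff_nat 1).mpr this

end AnalyticityCriterion

section DirectionalDerivatives

variable {n : ℕ} {U : Set (Pt n)} {f h : Pt n → ℝ} {e : Pt n}

/-- Directional derivative. -/
def dd (e : Pt n) (f : Pt n → ℝ) (x : Pt n) : ℝ := fderiv ℝ f x e

theorem dd_eq_sum (e : Pt n) (f : Pt n → ℝ) (x : Pt n) : dd e f x = ∑ i, e i * pd i f x :=
  fderiv_apply_eq_sum f x e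

theorem contDiffOn_dd (hU : IsOpen U) (hf : ContDiffOn ℝ ∞ f U) : ContDiffOn ℝ ∞ (dd e f) U :=
  (hf.fderiv_of_isOpen hU (m := ∞) (by simp)).clm_apply contDiffOn_const

theorem contDiffOn_dd_iterate (hU : IsOpen U) (hf : ContDiffOn ℝ ∞ f U) (k : ℕ) :
    ContDiffOn ℝ ∞ ((dd e)^[k] f) U := by
  induction k with
  | zero => exact hf
  | succ k ih => rw [Function.iterate_succ_apply']; exact contDiffOn_dd hU ih

theorem dd_eqOn (hU : IsOpen U) (he : EqOn f h U) : EqOn (dd e f) (dd e h) U := fun x hx => by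
  rw [dd, dd, (Filter.eventuallyEq_of_mem (hU.mem_nhds hx) he).fderiv_eq]

theorem dd_iterate_eqOn (hU : IsOpen U) (he : EqOn f h U) (k : ℕ) :
    EqOn ((dd e)^[k] f) ((dd e)^[k] h) U := by
  induction k with
  | zero => exact he
  | succ k ih => simp_rw [Function.iterate_succ_apply']; exact dd_eqOn hU ih

theorem differentiableAt_of_infty (hU : IsOpen U) (hf : ContDiffOn ℝ ∞ f U) {x : Pt n}
    (hx : x ∈ U) : DifferentiableAt ℝ f x :=
  (hf.contDiffAt (hU.mem_nhds hx)).differentiableAt (by simp)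

theorem iteratedFDeriv_diag (hU : IsOpen U) (hf : ContDiffOn ℝ ∞ f U) (k : ℕ) :
    ∀ x ∈ U, (iteratedFDeriv ℝ k f x fun _ => e) = (dd e)^[k] f x := by
  induction k with
  | zero => intro x _; simp
  | succ k ih =>
    intro x hx
    have hd : DifferentiableAt ℝ (iteratedFDeriv ℝ k f) x :=
      (hf.contDiffAt (hU.mem_nhds hx)).differentiableAt_iteratedFDeriv
        (by exact_mod_cast WithTop.coe_lt_top k)
    rw [hd.iteratedFDeriv_succ_apply_left', Function.iterate_succ_apply', dd,
      ← (Filter.eventuallyEq_of_mem (hU.mem_nhds hx) ih).fderiv_eq]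
    rfl

theorem pd_dd (hU : IsOpen U) (hf : ContDiffOn ℝ ∞ f U) (i : Fin n) :
    EqOn (pd i (dd e f)) (dd e (pd i f)) U := fun x hx => by
  have h1 : dd e f = fun x => ∑ j, e j * pd j f x := funext fun x => dd_eq_sum e f x
  have hd : ∀ j, DifferentiableAt ℝ (pd j f) x := fun j =>
    differentiableAt_of_infty hU (contDiffOn_pd hU hf (m := ∞) (by simp) j) hx
  rw [h1, pd_sum _ (fun j _ => (hd j).const_mul _), dd_eq_sum]
  refine Finset.sum_congr rfl fun j _ => ?_
  rw [pd_const_mul _ (hd j), pd_comm ((hf.contDiffAt (hU.mem_nhds hx)).of_le two_le_infty)]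

theorem pd_dd_iterate (hU : IsOpen U) (hf : ContDiffOn ℝ ∞ f U) (i : Fin n) (k : ℕ) :
    EqOn (pd i ((dd e)^[k] f)) ((dd e)^[k] (pd i f)) U := by
  induction k with
  | zero => exact fun _ _ => rfl
  | succ k ih =>
    simp_rw [Function.iterate_succ_apply']
    exact (pd_dd hU (contDiffOn_dd_iterate hU hf k) i).trans (dd_eqOn hU ih)

theorem dd_iterate_sum (hU : IsOpen U) {ι : Type*} (s : Finset ι) {f : ι → Pt n → ℝ}
    (hf : ∀ a ∈ s, ContDiffOn ℝ ∞ (f a) U) (k : ℕ) :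
    EqOn ((dd e)^[k] fun x => ∑ a ∈ s, f a x) (fun x => ∑ a ∈ s, (dd e)^[k] (f a) x) U := by
  induction k with
  | zero => exact fun _ _ => rfl
  | succ k ih =>
    simp_rw [Function.iterate_succ_apply']
    refine (dd_eqOn hU ih).trans fun x hx => ?_
    have := HasFDerivAt.fun_sum fun a ha =>
      (differentiableAt_of_infty hU (contDiffOn_dd_iterate (e := e) hU (hf a ha) k) hx).hasFDerivAt
    simp [dd, this.fderiv]

theorem dd_iterate_mul (hU : IsOpen U) (hf : ContDiffOn ℝ ∞ f U) (hh : ContDiffOn ℝ ∞ h U)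
    (k : ℕ) : EqOn ((dd e)^[k] fun x => f x * h x) (fun x => ∑ p ∈ Finset.HasAntidiagonal.antidiagonal k,
      (k.choose p.1 : ℝ) * ((dd e)^[p.1] f x * (dd e)^[p.2] h x)) U := by
  induction k with
  | zero => intro x _; simp
  | succ k ih =>
    rw [Function.iterate_succ_apply']
    refine (dd_eqOn hU ih).trans fun x hx => ?_
    have hF := fun m => differentiableAt_of_infty hU (contDiffOn_dd_iterate (e := e) hU hf m) hx
    have hH := fun m => differentiableAt_of_infty hU (contDiffOn_dd_iterate (e := e) hU hh m) hx
    have hd : HasFDerivAt _ _ x := HasFDerivAt.fun_sum (u := Finset.HasAntidiagonal.antidiagonal k) fun p _ =>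
      ((hF p.1).hasFDerivAt.fun_mul (hH p.2).hasFDerivAt).const_mul (k.choose p.1 : ℝ)
    rw [Finset.sum_antidiagonal_choose_succ_mul
      (fun i j => (dd e)^[i] f x * (dd e)^[j] h x), dd, hd.fderiv]
    simp_rw [Function.iterate_succ_apply', dd]
    rw [← Finset.sum_add_distrib]
    simp only [_root_.sum_apply, _root_.smul_apply, _root_.add_apply, smul_eq_mul]
    refine Finset.sum_congr rfl fun p hp => ?_
    rw [← Finset.HasAntidiagonal.mem_antidiagonal.mp hp, Nat.choose_symm_add]
    ring

/-- The normalized directional derivative `φ ^ k * ∂ₑ ^ k f / k!`, localized by `φ`. -/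
def loc (φ : Pt n → ℝ) (e : Pt n) (k : ℕ) (f : Pt n → ℝ) (x : Pt n) : ℝ :=
  φ x ^ k * ((dd e)^[k] f x / k.factorial)

/-- `loc` with index shifted by one. -/
def locPred (φ : Pt n → ℝ) (e : Pt n) : ℕ → (Pt n → ℝ) → Pt n → ℝ
  | 0, _, _ => 0
  | k + 1, f, x => loc φ e k f x

variable {φ : Pt n → ℝ}

theorem loc_zero (φ : Pt n → ℝ) (e : Pt n) (f : Pt n → ℝ) : loc φ e 0 f = f := by
  ext x; simp [loc]

theorem loc_eqOn (hU : IsOpen U) (he : EqOn f h U) (k : ℕ) : EqOn (loc φ e k f) (loc φ e k h) U :=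
  fun x hx => by rw [loc, loc, dd_iterate_eqOn hU he k hx]

theorem loc_succ (k : ℕ) (x : Pt n) :
    loc φ e (k + 1) f x = ((k : ℝ) + 1)⁻¹ * (φ x * loc φ e k (dd e f) x) := by
  rw [loc, loc, Function.iterate_succ_apply, Nat.factorial_succ]
  push_cast
  field_simp
  ring

theorem loc_sum (hU : IsOpen U) {ι : Type*} (s : Finset ι) {f : ι → Pt n → ℝ}
    (hf : ∀ a ∈ s, ContDiffOn ℝ ∞ (f a) U) (k : ℕ) :
    EqOn (loc φ e k fun x => ∑ a ∈ s, f a x) (fun x => ∑ a ∈ s, loc φ e k (f a) x) U :=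
  fun x hx => by
    simp_rw [loc]
    rw [dd_iterate_sum hU s hf k hx, Finset.sum_div, Finset.mul_sum]

theorem loc_mul (hU : IsOpen U) (hf : ContDiffOn ℝ ∞ f U) (hh : ContDiffOn ℝ ∞ h U)
    (k : ℕ) : EqOn (loc φ e k fun x => f x * h x) (fun x => ∑ p ∈ Finset.HasAntidiagonal.antidiagonal k,
      loc φ e p.1 f x * loc φ e p.2 h x) U := fun x hx => by
  simp_rw [loc]
  rw [dd_iterate_mul hU hf hh k hx, Finset.sum_div, Finset.mul_sum]
  refine Finset.sum_congr rfl fun p hp => ?_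
  have hk : p.1 + p.2 = k := Finset.HasAntidiagonal.mem_antidiagonal.mp hp
  have hc : (k.choose p.1 : ℝ) * p.1.factorial * p.2.factorial = k.factorial := by
    rw [← hk, Nat.choose_symm_add]
    exact_mod_cast Nat.add_choose_mul_factorial_mul_factorial p.1 p.2
  have h0 : (p.1.factorial : ℝ) ≠ 0 := by positivity
  have h1 : (p.2.factorial : ℝ) ≠ 0 := by positivity
  have h2 : (k.choose p.1 : ℝ) ≠ 0 := by
    exact_mod_cast (Nat.choose_pos (hk ▸ Nat.le_add_right _ _)).ne'
  have hp : φ x ^ k = φ x ^ p.1 * φ x ^ p.2 := by rw [← hk, pow_add]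
  rw [← hc, hp]
  field_simp

theorem loc_dd (hU : IsOpen U) (hf : ContDiffOn ℝ ∞ f U) (k : ℕ) :
    EqOn (loc φ e k (dd e f)) (fun x => ∑ i, e i * loc φ e k (pd i f) x) U := fun x hx => by
  simp_rw [loc]
  rw [← Function.iterate_succ_apply, Function.iterate_succ_apply', dd_eq_sum, Finset.sum_div,
    Finset.mul_sum]
  refine Finset.sum_congr rfl fun i _ => ?_
  rw [pd_dd_iterate hU hf i k hx]
  ring

theorem pd_loc (hU : IsOpen U) (hφ : ContDiff ℝ ∞ φ) (hf : ContDiffOn ℝ ∞ f U) (i : Fin n)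
    (k : ℕ) : EqOn (pd i (loc φ e k f))
      (fun x => loc φ e k (pd i f) x + pd i φ x * locPred φ e k (dd e f) x) U := fun x hx => by
  cases k with
  | zero => simp [loc_zero, locPred]
  | succ k =>
    have hφx : DifferentiableAt ℝ φ x := hφ.differentiable (by simp) x
    have hF := differentiableAt_of_infty hU (contDiffOn_dd_iterate (e := e) hU hf (k + 1)) hx
    have h1 : loc φ e (k + 1) f
        = fun x => φ x ^ (k + 1) * (((k + 1).factorial : ℝ)⁻¹ * (dd e)^[k + 1] f x) := by
      ext y; rw [loc, div_eq_inv_mul]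
    have h2 : pd i (fun y => φ y ^ (k + 1)) x = ((k + 1 : ℕ) : ℝ) * φ x ^ k * pd i φ x :=
      ((hasDerivAt_pow (k + 1) (φ x)).comp_hasFDerivAt x hφx.hasFDerivAt).pd_eq i
    rw [h1, pd_mul (hφx.fun_pow (k + 1)) (hF.const_mul _), h2, pd_const_mul _ hF,
      pd_dd_iterate hU hf i (k + 1) hx]
    simp_rw [locPred, loc]
    rw [← Function.iterate_succ_apply, Nat.factorial_succ]
    push_cast
    field_simp
    ring

theorem contDiff_loc (hU : IsOpen U) (hφ : ContDiff ℝ ∞ φ) (hs : tsupport φ ⊆ U)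
    (hf : ContDiffOn ℝ ∞ f U) (k : ℕ) : ContDiff ℝ ∞ (loc φ e (k + 1) f) := by
  have h1 : loc φ e (k + 1) f
      = fun x => φ x * (φ x ^ k * ((dd e)^[k + 1] f x / (k + 1).factorial)) := by
    ext y; rw [loc, pow_succ]; ring
  rw [h1]
  exact contDiff_mul_of_tsupport_subset hU hφ hs ((hφ.contDiffOn.pow k).mul
    ((contDiffOn_dd_iterate hU hf (k + 1)).div_const _))

theorem tsupport_loc_subset (k : ℕ) : tsupport (loc φ e (k + 1) f) ⊆ tsupport φ := by
  refine closure_mono fun x hx => ?_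
  contrapose! hx
  simp [loc, Function.notMem_support.mp hx]

end DirectionalDerivatives

section AnalyticBounds

section Normed

variable {E : Type*} [NormedAddCommGroup E] [NormedSpace ℝ E]

open scoped ENNReal NNReal in
/-- Uniform Cauchy estimates for the coefficients of the re-expansions of a power series. -/
theorem exists_nnnorm_changeOrigin_le {F : Type*} [NormedAddCommGroup F] [NormedSpace ℝ F]
    [CompleteSpace F] (p : FormalMultilinearSeries ℝ E F) {r r' : ℝ≥0}
    (hr : (r + r' : ℝ≥0∞) < p.radius) (hr' : 0 < r') :
    ∃ S : ℝ≥0, ∀ y : E, ‖y‖₊ ≤ r → ∀ k, ‖p.changeOrigin y k‖₊ ≤ S * (r'⁻¹) ^ k := by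
  have hs := p.changeOriginSeries_summable_aux₁ hr
  refine ⟨∑' s : Σ k l : ℕ, { s : Finset (Fin (k + l)) // s.card = l },
      ‖p (s.1 + s.2.1)‖₊ * r ^ s.2.1 * r' ^ s.1, fun y hy k => ?_⟩
  have hrr : (r : ℝ≥0∞) < p.radius := lt_of_le_of_lt (by simp) hr
  have hy' : (‖y‖₊ : ℝ≥0∞) < p.radius := lt_of_le_of_lt (by exact_mod_cast hy) hrr
  refine (p.nnnorm_changeOrigin_le k hy').trans ?_
  rw [inv_pow, ← div_eq_mul_inv, le_div_iff₀ (by positivity)]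
  calc _ ≤ (∑' s : Σ l : ℕ, { s : Finset (Fin (k + l)) // s.card = l },
          ‖p (k + s.1)‖₊ * r ^ s.1) * r' ^ k := by
        gcongr
        · exact p.changeOriginSeries_summable_aux₂ hy' k
        · exact p.changeOriginSeries_summable_aux₂ hrr k
    _ = ∑' s : Σ l : ℕ, { s : Finset (Fin (k + l)) // s.card = l },
          ‖p (k + s.1)‖₊ * r ^ s.1 * r' ^ k := by rw [NNReal.tsum_mul_right]
    _ ≤ _ := NNReal.tsum_comp_le_tsum_of_inj hs (i := fun s => ⟨k, s⟩) (fun _ _ h => by simpa using h)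

open scoped ENNReal NNReal in
theorem exists_iteratedFDeriv_le {f : E → ℝ} {x₀ : E} (hf : AnalyticAt ℝ f x₀) :
    ∃ r A M : ℝ, 0 < r ∧ 0 ≤ A ∧ 0 ≤ M ∧ ∀ x ∈ Metric.ball x₀ r, ∀ e, ‖e‖ ≤ 1 → ∀ k,
      |iteratedFDeriv ℝ k f x fun _ => e| ≤ A * M ^ k * k.factorial := by
  obtain ⟨p, R, hp⟩ := hf
  obtain ⟨ρ, hρ0, hρ⟩ := ENNReal.lt_iff_exists_nnreal_btwn.mp hp.r_pos
  have hρ0' : 0 < ρ := by exact_mod_cast hρ0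
  obtain ⟨S, hS⟩ := exists_nnnorm_changeOrigin_le p (r := ρ / 2) (r' := ρ / 2)
    (lt_of_lt_of_le (by rwa [← ENNReal.coe_add, add_halves]) hp.r_le) (by positivity)
  refine ⟨ρ / 2, S, (ρ / 2 : ℝ≥0)⁻¹, by positivity, by positivity, by positivity,
    fun x hx e he k => ?_⟩
  have hy : ‖x - x₀‖₊ ≤ ρ / 2 := by
    rw [Metric.mem_ball, dist_eq_norm] at hx
    exact_mod_cast hx.le
  have hyR : (‖x - x₀‖₊ : ℝ≥0∞) < R := lt_of_le_of_lt
    (by exact_mod_cast hy.trans (half_le_self ρ.2)) hρ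
  have h := (hp.changeOrigin hyR).factorial_smul e k
  rw [add_sub_cancel] at h
  rw [← h, nsmul_eq_mul, abs_mul, Nat.abs_cast, mul_comm]
  gcongr
  have h1 := (p.changeOrigin (x - x₀) k).le_opNorm fun _ => e
  simp only [Finset.prod_const, Finset.card_univ, Fintype.card_fin, Real.norm_eq_abs] at h1
  refine h1.trans ((mul_le_of_le_one_right (norm_nonneg _) (pow_le_one₀ (norm_nonneg _) he)).trans ?_)
  exact_mod_cast hS (x - x₀) hy k

end Normed

variable {n : ℕ} {U : Set (Pt n)} {f h φ : Pt n → ℝ} {e x₀ : Pt n} {α r : ℝ}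

theorem eventually_dd_iterate_le (hf : AnalyticAt ℝ f x₀) :
    ∀ᶠ N : ℝ in atTop, ∀ x ∈ Metric.ball x₀ N⁻¹, ∀ e, ‖e‖ ≤ 1 → ∀ k,
      |(dd e)^[k] f x| ≤ N * N ^ k * k.factorial := by
  obtain ⟨r, A, M, hr, hA, hM, h⟩ := exists_iteratedFDeriv_le hf
  obtain ⟨s, hs, hs'⟩ := Metric.eventually_nhds_iff_ball.mp hf.eventually_analyticAt
  have hc : ContDiffOn ℝ ∞ f (Metric.ball x₀ s) := fun x hx =>
    (hs' x hx).contDiffAt.contDiffWithinAt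
  have hN := tendsto_inv_atTop_zero (𝕜 := ℝ)
  filter_upwards [eventually_ge_atTop A, eventually_ge_atTop M, eventually_gt_atTop 0,
    hN.eventually_le_const hr, hN.eventually_le_const hs] with N hAN hMN hN0 hNr hNs x hx e he k
  rw [← iteratedFDeriv_diag Metric.isOpen_ball hc k x (Metric.ball_subset_ball hNs hx)]
  refine (h x (Metric.ball_subset_ball hNr hx) e he k).trans ?_
  gcongr

/-- On a ball of diameter at most one, a `C¹` bound gives a Hölder bound. -/
theorem HB.of_pd_le (hr1 : 2 * r ≤ 1) (hα : α ≤ 1) {M K : ℝ} (hM : 0 ≤ M)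
    (hd : ∀ x ∈ Metric.ball x₀ r, DifferentiableAt ℝ f x)
    (hf : ∀ x ∈ Metric.ball x₀ r, |f x| ≤ K)
    (hp : ∀ i, ∀ x ∈ Metric.ball x₀ r, |pd i f x| ≤ M) :
    HB (Metric.ball x₀ r) α (n * M + K) f := by
  refine ⟨fun x hx => (hf x hx).trans (le_add_of_nonneg_left (by positivity)), fun x hx y hy => ?_⟩
  have hK0 : 0 ≤ K := (abs_nonneg _).trans (hf x hx)
  have h1 : ‖x - y‖ ≤ 1 := by
    rw [← dist_eq_norm]
    exact (dist_triangle_right x y x₀).trans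
      (by linarith [Metric.mem_ball.mp hx, Metric.mem_ball.mp hy])
  refine (abs_sub_le_of_pd_le (convex_ball x₀ r) hM hd hp hx hy).trans ?_
  have h2 : ‖x - y‖ ≤ ‖x - y‖ ^ α := by
    rcases (norm_nonneg (x - y)).eq_or_lt with h0 | h0
    · rw [← h0]; exact Real.rpow_nonneg le_rfl _
    · simpa using Real.rpow_le_rpow_of_exponent_ge h0 h1 hα
  have : 0 ≤ n * M := by positivity
  exact mul_le_mul (by linarith) h2 (norm_nonneg _) (by linarith)

theorem exists_hb_of_contDiffOn (hr1 : 2 * r ≤ 1) (hα : α ≤ 1) (hU : IsOpen U)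
    (hB : Metric.closedBall x₀ r ⊆ U) (hf : ContDiffOn ℝ ∞ f U) :
    ∃ M, 0 ≤ M ∧ HB (Metric.ball x₀ r) α M f := by
  have hb : ∀ h : Pt n → ℝ, ContDiffOn ℝ ∞ h U →
      ∀ᶠ N : ℝ in atTop, ∀ x ∈ Metric.ball x₀ r, |h x| ≤ N := fun h hh => by
    obtain ⟨N, hN⟩ := (isCompact_closedBall x₀ r).exists_bound_of_continuousOn
      (hh.continuousOn.mono hB)
    filter_upwards [eventually_ge_atTop N] with N' hN' x hx
    exact (hN x (Metric.ball_subset_closedBall hx)).trans hN'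
  obtain ⟨N, h0, h1, h2⟩ := ((eventually_ge_atTop 0).and ((hb f hf).and (eventually_all.mpr fun i =>
    hb (pd i f) (contDiffOn_pd hU hf (m := ∞) (by simp) i)))).exists
  exact ⟨n * N + N, by positivity, HB.of_pd_le hr1 hα h0 (fun x hx =>
    differentiableAt_of_infty hU hf (hB (Metric.ball_subset_closedBall hx))) h1 h2⟩

theorem hb_loc (hr1 : 2 * r ≤ 1) (hα : α ≤ 1) (hφ : ContDiff ℝ ∞ φ) {K N : ℝ}
    (hf : ContDiffOn ℝ ∞ f (Metric.ball x₀ r)) (hN : 0 ≤ N) (hK0 : 0 ≤ K) (hK : ∀ x, |φ x| ≤ K)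
    (hK' : ∀ i x, |pd i φ x| ≤ K) (hfN : ∀ x ∈ Metric.ball x₀ r, ∀ k,
      |(dd e)^[k] f x| ≤ N * N ^ k * k.factorial)
    (hfN' : ∀ i, ∀ x ∈ Metric.ball x₀ r, ∀ k,
      |(dd e)^[k] (pd i f) x| ≤ N * N ^ k * k.factorial) (k : ℕ) :
    HB (Metric.ball x₀ r) α ((n * N + N) * (2 * (K * N)) ^ k) (loc φ e k f) := by
  have hloc : ∀ f' : Pt n → ℝ, (∀ x ∈ Metric.ball x₀ r, ∀ k,
      |(dd e)^[k] f' x| ≤ N * N ^ k * k.factorial) → ∀ x ∈ Metric.ball x₀ r,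
      |loc φ e k f' x| ≤ N * (K * N) ^ k := fun f' hf' x hx => by
    have hk : (0 : ℝ) < k.factorial := by positivity
    rw [loc, abs_mul, abs_pow, abs_div, Nat.abs_cast]
    calc |φ x| ^ k * (|(dd e)^[k] f' x| / k.factorial) ≤ K ^ k * (N * N ^ k) := by
          gcongr
          · exact hK x
          · rw [div_le_iff₀ hk]; exact hf' x hx k
      _ = N * (K * N) ^ k := by rw [mul_pow]; ring
  have hpred : ∀ x ∈ Metric.ball x₀ r, K * |locPred φ e k (dd e f) x| ≤ k * (N * (K * N) ^ k) := by
    intro x hx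
    cases k with
    | zero => simp [locPred]
    | succ k =>
      have hk : (0 : ℝ) < k.factorial := by positivity
      rw [locPred, loc, abs_mul, abs_pow, abs_div, Nat.abs_cast, ← Function.iterate_succ_apply]
      calc K * (|φ x| ^ k * (|(dd e)^[k + 1] f x| / k.factorial))
          ≤ K * (K ^ k * (N * N ^ (k + 1) * (k + 1))) := by
            gcongr
            · exact hK x
            · rw [div_le_iff₀ hk]
              refine (hfN x hx (k + 1)).trans_eq ?_
              rw [Nat.factorial_succ]; push_cast; ring
        _ = _ := by push_cast; rw [mul_pow]; ring
  have hd : ∀ x ∈ Metric.ball x₀ r, DifferentiableAt ℝ (loc φ e k f) x := fun x hx => by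
    have := differentiableAt_of_infty Metric.isOpen_ball
      (contDiffOn_dd_iterate (e := e) Metric.isOpen_ball hf k) hx
    have h1 : loc φ e k f = fun x => φ x ^ k * ((dd e)^[k] f x * (k.factorial : ℝ)⁻¹) := by
      ext y; rw [loc, div_eq_mul_inv]
    rw [h1]
    exact ((hφ.differentiable (by simp) x).fun_pow k).fun_mul (this.mul_const _)
  have h2 : (k : ℝ) + 1 ≤ 2 ^ k := by exact_mod_cast Nat.lt_two_pow_self
  have hp : ∀ i, ∀ x ∈ Metric.ball x₀ r, |pd i (loc φ e k f) x| ≤ N * (2 * (K * N)) ^ k := by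
    intro i x hx
    rw [pd_loc Metric.isOpen_ball hφ hf i k hx]
    refine (abs_add_le _ _).trans ?_
    rw [abs_mul]
    calc _ ≤ N * (K * N) ^ k + k * (N * (K * N) ^ k) := by
          refine add_le_add (hloc _ (hfN' i) x hx) (le_trans ?_ (hpred x hx))
          gcongr
          exact hK' i x
      _ = (N * (K * N) ^ k) * (k + 1) := by ring
      _ ≤ (N * (K * N) ^ k) * 2 ^ k := by gcongr
      _ = _ := by rw [mul_pow 2]; ring
  have := HB.of_pd_le hr1 hα (by positivity) hd (fun x hx => (hloc f hfN x hx).trans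
    (show _ ≤ N * (2 * (K * N)) ^ k from ?_)) hp
  · convert this using 1; ring
  · have : 0 ≤ K * N := by positivity
    have : K * N ≤ 2 * (K * N) := by linarith
    exact mul_le_mul_of_nonneg_left (pow_le_pow_left₀ ‹_› this k) hN

end AnalyticBounds

section LocalizedEquation

variable {n : ℕ} {B : Set (Pt n)} {f h φ w : Pt n → ℝ} {e : Pt n} {α K q : ℝ} {k : ℕ}

theorem HB.neg (hf : HB B α q f) : HB B α q fun x => -f x := by
  simpa using hf.const_mul (-1)

theorem hb_loc_dd (hB : IsOpen B) (hf : ContDiffOn ℝ ∞ f B) (he : ‖e‖ ≤ 1) (hq : 0 ≤ q)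
    (h : ∀ i, HB B α q (loc φ e k (pd i f))) : HB B α (n * q) (loc φ e k (dd e f)) := by
  refine ((HB.sum Finset.univ fun i _ => (h i).const_mul (e i)).congr (loc_dd hB hf k)).mono ?_
  calc ∑ i, |e i| * q ≤ ∑ _ : Fin n, q := Finset.sum_le_sum fun i _ =>
        mul_le_of_le_one_left hq ((norm_le_pi_norm e i).trans he)
    _ = n * q := by simp

theorem hb_loc_succ (hB : IsOpen B) (hf : ContDiffOn ℝ ∞ f B) (he : ‖e‖ ≤ 1) (hq : 0 ≤ q)
    (hK : 0 ≤ K) (hφ : HB B α K φ) (h : ∀ i, HB B α q (loc φ e k (pd i f))) :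
    HB B α (2 * (K * (n * q))) (loc φ e (k + 1) f) := by
  refine (((hφ.mul (hb_loc_dd hB hf he hq h)).const_mul ((k : ℝ) + 1)⁻¹).congr
    fun x _ => loc_succ k x).mono ?_
  rw [abs_of_nonneg (by positivity)]
  exact mul_le_of_le_one_left (by positivity)
    (inv_le_one_of_one_le₀ (by linarith [(Nat.cast_nonneg k : (0 : ℝ) ≤ k)]))

/-- The second derivatives of `loc φ e (k + 1) w`, up to terms involving only lower indices. -/
theorem exists_pd_pd_loc (hB : IsOpen B) (hw : ContDiffOn ℝ ∞ w B) (he : ‖e‖ ≤ 1) (hq : 0 ≤ q)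
    (hφ : ContDiff ℝ ∞ φ) (hφ₁ : ∀ i, HB B α K (pd i φ))
    (hφ₂ : ∀ i l, HB B α K (pd l (pd i φ)))
    (h₁ : ∀ i, HB B α q (loc φ e k (pd i w))) (h₂ : ∀ i l, HB B α q (loc φ e k (pd l (pd i w))))
    (h₃ : ∀ i l, HB B α q (locPred φ e k (pd l (pd i w)))) (i l : Fin n) :
    ∃ E, HB B α ((6 * K * n + 4 * K ^ 2 * n ^ 2) * q) E ∧
      ∀ x ∈ B, pd l (pd i (loc φ e (k + 1) w)) x = loc φ e (k + 1) (pd l (pd i w)) x + E x := by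
  have hpw : ∀ i, ContDiffOn ℝ ∞ (pd i w) B := fun i => contDiffOn_pd hB hw (m := ∞) (by simp) i
  have hdw : ContDiffOn ℝ ∞ (dd e w) B := contDiffOn_dd hB hw
  have hcomm : ∀ l, EqOn (pd l (dd e w)) (dd e (pd l w)) B := pd_dd hB hw
  have hpp : HB B α (n * (n * q)) (locPred φ e k (dd e (dd e w))) := by
    cases k with
    | zero =>
      refine ⟨fun x _ => ?_, fun x _ y _ => ?_⟩
      · simp only [locPred, abs_zero]; positivity
      · simp only [locPred, sub_zero, abs_zero]; positivity
    | succ k =>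
      refine hb_loc_dd hB hdw he (by positivity) fun i => ?_
      exact (hb_loc_dd hB (hpw i) he hq (h₃ i)).congr (loc_eqOn hB (hcomm i) k)
  refine ⟨fun x => pd l φ x * loc φ e k (dd e (pd i w)) x + pd l (pd i φ) x * loc φ e k (dd e w) x
    + pd i φ x * (loc φ e k (dd e (pd l w)) x + pd l φ x * locPred φ e k (dd e (dd e w)) x), ?_, ?_⟩
  · refine ((((hφ₁ l).mul (hb_loc_dd hB (hpw i) he hq (h₂ i))).add
      ((hφ₂ i l).mul (hb_loc_dd hB hw he hq h₁))).add ((hφ₁ i).mul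
        ((hb_loc_dd hB (hpw l) he hq (h₂ l)).add ((hφ₁ l).mul hpp)))).mono (le_of_eq ?_)
    ring
  · intro x hx
    have hd : ∀ {f : Pt n → ℝ}, ContDiffOn ℝ ∞ f B → DifferentiableAt ℝ f x := fun hf =>
      differentiableAt_of_infty hB hf hx
    have hloc : ∀ {f : Pt n → ℝ} (m : ℕ), ContDiffOn ℝ ∞ f B →
        ContDiffOn ℝ ∞ (loc φ e m f) B := fun {f} m hf => by
      unfold loc
      exact (hφ.contDiffOn.pow m).mul ((contDiffOn_dd_iterate hB hf m).div_const _)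
    have h1 : EqOn (pd i (loc φ e (k + 1) w))
        (fun x => loc φ e (k + 1) (pd i w) x + pd i φ x * loc φ e k (dd e w) x) B :=
      pd_loc hB hφ hw i (k + 1)
    have hpφ : DifferentiableAt ℝ (pd i φ) x :=
      (contDiff_pd (m := ∞) hφ le_rfl i).differentiable (by simp) x
    rw [(Filter.eventuallyEq_of_mem (hB.mem_nhds hx) h1).pd_eq,
      pd_add (hd (hloc _ (hpw i))) (hpφ.fun_mul (hd (hloc k hdw))),
      pd_mul hpφ (hd (hloc k hdw)), pd_loc hB hφ (hpw i) l (k + 1) hx, pd_loc hB hφ hdw l k hx]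
    beta_reduce
    rw [loc_eqOn hB (hcomm l) k hx]
    simp only [locPred]
    ring

theorem exists_loc_mul {A M T R : ℝ} (hB : IsOpen B) (hf : ContDiffOn ℝ ∞ f B)
    (hh : ContDiffOn ℝ ∞ h B) (hA : 0 ≤ A) (hM : 0 ≤ M) (hT : 0 ≤ T) (hR : 2 * M ≤ R)
    (hfk : ∀ k, HB B α (A * M ^ k) (loc φ e k f))
    (hhk : ∀ j ≤ k, HB B α (T * R ^ j) (loc φ e j h)) :
    ∃ E, HB B α (4 * A * M * (T * R ^ k)) E ∧
      ∀ x ∈ B, loc φ e (k + 1) (fun x => f x * h x) x = f x * loc φ e (k + 1) h x + E x := by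
  refine ⟨fun x => ∑ p ∈ Finset.HasAntidiagonal.antidiagonal k,
    loc φ e (p.1 + 1) f x * loc φ e p.2 h x, ?_, fun x hx => ?_⟩
  · refine (HB.sum _ fun p hp => (hfk (p.1 + 1)).mul (hhk p.2 ?_)).mono ?_
    · exact (Finset.HasAntidiagonal.mem_antidiagonal.mp hp) ▸ Nat.le_add_left _ _
    calc ∑ p ∈ Finset.HasAntidiagonal.antidiagonal k, 2 * (A * M ^ (p.1 + 1) * (T * R ^ p.2))
        ≤ ∑ p ∈ Finset.HasAntidiagonal.antidiagonal k, 2 * A * M * (T * R ^ k) * (1 / 2) ^ p.1 := by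
          refine Finset.sum_le_sum fun p hp => ?_
          rw [← Finset.HasAntidiagonal.mem_antidiagonal.mp hp, pow_add R, pow_succ]
          have h1 : M ^ p.1 ≤ (R * (1 / 2)) ^ p.1 := by gcongr; linarith
          rw [mul_pow] at h1
          have h0 : 0 ≤ R := by linarith
          calc _ = 2 * A * M * T * R ^ p.2 * M ^ p.1 := by ring
            _ ≤ 2 * A * M * T * R ^ p.2 * (R ^ p.1 * (1 / 2) ^ p.1) := by gcongr
            _ = _ := by ring
      _ = 2 * A * M * (T * R ^ k) * ∑ i ∈ Finset.range (k + 1), (1 / 2 : ℝ) ^ i := by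
          rw [← Finset.mul_sum, Finset.Nat.sum_antidiagonal_eq_sum_range_succ_mk]
      _ ≤ 2 * A * M * (T * R ^ k) * 2 := by
          have h0 : 0 ≤ R := by linarith
          gcongr
          exact sum_geometric_two_le _
      _ = _ := by ring
  · rw [loc_mul hB hf hh (k + 1) hx]
    beta_reduce
    rw [Finset.Nat.sum_antidiagonal_succ, loc_zero]

theorem loc_add (hB : IsOpen B) (hf : ContDiffOn ℝ ∞ f B) (hh : ContDiffOn ℝ ∞ h B) (k : ℕ) :
    EqOn (loc φ e k fun x => f x + h x) (fun x => loc φ e k f x + loc φ e k h x) B := by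
  have := loc_sum (φ := φ) (e := e) hB Finset.univ (f := fun b : Bool => cond b f h)
    (fun b _ => by cases b <;> assumption) k
  simpa using this

theorem loc_const_zero (hB : IsOpen B) (k : ℕ) : EqOn (loc φ e k fun _ => 0) (fun _ => 0) B := by
  simpa using loc_sum (φ := φ) (e := e) hB (∅ : Finset ℕ) (f := fun _ _ => 0) (by simp) k

/-- Applying `op a` to `loc φ e (k + 1) w` for a solution `w` produces only lower indices. -/
theorem hb_op_loc {a : Fin n → Fin n → Pt n → ℝ} {b : Fin n → Pt n → ℝ} {c : Pt n → ℝ}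
    {A M T R : ℝ} (hB : IsOpen B) (ha : ∀ i j, ContDiffOn ℝ ∞ (a i j) B)
    (hb : ∀ i, ContDiffOn ℝ ∞ (b i) B) (hc : ContDiffOn ℝ ∞ c B) (hw : ContDiffOn ℝ ∞ w B)
    (hL : ∀ x ∈ B, op a w x + ∑ i, b i x * pd i w x + c x * w x = 0) (he : ‖e‖ ≤ 1)
    (hK : 0 ≤ K) (hφ : HB B α K φ) (hA : 0 ≤ A) (hM : 0 ≤ M) (hT : 0 ≤ T) (hR : 2 * M ≤ R)
    (hak : ∀ i j k, HB B α (A * M ^ k) (loc φ e k (a i j)))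
    (hbk : ∀ i k, HB B α (A * M ^ k) (loc φ e k (b i)))
    (hck : ∀ k, HB B α (A * M ^ k) (loc φ e k c))
    (h₀ : ∀ j ≤ k, HB B α (T * R ^ j) (loc φ e j w))
    (h₁ : ∀ j ≤ k, ∀ i, HB B α (T * R ^ j) (loc φ e j (pd i w)))
    (h₂ : ∀ j ≤ k, ∀ i l, HB B α (T * R ^ j) (loc φ e j (pd l (pd i w))))
    {D : ℝ} {E : Fin n → Fin n → Pt n → ℝ} (hE : ∀ i l, HB B α (D * (T * R ^ k)) (E i l))
    (hE' : ∀ i l, ∀ x ∈ B,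
      pd l (pd i (loc φ e (k + 1) w)) x = loc φ e (k + 1) (pd l (pd i w)) x + E i l x) :
    HB B α (((n ^ 2 + n + 1) * (4 * A * M) + (n + 1) * (4 * A * K * n) + n ^ 2 * (2 * A * D))
      * (T * R ^ k)) (op a (loc φ e (k + 1) w)) := by
  have hQ : 0 ≤ T * R ^ k := by
    have : 0 ≤ R := by linarith
    positivity
  have hpw : ∀ i, ContDiffOn ℝ ∞ (pd i w) B := fun i => contDiffOn_pd hB hw (m := ∞) (by simp) i
  have hppw : ∀ i l, ContDiffOn ℝ ∞ (pd l (pd i w)) B := fun i l =>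
    contDiffOn_pd hB (hpw i) (m := ∞) (by simp) l
  choose Ea hEa hEa' using fun i j =>
    exists_loc_mul hB (ha i j) (hppw i j) hA hM hT hR (hak i j) fun m hm => h₂ m hm i j
  choose Eb hEb hEb' using fun i =>
    exists_loc_mul hB (hb i) (hpw i) hA hM hT hR (hbk i) fun m hm => h₁ m hm i
  obtain ⟨Ec, hEc, hEc'⟩ := exists_loc_mul hB hc hw hA hM hT hR hck h₀
  have ha0 : ∀ i j, HB B α A (a i j) := fun i j => by simpa [loc_zero] using hak i j 0
  have hb0 : ∀ i, HB B α A (b i) := fun i => by simpa [loc_zero] using hbk i 0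
  have hc0 : HB B α A c := by simpa [loc_zero] using hck 0
  have hw1 := hb_loc_succ hB hw he hQ hK hφ (h₁ k le_rfl)
  have hpw1 := fun i => hb_loc_succ hB (hpw i) he hQ hK hφ (h₂ k le_rfl i)
  have hF := (((HB.sum Finset.univ fun i _ => HB.sum Finset.univ fun j _ => hEa i j).neg.add
    (HB.sum Finset.univ fun i _ => ((hb0 i).mul (hpw1 i)).add (hEb i)).neg).add
    ((hc0.mul hw1).add hEc).neg).add
    (HB.sum Finset.univ fun i _ => HB.sum Finset.univ fun j _ => (ha0 i j).mul (hE i j))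
  refine (hF.congr fun x hx => ?_).mono (le_of_eq ?_)
  · have hab : ∀ i j, ContDiffOn ℝ ∞ (fun x => a i j x * pd j (pd i w) x) B := fun i j =>
      (ha i j).mul (hppw i j)
    have hbb : ∀ i, ContDiffOn ℝ ∞ (fun x => b i x * pd i w x) B := fun i => (hb i).mul (hpw i)
    have hcc : ContDiffOn ℝ ∞ (fun x => c x * w x) B := hc.mul hw
    have hsa : ∀ i, ContDiffOn ℝ ∞ (fun x => ∑ j, a i j x * pd j (pd i w) x) B := fun i =>
      ContDiffOn.sum fun j _ => hab i j
    have hsb : ContDiffOn ℝ ∞ (fun x => ∑ i, b i x * pd i w x) B := ContDiffOn.sum fun i _ => hbb i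
    have hop : ContDiffOn ℝ ∞ (op a w) B := ContDiffOn.sum fun i _ => hsa i
    have h1 : loc φ e (k + 1)
        (fun x => op a w x + ∑ i, b i x * pd i w x + c x * w x) x = 0 :=
      (loc_eqOn hB (fun x hx => hL x hx) (k + 1) hx).trans (loc_const_zero hB (k + 1) hx)
    have h2 : loc φ e (k + 1) (op a w) x
        = ∑ i, ∑ j, (a i j x * loc φ e (k + 1) (pd j (pd i w)) x + Ea i j x) :=
      (loc_sum hB Finset.univ (fun i _ => hsa i) (k + 1) hx).trans
        (Finset.sum_congr rfl fun i _ => (loc_sum hB Finset.univ (fun j _ => hab i j) (k + 1) hx).trans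
          (Finset.sum_congr rfl fun j _ => hEa' i j x hx))
    have h3 : loc φ e (k + 1) (fun x => ∑ i, b i x * pd i w x) x
        = ∑ i, (b i x * loc φ e (k + 1) (pd i w) x + Eb i x) :=
      (loc_sum hB Finset.univ (fun i _ => hbb i) (k + 1) hx).trans
        (Finset.sum_congr rfl fun i _ => hEb' i x hx)
    rw [loc_add hB (hop.add hsb) hcc (k + 1) hx] at h1
    beta_reduce at h1
    rw [loc_add hB hop hsb (k + 1) hx] at h1
    beta_reduce at h1
    rw [h2, h3, hEc' x hx] at h1
    simp_rw [Finset.sum_add_distrib] at h1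
    have h4 : op a (loc φ e (k + 1) w) x = ∑ i, ∑ j, a i j x * loc φ e (k + 1) (pd j (pd i w)) x
        + ∑ i, ∑ j, a i j x * E i j x := by
      simp_rw [op, hE' _ _ x hx, mul_add, Finset.sum_add_distrib]
    rw [h4]
    simp_rw [Finset.sum_add_distrib]
    linarith
  · simp only [Finset.sum_const, Finset.card_univ, Fintype.card_fin, nsmul_eq_mul]
    ring

end LocalizedEquation

section GeometricBounds

variable {n : ℕ} {B : Set (Pt n)} {φ χ w : Pt n → ℝ} {e : Pt n} {α K : ℝ}

theorem hb_locPred {q R : ℝ} {f : Pt n → ℝ} (hq : 0 ≤ q) (hR : 1 ≤ R) (k : ℕ)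
    (h : ∀ j ≤ k, HB B α (q * R ^ j) (loc φ e j f)) : HB B α (q * R ^ k) (locPred φ e k f) := by
  cases k with
  | zero =>
    refine ⟨fun x _ => ?_, fun x _ y _ => ?_⟩
    · simp only [locPred, abs_zero]; positivity
    · simp only [locPred, sub_zero, abs_zero]; positivity
  | succ k =>
    refine (h k k.le_succ).mono ?_
    gcongr
    exact k.le_succ

/-- Geometric bounds on all the localized derivatives of a smooth solution `w` of an elliptic
equation whose coefficients satisfy such bounds. -/
theorem exists_hb_loc_of_equation {a : Fin n → Fin n → Pt n → ℝ} {b : Fin n → Pt n → ℝ}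
    {c : Pt n → ℝ} {A M T C L : ℝ} (hB : IsOpen B) (ha : ∀ i j, ContDiffOn ℝ ∞ (a i j) B)
    (hb : ∀ i, ContDiffOn ℝ ∞ (b i) B) (hc : ContDiffOn ℝ ∞ c B) (hw : ContDiffOn ℝ ∞ w B)
    (hL : ∀ x ∈ B, op a w x + ∑ i, b i x * pd i w x + c x * w x = 0)
    (hφ : ContDiff ℝ ∞ φ) (hφs : tsupport φ ⊆ B) (hK : 0 ≤ K) (hφ₀ : HB B α K φ)
    (hφ₁ : ∀ i, HB B α K (pd i φ)) (hφ₂ : ∀ i l, HB B α K (pd l (pd i φ)))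
    (hA : 0 ≤ A) (hM : 0 ≤ M) (hT : 0 ≤ T)
    (hak : ∀ i j e, ‖e‖ ≤ 1 → ∀ k, HB B α (A * M ^ k) (loc φ e k (a i j)))
    (hbk : ∀ i e, ‖e‖ ≤ 1 → ∀ k, HB B α (A * M ^ k) (loc φ e k (b i)))
    (hck : ∀ e, ‖e‖ ≤ 1 → ∀ k, HB B α (A * M ^ k) (loc φ e k c))
    (hw₀ : HB B α T w) (hw₁ : ∀ i, HB B α T (pd i w)) (hw₂ : ∀ i l, HB B α T (pd l (pd i w)))
    (hL0 : 0 ≤ L) (hχ : HB univ α L χ) (hχ0 : ∀ x ∉ B, χ x = 0) (hχ1 : ∀ x ∈ tsupport φ, χ x = 1)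
    (hC : 0 ≤ C) (hS : ∀ v N, 0 ≤ N → ContDiff ℝ 2 v → tsupport v ⊆ B → Hol α N (op a v) →
      ∀ k l, HB univ α (C * N) (pd k (pd l v))) :
    ∃ R, 0 ≤ R ∧ ∀ e, ‖e‖ ≤ 1 → ∀ k, HB B α (T * R ^ k) (loc φ e k w) := by
  set D := 6 * K * n + 4 * K ^ 2 * n ^ 2 with hD
  set D' := (n ^ 2 + n + 1) * (4 * A * M) + (n + 1) * (4 * A * K * n) + n ^ 2 * (2 * A * D) with hD'
  have hD0 : 0 ≤ D := by positivity
  have hD'0 : 0 ≤ D' := by positivity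
  obtain ⟨R, hR⟩ : ∃ R, R = 1 + 2 * M + 2 * K * n + (C * (2 * (L * D')) + D) := ⟨_, rfl⟩
  have hR1 : 1 ≤ R := by
    rw [hR, add_assoc, add_assoc]; exact le_add_of_nonneg_right (by positivity)
  have hR2 : 2 * M ≤ R := by
    have : 0 ≤ 1 + 2 * K * n + (C * (2 * (L * D')) + D) := by positivity
    linarith
  have hR3 : 2 * K * n ≤ R := by
    have : 0 ≤ 1 + 2 * M + (C * (2 * (L * D')) + D) := by positivity
    linarith
  have hR4 : C * (2 * (L * D')) + D ≤ R := by
    have : 0 ≤ 1 + 2 * M + 2 * K * n := by positivity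
    linarith
  clear_value D D'
  refine ⟨R, by linarith, fun e he k => ?_⟩
  suffices h : ∀ k, HB B α (T * R ^ k) (loc φ e k w) ∧
      (∀ i, HB B α (T * R ^ k) (loc φ e k (pd i w))) ∧
      (∀ i l, HB B α (T * R ^ k) (loc φ e k (pd l (pd i w)))) from (h k).1
  clear k
  intro k
  induction k using Nat.strong_induction_on with
  | _ k ih =>
  cases k with
  | zero => simpa [loc_zero] using ⟨hw₀, hw₁, hw₂⟩
  | succ k =>
    have hi := fun j (hj : j ≤ k) => ih j (Nat.lt_succ_of_le hj)
    have hQ : 0 ≤ T * R ^ k := by positivity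
    have hstep : ∀ {s f}, s ≤ R → HB B α (s * (T * R ^ k)) f → HB B α (T * R ^ (k + 1)) f :=
      fun hs hf =>
      hf.mono ((mul_le_mul_of_nonneg_right hs hQ).trans_eq (by ring))
    have hpw : ∀ i, ContDiffOn ℝ ∞ (pd i w) B := fun i =>
      contDiffOn_pd hB hw (m := ∞) (by simp) i
    refine ⟨hstep hR3 ((hb_loc_succ hB hw he hQ hK hφ₀ (hi k le_rfl).2.1).mono (le_of_eq (by ring))),
      fun i => hstep hR3 ((hb_loc_succ hB (hpw i) he hQ hK hφ₀ ((hi k le_rfl).2.2 i)).mono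
        (le_of_eq (by ring))), fun i l => ?_⟩
    choose E hE hE' using exists_pd_pd_loc hB hw he hQ hφ hφ₁ hφ₂ (hi k le_rfl).2.1
      (hi k le_rfl).2.2 fun i l => hb_locPred hT hR1 k fun j hj => (hi j hj).2.2 i l
    rw [← hD] at hE
    have hop := hb_op_loc hB ha hb hc hw hL he hK hφ₀ hA hM hT hR2 (fun i j => hak i j e he)
      (fun i => hbk i e he) (hck e he) (fun j hj => (hi j hj).1) (fun j hj => (hi j hj).2.1)
      (fun j hj => (hi j hj).2.2) hE hE'
    rw [← hD'] at hop
    have hχop : (fun x => χ x * op a (loc φ e (k + 1) w) x) = op a (loc φ e (k + 1) w) := by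
      ext x
      by_cases hx : x ∈ tsupport φ
      · rw [hχ1 x hx, one_mul]
      · rw [op_eq_zero_of_notMem_tsupport fun h => hx (tsupport_loc_subset k h), mul_zero]
    have hHol := hχ.hol_mul hχ0 (by positivity) hop
    rw [hχop] at hHol
    have hSch := (hS _ _ (by positivity) ((contDiff_loc hB hφ hφs hw k).of_le two_le_infty)
      ((tsupport_loc_subset k).trans hφs) hHol l i).mono_set (subset_univ B)
    refine hstep hR4 (((hSch.add (hE i l).neg).congr fun x hx => ?_).mono (le_of_eq ?_))
    · rw [hE' i l x hx]; ring
    · ring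

end GeometricBounds

section AnalyticRegularity

variable {n : ℕ} {U B : Set (Pt n)} {w : Pt n → ℝ} {α : ℝ} {x₀ : Pt n}

theorem HB.eventually {M : ℝ} {f : Pt n → ℝ} (hf : HB B α M f) : ∀ᶠ N in atTop, HB B α N f :=
  (eventually_ge_atTop M).mono fun _ h => hf.mono h

/-- Smooth solutions of second order linear elliptic equations with analytic coefficients are
analytic. -/
theorem analyticAt_of_equation [NeZero n] {a : Fin n → Fin n → Pt n → ℝ} {b : Fin n → Pt n → ℝ}
    {c : Pt n → ℝ} (hU : IsOpen U) (ha : ∀ i j, AnalyticOnNhd ℝ (a i j) U)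
    (hb : ∀ i, AnalyticOnNhd ℝ (b i) U) (hc : AnalyticOnNhd ℝ c U) (hw : ContDiffOn ℝ ∞ w U)
    (hL : ∀ x ∈ U, op a w x + ∑ i, b i x * pd i w x + c x * w x = 0) (hx₀ : x₀ ∈ U)
    (hpos : (Matrix.of fun i j => a i j x₀).PosDef) : AnalyticAt ℝ w x₀ := by
  have hα : (1 / 2 : ℝ) ∈ Ioo (0 : ℝ) 1 := by constructor <;> norm_num
  obtain ⟨r₁, C, hr₁, hr₁', hC, hrU, hS⟩ := exists_local_schauder_on hU
    (fun i j => (ha i j).contDiffOn hU.uniqueDiffOn) hx₀ hpos hα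
  obtain ⟨N, hN0, hNr, hNa, hNa', hNb, hNb', hNc, hNc'⟩ :=
    ((eventually_gt_atTop (0 : ℝ)).and
    (((tendsto_inv_atTop_zero (𝕜 := ℝ)).eventually_le_const (half_pos hr₁)).and
    ((eventually_all.mpr fun i => eventually_all.mpr fun j =>
      eventually_dd_iterate_le (ha i j x₀ hx₀)).and
    ((eventually_all.mpr fun i => eventually_all.mpr fun j => eventually_all.mpr fun l =>
      eventually_dd_iterate_le (analyticOnNhd_pd (ha i j) l x₀ hx₀)).and
    ((eventually_all.mpr fun i => eventually_dd_iterate_le (hb i x₀ hx₀)).and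
    ((eventually_all.mpr fun i => eventually_all.mpr fun l =>
      eventually_dd_iterate_le (analyticOnNhd_pd (hb i) l x₀ hx₀)).and
    ((eventually_dd_iterate_le (hc x₀ hx₀)).and
    (eventually_all.mpr fun l =>
      eventually_dd_iterate_le (analyticOnNhd_pd hc l x₀ hx₀))))))))).exists
  obtain ⟨r, hr⟩ : ∃ r, r = N⁻¹ := ⟨_, rfl⟩
  rw [← hr] at hNr hNa hNa' hNb hNb' hNc hNc'
  have hr0 : 0 < r := hr ▸ inv_pos.mpr hN0
  have hr1 : 2 * r ≤ 1 := by linarith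
  have hcU : Metric.closedBall x₀ r ⊆ U :=
    (Metric.closedBall_subset_ball (by linarith)).trans hrU
  have hBU : Metric.ball x₀ r ⊆ U := Metric.ball_subset_closedBall.trans hcU
  have hB := Metric.isOpen_ball (x := x₀) (ε := r)
  obtain ⟨χ, hχ, hχs, hχ1⟩ := exists_cutoff x₀ hr0
  obtain ⟨r', hr', hχ1'⟩ := Metric.eventually_nhds_iff_ball.mp hχ1
  obtain ⟨φ, hφ, hφs, hφ1⟩ := exists_cutoff x₀ (lt_min hr0 hr')
  obtain ⟨s, hs, hφ1'⟩ := Metric.eventually_nhds_iff_ball.mp hφ1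
  have hφr : tsupport φ ⊆ Metric.ball x₀ r := hφs.trans (Metric.ball_subset_ball (min_le_left _ _))
  have hφc := hasCompactSupport_of_tsupport_subset_ball hφr
  obtain ⟨L, hL0, hχL⟩ := exists_hb_of_contDiff_of_hasCompactSupport (hχ.of_le (by exact_mod_cast le_top))
    (hasCompactSupport_of_tsupport_subset_ball hχs) hα
  have hpφ : ∀ i, ContDiff ℝ ∞ (pd i φ) := fun i => contDiff_pd (m := ∞) hφ le_rfl i
  have hφhb : ∀ {ψ : Pt n → ℝ}, ContDiff ℝ ∞ ψ → HasCompactSupport ψ →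
      ∀ᶠ K in atTop, HB univ (1 / 2) K ψ := fun hψ hψc =>
    (exists_hb_of_contDiff_of_hasCompactSupport (hψ.of_le (by exact_mod_cast le_top))
      hψc hα).elim fun _ h => h.2.eventually
  obtain ⟨K, hK0, hK, hK', hK''⟩ := ((eventually_ge_atTop (0 : ℝ)).and ((hφhb hφ hφc).and
    ((eventually_all.mpr fun i => hφhb (hpφ i) (hasCompactSupport_pd hφc i)).and
    (eventually_all.mpr fun i => eventually_all.mpr fun l =>
      hφhb (contDiff_pd (m := ∞) (hpφ i) le_rfl l)
        (hasCompactSupport_pd (hasCompactSupport_pd hφc i) l))))).exists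
  have hwhb : ∀ {f : Pt n → ℝ}, ContDiffOn ℝ ∞ f U →
      ∀ᶠ K in atTop, HB (Metric.ball x₀ r) (1 / 2) K f := fun hf =>
    (exists_hb_of_contDiffOn hr1 hα.2.le hU hcU hf).elim fun _ h => h.2.eventually
  have hpw : ∀ i, ContDiffOn ℝ ∞ (pd i w) U := fun i => contDiffOn_pd hU hw (m := ∞) (by simp) i
  obtain ⟨T, hT0, hT, hT', hT''⟩ := ((eventually_ge_atTop (0 : ℝ)).and ((hwhb hw).and
    ((eventually_all.mpr fun i => hwhb (hpw i)).and
    (eventually_all.mpr fun i => eventually_all.mpr fun l =>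
      hwhb (contDiffOn_pd hU (hpw i) (m := ∞) (by simp) l))))).exists
  have hloc : ∀ {f : Pt n → ℝ}, AnalyticOnNhd ℝ f U →
      (∀ x ∈ Metric.ball x₀ r, ∀ e, ‖e‖ ≤ 1 → ∀ k, |(dd e)^[k] f x| ≤ N * N ^ k * k.factorial) →
      (∀ i, ∀ x ∈ Metric.ball x₀ r, ∀ e, ‖e‖ ≤ 1 → ∀ k,
        |(dd e)^[k] (pd i f) x| ≤ N * N ^ k * k.factorial) → ∀ e, ‖e‖ ≤ 1 → ∀ k,
      HB (Metric.ball x₀ r) (1 / 2) ((n * N + N) * (2 * (K * N)) ^ k) (loc φ e k f) :=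
    fun {f} hf h h' e he k => hb_loc hr1 hα.2.le hφ ((hf.contDiffOn hU.uniqueDiffOn).mono hBU)
      hN0.le hK0 (fun x => hK.1 x (mem_univ x)) (fun i x => (hK' i).1 x (mem_univ x))
      (fun x hx => h x hx e he) (fun i x hx => h' i x hx e he) k
  obtain ⟨R, hR, hRw⟩ := exists_hb_loc_of_equation hB
    (fun i j => ((ha i j).contDiffOn hU.uniqueDiffOn).mono hBU)
    (fun i => ((hb i).contDiffOn hU.uniqueDiffOn).mono hBU)
    ((hc.contDiffOn hU.uniqueDiffOn).mono hBU) (hw.mono hBU) (fun x hx => hL x (hBU hx)) hφ hφr hK0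
    (hK.mono_set (subset_univ _)) (fun i => (hK' i).mono_set (subset_univ _))
    (fun i l => (hK'' i l).mono_set (subset_univ _)) (by positivity) (by positivity) hT0
    (fun i j => hloc (ha i j) (hNa i j) (hNa' i j)) (fun i => hloc (hb i) (hNb i) (hNb' i))
    (hloc hc hNc hNc') hT hT' hT'' hL0 hχL
    (fun x hx => image_eq_zero_of_notMem_tsupport fun h => hx (hχs h))
    (fun x hx => hχ1' x (Metric.ball_subset_ball (min_le_right _ _) (hφs hx))) hC
    (fun v N' hN' hv hvs hh k l => by
      have hvs' := hvs.trans (Metric.ball_subset_ball (show r ≤ r₁ by linarith))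
      have h1 := hS v N' hN' hv hvs' hh
      exact HB.of_hol ((bounds_of_hol_pd_pd hr₁ hr₁' hα (by positivity) hv hvs' h1).1 k l) (h1 k l))
  have hsB : Metric.ball x₀ (min s r) ⊆ Metric.ball x₀ r :=
    Metric.ball_subset_ball (min_le_right _ _)
  refine analyticAt_of_iteratedFDeriv_le (lt_min hs hr0) (hw.mono (hsB.trans hBU)) hT0 hR
    fun x hx e he k => ?_
  rw [iteratedFDeriv_diag hU hw k x (hBU (hsB hx))]
  have h1 := (hRw e he k).1 x (hsB hx)
  rw [loc, hφ1' x (Metric.ball_subset_ball (min_le_left _ _) hx), one_pow, one_mul, abs_div,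
    Nat.abs_cast, div_le_iff₀ (by positivity)] at h1
  exact h1

end AnalyticRegularity

theorem contDiffOn_infty_of_equation {n : ℕ} [NeZero n] {U : Set (Pt n)}
    {a : Fin n → Fin n → Pt n → ℝ} {b : Fin n → Pt n → ℝ} {c w : Pt n → ℝ} (hU : IsOpen U)
    (hpos : ∀ x ∈ U, (Matrix.of fun i j => a i j x).PosDef)
    (ha : ∀ i j, ContDiffOn ℝ ∞ (a i j) U) (hb : ∀ i, ContDiffOn ℝ ∞ (b i) U)
    (hc : ContDiffOn ℝ ∞ c U) (hw : ContDiffOn ℝ 2 w U)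
    (hL : ∀ x ∈ U, op a w x + ∑ i, b i x * pd i w x + c x * w x = 0) : ContDiffOn ℝ ∞ w U := by
  have hα : (1 / 2 : ℝ) ∈ Ioo (0 : ℝ) 1 := by constructor <;> norm_num
  refine contDiffOn_infty_of_hc hU hα.1 fun k => ?_
  exact (hc_add_two_of_eq_zero hU hpos hα (fun i j => HC.of_contDiffOn_infty hU hα (ha i j) (k + 1))
    (fun i => HC.of_contDiffOn_infty hU hα (hb i) k) (HC.of_contDiffOn_infty hU hα hc k) hw hL).mono
    hα hU (by omega)

theorem analyticOnNhd_of_confLap {n : ℕ} [NeZero n] {U : Set (Pt n)} (hU : IsOpen U) {g : Met n}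
    (hg : IsMetricOn g U) (h : ∀ a b, AnalyticOnNhd ℝ (fun x => g x a b) U) {u : Pt n → ℝ}
    (hu : ContDiffOn ℝ 2 u U) (hLu : ∀ x ∈ U, confLap g u x = 0) : AnalyticOnNhd ℝ u U := by
  have hP := isRegScale_analyticOnNhd (n := n) hU
  have hpos := posDef_inv_metric hg
  have ha := hP.metric_inv (k := 2) hg h
  have hb := hP.lapDrift (k := 0) hg h
  have hc := hP.confPot (k := 0) hg h
  have hL := equation_of_confLap_eq_zero (k := 0) hU hP hg h hu hLu
  have hsm : ContDiffOn ℝ ∞ u U := contDiffOn_infty_of_equation hU hpos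
    (fun i j => (ha i j).contDiffOn hU.uniqueDiffOn) (fun i => (hb i).contDiffOn hU.uniqueDiffOn)
    (AnalyticOnNhd.contDiffOn hc hU.uniqueDiffOn) hu hL
  exact fun x hx => analyticAt_of_equation hU ha hb hc hsm hL hx (hpos x hx)

end EllipticReg

open EllipticReg

/-- Theorem 2.2, part (2): regularity of quotients of solutions of the
conformal Laplace equation. -/
theorem quotient_of_solutions_regularity
    (n : ℕ) (hn : 3 ≤ n) (U : Set (Pt n)) (hU : IsOpen U)
    (g : Met n) (hgm : IsMetricOn g U)
    (u f : Pt n → ℝ) (hu : ContDiffOn ℝ 2 u U) (hf : ContDiffOn ℝ 2 f U)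
    (hLu : ∀ x ∈ U, confLap g u x = 0) (hLf : ∀ x ∈ U, confLap g f x = 0)
    (hfpos : ∀ x ∈ U, 0 < f x) :
    (∀ (k : ℕ) (α : ℝ), 2 ≤ k → α ∈ Set.Ioo (0 : ℝ) 1 → MetCHolderOn k α U g →
      CHolderOn (k + 1) α U fun x => u x / f x) ∧
    ((∀ a b, ContDiffOn ℝ (⊤ : ℕ∞) (fun x => g x a b) U) →
      ContDiffOn ℝ (⊤ : ℕ∞) (fun x => u x / f x) U) ∧
    ((∀ a b, AnalyticOnNhd ℝ (fun x => g x a b) U) →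
      AnalyticOnNhd ℝ (fun x => u x / f x) U) := by
  have : NeZero n := ⟨by omega⟩
  refine ⟨fun k α hk hα hg => ?_, fun hg => ?_, fun hg => ?_⟩
  · obtain ⟨m, rfl⟩ := Nat.exists_eq_add_of_le' hk
    exact (hc_iff_cHolderOn hU hα.1).mp (hc_div_of_confLap hU hgm hα
      (fun a b => (hc_iff_cHolderOn hU hα.1).mpr (hg a b)) hu hf hLu hLf hfpos)
  · have hα : (1 / 2 : ℝ) ∈ Set.Ioo (0 : ℝ) 1 := by constructor <;> norm_num
    exact contDiffOn_infty_of_hc hU hα.1 fun k => (hc_div_of_confLap hU hgm hα (k := k)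
      (fun a b => HC.of_contDiffOn_infty hU hα (hg a b) _) hu hf hLu hLf hfpos).mono hα hU (by omega)
  · exact fun x hx => (analyticOnNhd_of_confLap hU hgm hg hu hLu x hx).fun_div
      (analyticOnNhd_of_confLap hU hgm hg hf hLf x hx) (hfpos x hx).ne'
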